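/- Let ℓ ≥ 2, m = 2^ℓ − 2 and k = 2^{ℓ−1}. For every strictly convex body K ⊆ ℝ^m there exist k pairwise distinct lines L_1, …, L_k in ℝ^m, each an affine diameter of K in some direction, such that L_1 ∩ ⋯ ∩ L_k ∩ int(K) ≠ ∅. -/

import Mathlib

/-- `L` is a line in `ℝ^m` parallel to the (nonzero) vector `w`. -/
def IsLineParallel {m : ℕ} (w : EuclideanSpace ℝ (Fin m))
    (L : Set (EuclideanSpace ℝ (Fin m))) : Prop :=
  ∃ v : EuclideanSpace ℝ (Fin m), L = {p | ∃ t : ℝ, p = v + t • w}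

/-- `L` is an affine diameter of `K` in direction `w`: a line parallel to `w` whose
chord `K ∩ L` has maximal length among all lines parallel to `w`. -/
def IsAffineDiameter {m : ℕ} (K : Set (EuclideanSpace ℝ (Fin m)))
    (w : EuclideanSpace ℝ (Fin m)) (L : Set (EuclideanSpace ℝ (Fin m))) : Prop :=
  IsLineParallel w L ∧
    ∀ L', IsLineParallel w L' → Metric.diam (K ∩ L') ≤ Metric.diam (K ∩ L)

namespace AffineDiameter

open Matrix Filter Topology
open scoped Kronecker

set_option linter.unusedSectionVars false

/-- A finite based chain complex over `ZMod 2` with an augmentation. -/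
structure Cx (B : Type) [Fintype B] [DecidableEq B] where
  bd : Matrix B B (ZMod 2)
  aug : B → ZMod 2
  deg : B → ℕ
  bd_bd : bd * bd = 0
  aug_bd : aug ᵥ* bd = 0
  deg_lt : ∀ b' b, bd b' b ≠ 0 → deg b' < deg b


section Complexes

variable {A B C D E : Type} [Fintype A] [DecidableEq A] [Fintype B] [DecidableEq B]
  [Fintype C] [DecidableEq C] [Fintype D] [DecidableEq D] [Fintype E] [DecidableEq E]

theorem add_self_eq_zero_matrix (M : Matrix A B (ZMod 2)) : M + M = 0 := by
  ext i j
  exact CharTwo.add_self_eq_zero _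

/-- An augmentation preserving chain map, written as a matrix. -/
structure IsHom (X : Cx A) (Y : Cx B) (M : Matrix B A (ZMod 2)) : Prop where
  bd : Y.bd * M = M * X.bd
  aug : Y.aug ᵥ* M = X.aug

theorem IsHom.one (X : Cx A) : IsHom X X 1 := ⟨by simp, by simp⟩

theorem IsHom.comp {X : Cx A} {Y : Cx B} {Z : Cx C} {M : Matrix B A (ZMod 2)}
    {N : Matrix C B (ZMod 2)} (hN : IsHom Y Z N) (hM : IsHom X Y M) : IsHom X Z (N * M) :=
  ⟨by rw [← Matrix.mul_assoc, hN.bd, Matrix.mul_assoc, hM.bd, Matrix.mul_assoc],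
   by rw [← Matrix.vecMul_vecMul, hN.aug, hM.aug]⟩

theorem vecMul_kronecker (u : A → ZMod 2) (v : B → ZMod 2) (M : Matrix A C (ZMod 2))
    (N : Matrix B D (ZMod 2)) :
    (fun p : A × B => u p.1 * v p.2) ᵥ* (M ⊗ₖ N) =
      fun q : C × D => (u ᵥ* M) q.1 * (v ᵥ* N) q.2 := by
  ext ⟨c, d⟩
  simp only [Matrix.vecMul, dotProduct, Fintype.sum_prod_type, kroneckerMap_apply,
    Finset.sum_mul_sum]
  exact Finset.sum_congr rfl fun _ _ => Finset.sum_congr rfl fun _ _ => by ring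

/-- The tensor product of two complexes. -/
def Cx.tensor (X : Cx A) (Y : Cx B) : Cx (A × B) where
  bd := X.bd ⊗ₖ 1 + 1 ⊗ₖ Y.bd
  aug p := X.aug p.1 * Y.aug p.2
  deg p := X.deg p.1 + Y.deg p.2
  bd_bd := by
    simp only [Matrix.add_mul, Matrix.mul_add, ← Matrix.mul_kronecker_mul, X.bd_bd, Y.bd_bd,
      Matrix.mul_one, Matrix.one_mul, Matrix.zero_kronecker, Matrix.kronecker_zero, zero_add,
      add_zero]
    exact add_self_eq_zero_matrix _
  aug_bd := by
    rw [Matrix.vecMul_add, vecMul_kronecker, vecMul_kronecker, X.aug_bd, Y.aug_bd]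
    ext; simp
  deg_lt := by
    rintro ⟨a', b'⟩ ⟨a, b⟩ h
    simp only [Matrix.add_apply, kroneckerMap_apply, Matrix.one_apply] at h
    by_cases hb : b' = b
    · subst hb
      by_cases ha : X.bd a' a = 0
      · by_cases ha' : a' = a
        · subst ha'
          have hd : Y.bd b' b' ≠ 0 := fun h0 => h (by simp [ha, h0])
          exact absurd (Y.deg_lt _ _ hd) (lt_irrefl _)
        · simp [ha, ha'] at h
      · have := X.deg_lt _ _ ha
        simpa using this
    · by_cases ha' : a' = a
      · subst ha'
        have hd : Y.bd b' b ≠ 0 := fun h0 => h (by simp [hb, h0])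
        have := Y.deg_lt _ _ hd
        simpa using this
      · simp [hb, ha'] at h

theorem Cx.tensor_bd_ne_zero {X : Cx A} {Y : Cx B} {p' p : A × B}
    (h : (X.tensor Y).bd p' p ≠ 0) :
    (X.bd p'.1 p.1 ≠ 0 ∧ p'.2 = p.2) ∨ (p'.1 = p.1 ∧ Y.bd p'.2 p.2 ≠ 0) := by
  simp only [Cx.tensor, Matrix.add_apply, kroneckerMap_apply, Matrix.one_apply] at h
  by_contra! hc
  obtain ⟨h1, h2⟩ := hc
  apply h
  by_cases hb : p'.2 = p.2 <;> by_cases ha : p'.1 = p.1 <;> simp_all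

theorem IsHom.tensor {X : Cx A} {Y : Cx B} {Z : Cx C} {U : Cx D} {M : Matrix C A (ZMod 2)}
    {N : Matrix D B (ZMod 2)} (hM : IsHom X Z M) (hN : IsHom Y U N) :
    IsHom (X.tensor Y) (Z.tensor U) (M ⊗ₖ N) := by
  constructor
  · simp only [Cx.tensor, Matrix.add_mul, Matrix.mul_add, ← Matrix.mul_kronecker_mul, hM.bd, hN.bd,
      Matrix.mul_one, Matrix.one_mul]
  · simp only [Cx.tensor]
    rw [vecMul_kronecker, hM.aug, hN.aug]

/-- Precomposition of a chain map with an isomorphism that permutes the bases. -/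
theorem IsHom.submatrix {X : Cx A} {Y : Cx B} {Z : Cx C} {M : Matrix C B (ZMod 2)}
    (hM : IsHom Y Z M) (e : A ≃ B) (hbd : X.bd = Y.bd.submatrix e e)
    (haug : X.aug = Y.aug ∘ e) : IsHom X Z (M.submatrix id e) := by
  constructor
  · ext c a
    have := congrFun (congrFun hM.bd c) (e a)
    rw [hbd, Matrix.submatrix_mul_equiv, ← hM.bd]
    rfl
  · rw [haug, ← hM.aug]
    rfl

/-- The one-point complex. -/
def Cx.unit : Cx Unit where
  bd := 0
  aug _ := 1
  deg _ := 0
  bd_bd := by simp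
  aug_bd := by simp
  deg_lt := by simp

theorem sum_subtype_eq_sum (p : B → Prop) [DecidablePred p] (f : B → ZMod 2)
    (h : ∀ b, ¬ p b → f b = 0) : ∑ b : {b // p b}, f b = ∑ b, f b := by
  rw [← Fintype.sum_subtype_add_sum_subtype p f,
    Fintype.sum_eq_zero (fun b : {b // ¬ p b} => f b) (fun b => h b b.2), add_zero]

/-- The subcomplex spanned by a set of cells closed under faces. -/
def Cx.sub (X : Cx B) (p : B → Prop) [DecidablePred p]
    (hp : ∀ b' b, X.bd b' b ≠ 0 → p b → p b') : Cx {b // p b} where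
  bd := X.bd.submatrix Subtype.val Subtype.val
  aug := X.aug ∘ Subtype.val
  deg := X.deg ∘ Subtype.val
  bd_bd := by
    ext ⟨a, ha⟩ ⟨b, hb⟩
    have h := congrFun (congrFun X.bd_bd a) b
    rw [Matrix.mul_apply] at h
    refine (sum_subtype_eq_sum p (fun c => X.bd a c * X.bd c b) fun c hc => ?_).trans h
    have : X.bd c b = 0 := by
      by_contra h0
      exact hc (hp c b h0 hb)
    simp [this]
  aug_bd := by
    ext ⟨b, hb⟩
    have h := congrFun X.aug_bd b
    refine (sum_subtype_eq_sum p (fun c => X.aug c * X.bd c b) fun c hc => ?_).trans h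
    have : X.bd c b = 0 := by
      by_contra h0
      exact hc (hp c b h0 hb)
    simp [this]
  deg_lt := fun b' b h => X.deg_lt _ _ h

end Complexes

section Towers

/-- The `n`-fold product of a type with itself. -/
def Pw (B : Type) : ℕ → Type
  | 0 => Unit
  | n + 1 => B × Pw B n

/-- Perfect binary trees of height `j` whose inner nodes are labelled by `A`. -/
def Tr (A : Type) : ℕ → Type
  | 0 => Unit
  | j + 1 => A × (Tr A j × Tr A j)

variable {A B : Type}

instance Pw.fintype [Fintype B] : ∀ n, Fintype (Pw B n)
  | 0 => inferInstanceAs (Fintype Unit)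
  | n + 1 => have := Pw.fintype n; inferInstanceAs (Fintype (B × Pw B n))

instance Pw.decidableEq [DecidableEq B] : ∀ n, DecidableEq (Pw B n)
  | 0 => inferInstanceAs (DecidableEq Unit)
  | n + 1 => have := Pw.decidableEq n; inferInstanceAs (DecidableEq (B × Pw B n))

instance Tr.fintype [Fintype B] : ∀ n, Fintype (Tr B n)
  | 0 => inferInstanceAs (Fintype Unit)
  | n + 1 => have := Tr.fintype n; inferInstanceAs (Fintype (B × (Tr B n × Tr B n)))

instance Tr.decidableEq [DecidableEq B] : ∀ n, DecidableEq (Tr B n)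
  | 0 => inferInstanceAs (DecidableEq Unit)
  | n + 1 => have := Tr.decidableEq n
    inferInstanceAs (DecidableEq (B × (Tr B n × Tr B n)))

variable [Fintype A] [DecidableEq A] [Fintype B] [DecidableEq B]

/-- Tensor powers of a complex. -/
def Cx.pow (X : Cx B) : ∀ n, Cx (Pw B n)
  | 0 => Cx.unit
  | n + 1 => X.tensor (X.pow n)

/-- The tensor power of a complex indexed by the inner nodes of a binary tree. -/
def Cx.tree (X : Cx B) : ∀ j, Cx (Tr B j)
  | 0 => Cx.unit
  | j + 1 => X.tensor ((X.tree j).tensor (X.tree j))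

/-- The map induced by `M` on tree powers. -/
def treeMat (M : Matrix B A (ZMod 2)) : ∀ j, Matrix (Tr B j) (Tr A j) (ZMod 2)
  | 0 => fun _ _ => 1
  | j + 1 => M ⊗ₖ (treeMat M j ⊗ₖ treeMat M j)

theorem IsHom.tree {X : Cx A} {Y : Cx B} {M : Matrix B A (ZMod 2)} (hM : IsHom X Y M) :
    ∀ j, IsHom (X.tree j) (Y.tree j) (treeMat M j)
  | 0 => by
    have h : treeMat M 0 = (1 : Matrix Unit Unit (ZMod 2)) := by ext; rfl
    rw [h]
    exact IsHom.one _
  | j + 1 => hM.tensor ((IsHom.tree hM j).tensor (IsHom.tree hM j))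

end Towers

section Actions

/-- An action of a group on a type. -/
structure Act (G : Type) [Group G] (A : Type) where
  act : G → A → A
  one : ∀ a, act 1 a = a
  mul : ∀ g h a, act (g * h) a = act g (act h a)

variable {G H A B C D : Type} [Group G] [Group H]

theorem Act.inv_act (α : Act G A) (g : G) (a : A) : α.act g⁻¹ (α.act g a) = a := by
  rw [← α.mul, inv_mul_cancel, α.one]

theorem Act.act_inv (α : Act G A) (g : G) (a : A) : α.act g (α.act g⁻¹ a) = a := by
  rw [← α.mul, mul_inv_cancel, α.one]

/-- The permutation given by a group element. -/
def Act.equiv (α : Act G A) (g : G) : A ≃ A :=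
  ⟨α.act g, α.act g⁻¹, α.inv_act g, α.act_inv g⟩

def Act.comap (α : Act G A) (f : H →* G) : Act H A :=
  ⟨fun h => α.act (f h), fun a => by rw [map_one, α.one], fun g h a => by rw [map_mul, α.mul]⟩

def Act.prod (α : Act G A) (β : Act G B) : Act G (A × B) :=
  ⟨fun g p => (α.act g p.1, β.act g p.2), fun a => by simp [α.one, β.one],
    fun g h a => by simp [α.mul, β.mul]⟩

/-- The action of the group of signs given by an involution. -/
def Act.ofInv (ν : A → A) (hν : ∀ a, ν (ν a) = a) : Act ℤˣ A where
  act s a := if s = 1 then a else ν a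
  one a := by simp
  mul s t a := by
    rcases Int.units_eq_one_or s with rfl | rfl <;> rcases Int.units_eq_one_or t with rfl | rfl <;>
      simp [hν]

/-- The wreath product of `T` with the group of signs, which swaps the two factors. -/
@[ext] structure Wr (T : Type) where
  s : ℤˣ
  l : T
  r : T

namespace Wr

variable {T : Type} [Group T]

instance : Mul (Wr T) := ⟨fun a b =>
  if b.s = 1 then ⟨a.s * b.s, a.l * b.l, a.r * b.r⟩ else ⟨a.s * b.s, a.r * b.l, a.l * b.r⟩⟩

instance : One (Wr T) := ⟨⟨1, 1, 1⟩⟩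

instance : Inv (Wr T) := ⟨fun a => if a.s = 1 then ⟨a.s, a.l⁻¹, a.r⁻¹⟩ else ⟨a.s, a.r⁻¹, a.l⁻¹⟩⟩

theorem mul_def (a b : Wr T) : a * b =
  if b.s = 1 then ⟨a.s * b.s, a.l * b.l, a.r * b.r⟩ else ⟨a.s * b.s, a.r * b.l, a.l * b.r⟩ := rfl

theorem one_def : (1 : Wr T) = ⟨1, 1, 1⟩ := rfl

theorem inv_def (a : Wr T) :
  a⁻¹ = if a.s = 1 then ⟨a.s, a.l⁻¹, a.r⁻¹⟩ else ⟨a.s, a.r⁻¹, a.l⁻¹⟩ := rfl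

instance : Group (Wr T) := Group.ofLeftAxioms
  (by
    rintro ⟨s, l, r⟩ ⟨s', l', r'⟩ ⟨s'', l'', r''⟩
    rcases Int.units_eq_one_or s' with rfl | rfl <;>
      rcases Int.units_eq_one_or s'' with rfl | rfl <;> simp [mul_def, mul_assoc])
  (by
    rintro ⟨s, l, r⟩
    rcases Int.units_eq_one_or s with rfl | rfl <;> simp [mul_def, one_def])
  (by
    rintro ⟨s, l, r⟩
    rcases Int.units_eq_one_or s with rfl | rfl <;> simp [mul_def, one_def, inv_def])

end Wr

/-- The group of symmetries of binary trees of height `j`. -/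
def TG : ℕ → Type
  | 0 => Unit
  | j + 1 => Wr (TG j)

instance TG.group : ∀ j, Group (TG j)
  | 0 => inferInstanceAs (Group PUnit)
  | j + 1 => have := TG.group j; inferInstanceAs (Group (Wr (TG j)))

/-- Swap the two components of a pair if the sign is negative. -/
def swapIf (s : ℤˣ) (p : A × A) : A × A := if s = 1 then p else (p.2, p.1)

/-- One step of the construction of the action on trees. -/
def wrAct {T : Type} [Group T] (α : Act (ℤˣ × ℤˣ) A) (β : Act (T × ℤˣ) B) :
    Act (Wr T × ℤˣ) (A × (B × B)) where
  act g p := (α.act (g.1.s, g.2) p.1,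
    swapIf g.1.s (β.act (g.1.l, g.2) p.2.1, β.act (g.1.r, g.2) p.2.2))
  one p := by
    have h1 := α.one p.1
    have h2 := β.one p.2.1
    have h3 := β.one p.2.2
    simp only [Prod.one_eq_mk] at h1 h2 h3
    simp [Wr.one_def, swapIf, h1, h2, h3]
  mul := by
    rintro ⟨⟨s, l, r⟩, γ⟩ ⟨⟨s', l', r'⟩, γ'⟩ p
    have h1 := α.mul (s, γ) (s', γ') p.1
    have h2 := fun l l' => β.mul (l, γ) (l', γ')
    simp only [Prod.mk_mul_mk] at h1 h2
    rcases Int.units_eq_one_or s with rfl | rfl <;>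
      rcases Int.units_eq_one_or s' with rfl | rfl <;> simp_all [Wr.mul_def, swapIf]

/-- The action on trees induced by an action on labels: the first sign acts at the root of each
flipped subtree, the second one acts at every node. -/
def treeAct (α : Act (ℤˣ × ℤˣ) A) : ∀ j, Act (TG j × ℤˣ) (Tr A j)
  | 0 => ⟨fun _ a => a, fun _ => rfl, fun _ _ _ => rfl⟩
  | j + 1 => wrAct α (treeAct α j)

/-- A matrix compatible with two actions. -/
def Equivar (α : Act G A) (β : Act G B) (M : Matrix B A (ZMod 2)) : Prop :=
  ∀ g b a, M (β.act g b) (α.act g a) = M b a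

theorem Equivar.mul [Fintype B] {α : Act G A} {β : Act G B} {γ : Act G C}
    {N : Matrix C B (ZMod 2)} {M : Matrix B A (ZMod 2)} (hN : Equivar β γ N) (hM : Equivar α β M) :
    Equivar α γ (N * M) := by
  intro g c a
  rw [Matrix.mul_apply, Matrix.mul_apply, ← (β.equiv g).sum_comp]
  exact Finset.sum_congr rfl fun b _ => by
    rw [show β.equiv g b = β.act g b from rfl, hN, hM]

theorem Equivar.add {α : Act G A} {β : Act G B} {N M : Matrix B A (ZMod 2)}
    (hN : Equivar α β N) (hM : Equivar α β M) : Equivar α β (N + M) := fun g b a => by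
  rw [Matrix.add_apply, Matrix.add_apply, hN, hM]

theorem Equivar.kronecker {α : Act G A} {β : Act G B} {γ : Act G C} {δ : Act G D}
    {M : Matrix B A (ZMod 2)} {N : Matrix D C (ZMod 2)} (hM : Equivar α β M)
    (hN : Equivar γ δ N) : Equivar (α.prod γ) (β.prod δ) (M ⊗ₖ N) := fun g b a => by
  simp only [kroneckerMap_apply, Act.prod, hM g, hN g]

theorem Equivar.comap {α : Act G A} {β : Act G B} {M : Matrix B A (ZMod 2)}
    (hM : Equivar α β M) (f : H →* G) : Equivar (α.comap f) (β.comap f) M :=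
  fun g b a => hM (f g) b a

theorem Equivar.wr {T : Type} [Group T] {α : Act (ℤˣ × ℤˣ) A} {β : Act (ℤˣ × ℤˣ) B}
    {γ : Act (T × ℤˣ) C} {δ : Act (T × ℤˣ) D}
    {M : Matrix B A (ZMod 2)} {N : Matrix D C (ZMod 2)} (hM : Equivar α β M)
    (hN : Equivar γ δ N) : Equivar (wrAct α γ) (wrAct β δ) (M ⊗ₖ (N ⊗ₖ N)) := by
  rintro ⟨⟨s, l, r⟩, ε⟩ ⟨b, d, d'⟩ ⟨a, c, c'⟩
  have h1 := hM (s, ε) b a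
  have h2 := hN (l, ε) d c
  have h3 := hN (r, ε) d' c'
  rcases Int.units_eq_one_or s with rfl | rfl <;>
    simp [wrAct, swapIf, h1, h2, h3, mul_comm]

theorem Equivar.tree {α : Act (ℤˣ × ℤˣ) A} {β : Act (ℤˣ × ℤˣ) B} {M : Matrix B A (ZMod 2)}
    (hM : Equivar α β M) : ∀ j, Equivar (treeAct α j) (treeAct β j) (treeMat M j)
  | 0 => fun _ _ _ => rfl
  | j + 1 => hM.wr (Equivar.tree hM j)

/-- An action on the cells of a complex by automorphisms. -/
structure Act.IsCx [Fintype B] [DecidableEq B] (α : Act G B) (X : Cx B) : Prop where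
  bd : Equivar α α X.bd
  aug : ∀ g b, X.aug (α.act g b) = X.aug b
  deg : ∀ g b, X.deg (α.act g b) = X.deg b

theorem Equivar.one [DecidableEq B] (α : Act G B) : Equivar α α 1 := by
  intro g b a
  by_cases h : b = a
  · subst h
    simp only [Matrix.one_apply_eq]
  · have : α.act g b ≠ α.act g a := fun h' => h ((α.equiv g).injective h')
    rw [Matrix.one_apply_ne h, Matrix.one_apply_ne this]

theorem Act.IsCx.comap [Fintype B] [DecidableEq B] {α : Act G B} {X : Cx B} (h : α.IsCx X)
    (f : H →* G) : (α.comap f).IsCx X :=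
  ⟨h.bd.comap f, fun g => h.aug (f g), fun g => h.deg (f g)⟩

variable [Fintype A] [DecidableEq A] [Fintype B] [DecidableEq B]

theorem Act.IsCx.prod {α : Act G A} {β : Act G B} {X : Cx A} {Y : Cx B} (hα : α.IsCx X)
    (hβ : β.IsCx Y) : (α.prod β).IsCx (X.tensor Y) where
  bd := (hα.bd.kronecker (Equivar.one β)).add ((Equivar.one α).kronecker hβ.bd)
  aug g b := by simp [Cx.tensor, Act.prod, hα.aug, hβ.aug]
  deg g b := by simp [Cx.tensor, Act.prod, hα.deg, hβ.deg]

theorem Act.IsCx.wr {T : Type} [Group T] {α : Act (ℤˣ × ℤˣ) A} {β : Act (T × ℤˣ) B} {X : Cx A}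
    {Y : Cx B} (hα : α.IsCx X) (hβ : β.IsCx Y) :
    (wrAct α β).IsCx (X.tensor (Y.tensor Y)) where
  bd := by
    rintro ⟨⟨s, l, r⟩, ε⟩ ⟨b, d, d'⟩ ⟨a, c, c'⟩
    have h1 := hα.bd (s, ε) b a
    have h2 := hβ.bd (l, ε) d c
    have h3 := hβ.bd (r, ε) d' c'
    have e1 := Equivar.one α (s, ε) b a
    have e2 := Equivar.one β (l, ε) d c
    have e3 := Equivar.one β (r, ε) d' c'
    rcases Int.units_eq_one_or s with rfl | rfl <;>
      simp only [wrAct, swapIf, Cx.tensor, Matrix.add_apply, kroneckerMap_apply, h1, h2, h3, e1, e2,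
        e3, if_true, show ((-1 : ℤˣ) = 1) = False by decide, if_false,
          ← Matrix.one_kronecker_one] <;>
      ring
  aug := by
    rintro ⟨⟨s, l, r⟩, ε⟩ ⟨a, b, b'⟩
    rcases Int.units_eq_one_or s with rfl | rfl <;>
      simp [Cx.tensor, wrAct, hα.aug, hβ.aug, swapIf, mul_comm]
  deg := by
    rintro ⟨⟨s, l, r⟩, ε⟩ ⟨a, b, b'⟩
    rcases Int.units_eq_one_or s with rfl | rfl <;>
      simp [Cx.tensor, wrAct, hα.deg, hβ.deg, swapIf, add_comm]

theorem Act.IsCx.tree {α : Act (ℤˣ × ℤˣ) A} {X : Cx A} (hα : α.IsCx X) :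
    ∀ j, (treeAct α j).IsCx (X.tree j)
  | 0 => ⟨fun _ _ _ => rfl, fun _ _ => rfl, fun _ _ => rfl⟩
  | j + 1 => hα.wr (Act.IsCx.tree hα j)

/-- The element moving the normalized elements to a given tree, provided that the labels are
distinguished by a sign. -/
def treeSign (σ : A → ℤˣ) : ∀ j, Tr A j → TG j
  | 0, _ => ()
  | j + 1, (a, (l, r)) =>
    if σ a = 1 then (⟨1, treeSign σ j l, treeSign σ j r⟩ : Wr (TG j))
    else (⟨-1, treeSign σ j r, treeSign σ j l⟩ : Wr (TG j))

end Actions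

section Signs

variable {A : Type}

theorem treeSign_act (α : Act (ℤˣ × ℤˣ) A) (σ : A → ℤˣ)
    (hσ : ∀ g a, σ (α.act g a) = g.1 * g.2 * σ a) :
    ∀ j (t : TG j) (c : Tr A j), treeSign σ j ((treeAct α j).act (t, 1) c) = t * treeSign σ j c
  | 0, _, _ => rfl
  | j + 1, t, c => by
    obtain ⟨s, l, r⟩ := t
    obtain ⟨a, c, c'⟩ := c
    have h1 := treeSign_act α σ hσ j l c
    have h2 := treeSign_act α σ hσ j r c'
    have h3 := hσ (s, 1) a
    change treeSign σ (j + 1) ((wrAct α (treeAct α j)).act _ _) = 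
      (⟨s, l, r⟩ : Wr (TG j)) * (show Wr (TG j) from treeSign σ (j + 1) (a, c, c'))
    rcases Int.units_eq_one_or s with rfl | rfl <;>
      rcases Int.units_eq_one_or (σ a) with h | h <;>
      simp_all [wrAct, swapIf, treeSign, Wr.mul_def] <;> rfl

/-- The element moving the normalized elements to a given one in a product of a complex with a
tree power. -/
theorem exists_sign {B : Type} (α : Act (ℤˣ × ℤˣ) A) (σ : A → ℤˣ)
    (hσ : ∀ g a, σ (α.act g a) = g.1 * g.2 * σ a) (β : Act ℤˣ B) (τ : B → ℤˣ)
    (hτ : ∀ g b, τ (β.act g b) = g * τ b) (j : ℕ) :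
    ∃ γ : B × Tr A j → TG j × ℤˣ, ∀ g p,
      γ (((β.comap (MonoidHom.snd (TG j) ℤˣ)).prod (treeAct α j)).act g p) = g * γ p := by
  refine ⟨fun p => (treeSign σ j ((treeAct α j).act (1, (τ p.1)⁻¹) p.2), τ p.1), ?_⟩
  rintro ⟨t, s⟩ ⟨b, c⟩
  have e1 : τ (((β.comap (MonoidHom.snd (TG j) ℤˣ)).prod (treeAct α j)).act (t, s) (b, c)).1 =
      s * τ b := hτ s b
  refine Prod.ext ?_ e1
  simp only [e1]
  change treeSign σ j ((treeAct α j).act (1, (s * τ b)⁻¹) ((treeAct α j).act (t, s) c)) =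
    t * treeSign σ j ((treeAct α j).act (1, (τ b)⁻¹) c)
  rw [← treeSign_act α σ hσ, ← (treeAct α j).mul, ← (treeAct α j).mul]
  congr 2
  rcases Int.units_eq_one_or s with rfl | rfl <;> simp

end Signs

section Models

variable {G B D : Type} [Group G] [Fintype B] [DecidableEq B] [Fintype D] [DecidableEq D]

/-- Equivariant construction of a matrix column by column, by induction on the degree, on a
free complex. -/
theorem exists_equivar (X : Cx B) (α : Act G B) (hα : α.IsCx X) (β : Act G D)
    (γ : B → G) (hγ : ∀ g b, γ (α.act g b) = g * γ b)
    (R : B → (D → ZMod 2) → (D → ZMod 2) → Prop)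
    (hR : ∀ g b u x, R b u x → R (α.act g b) (fun d => u (β.act g⁻¹ d)) fun d => x (β.act g⁻¹ d))
    (hext : ∀ (f : Matrix D B (ZMod 2)) b,
      (∀ b', X.deg b' < X.deg b → R b' ((f * X.bd).col b') (f.col b')) →
      ∃ x, R b ((f * X.bd).col b) x) :
    ∃ f : Matrix D B (ZMod 2), Equivar α β f ∧ ∀ b, R b ((f * X.bd).col b) (f.col b) := by
  classical
  suffices h : ∀ N, ∃ f : Matrix D B (ZMod 2), Equivar α β f ∧
      ∀ b, X.deg b < N → R b ((f * X.bd).col b) (f.col b) by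
    obtain ⟨f, hf, hfR⟩ := h (Finset.univ.sup X.deg + 1)
    exact ⟨f, hf, fun b => hfR b (Nat.lt_succ_of_le (Finset.le_sup (Finset.mem_univ b)))⟩
  intro N
  induction N with
  | zero => exact ⟨0, fun _ _ _ => rfl, fun b hb => absurd hb (Nat.not_lt_zero _)⟩
  | succ N ih =>
    obtain ⟨f, hf, hfR⟩ := ih
    let Y : B → D → ZMod 2 := fun b =>
      if h : ∃ x, R b ((f * X.bd).col b) x then h.choose else 0
    let f' : Matrix D B (ZMod 2) := fun d b =>
      if X.deg b < N then f d b else Y (α.act (γ b)⁻¹ b) (β.act (γ b)⁻¹ d)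
    have hlow : ∀ b, X.deg b ≤ N → (f' * X.bd).col b = (f * X.bd).col b := by
      intro b hb
      ext d
      simp only [Matrix.col_apply, Matrix.mul_apply]
      refine Finset.sum_congr rfl fun b' _ => ?_
      by_cases h0 : X.bd b' b = 0
      · simp [h0]
      · simp [f', lt_of_lt_of_le (X.deg_lt _ _ h0) hb]
    have hfbd : Equivar α β (f * X.bd) := hf.mul hα.bd
    refine ⟨f', ?_, ?_⟩
    · intro g d b
      simp only [f', hα.deg]
      split_ifs
      · exact hf g d b
      · rw [hγ, _root_.mul_inv_rev, α.mul, β.mul, α.inv_act, β.inv_act]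
    · intro b hb
      rw [hlow b (Nat.lt_succ_iff.1 hb)]
      rcases lt_or_eq_of_le (Nat.lt_succ_iff.1 hb) with hlt | heq
      · have : f'.col b = f.col b := by
          ext d
          exact if_pos hlt
        rw [this]
        exact hfR b hlt
      · set b₀ := α.act (γ b)⁻¹ b with hb₀
        have hb₀' : α.act (γ b) b₀ = b := α.act_inv _ _
        have hdeg : X.deg b₀ = N := by rw [hb₀, hα.deg, heq]
        have hex : ∃ x, R b₀ ((f * X.bd).col b₀) x :=
          hext f b₀ fun b' hb' => hfR b' (by omega)
        have hY : R b₀ ((f * X.bd).col b₀) (Y b₀) := by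
          simp only [Y, dif_pos hex]
          exact hex.choose_spec
        have := hR (γ b) b₀ _ _ hY
        rw [hb₀'] at this
        convert this using 1
        · ext d
          have h := hfbd (γ b)⁻¹ d b
          rw [← hb₀] at h
          simp only [Matrix.col_apply]
          exact h.symm
        · ext d
          exact if_neg heq.not_lt

/-- A set of cells carrying a contraction of the complex. -/
def Contr (X : Cx D) (S : Set D) : Prop :=
  ∃ (H : Matrix D D (ZMod 2)) (v : D → ZMod 2), (∀ d, v d ≠ 0 → d ∈ S) ∧
    (∀ d' d, H d' d ≠ 0 → d ∈ S → d' ∈ S) ∧ X.aug ⬝ᵥ v = 1 ∧ X.bd *ᵥ v = 0 ∧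
    X.aug ᵥ* H = 0 ∧ 1 + vecMulVec v X.aug = X.bd * H + H * X.bd

theorem Contr.exists_vertex {X : Cx D} {S : Set D} (h : Contr X S) :
    ∃ v : D → ZMod 2, (∀ d, v d ≠ 0 → d ∈ S) ∧ X.bd *ᵥ v = 0 ∧ X.aug ⬝ᵥ v = 1 := by
  obtain ⟨H, v, h1, h2, h3, h4, h5, h6⟩ := h
  exact ⟨v, h1, h4, h3⟩

theorem Contr.exists_preimage {X : Cx D} {S : Set D} (h : Contr X S) (x : D → ZMod 2)
    (hx : ∀ d, x d ≠ 0 → d ∈ S) (hbd : X.bd *ᵥ x = 0) (haug : X.aug ⬝ᵥ x = 0) :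
    ∃ y : D → ZMod 2, (∀ d, y d ≠ 0 → d ∈ S) ∧ X.bd *ᵥ y = x ∧ X.aug ⬝ᵥ y = 0 := by
  obtain ⟨H, v, h1, h2, h3, h4, h5, h6⟩ := h
  refine ⟨H *ᵥ x, fun d hd => ?_, ?_, ?_⟩
  · simp only [Matrix.mulVec, dotProduct] at hd
    obtain ⟨d', -, hd'⟩ := Finset.exists_ne_zero_of_sum_ne_zero hd
    exact h2 d d' (left_ne_zero_of_mul hd') (hx d' (right_ne_zero_of_mul hd'))
  · have := congrArg (· *ᵥ x) h6
    simp only [Matrix.add_mulVec, Matrix.one_mulVec, ← Matrix.mulVec_mulVec, hbd,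
      Matrix.mulVec_zero,
      add_zero] at this
    rw [← this, vecMulVec_mulVec, haug]
    simp
  · rw [Matrix.dotProduct_mulVec, h5, zero_dotProduct]

variable {E : Type} [Fintype E] [DecidableEq E]

theorem Contr.tensor {X : Cx D} {Y : Cx E} {S : Set D} {T : Set E} (hS : Contr X S)
    (hT : Contr Y T) : Contr (X.tensor Y) (S ×ˢ T) := by
  obtain ⟨H, v, h1, h2, h3, h4, h5, h6⟩ := hS
  obtain ⟨K, w, k1, k2, k3, k4, k5, k6⟩ := hT
  have hP1 : X.bd * vecMulVec v X.aug = 0 := by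
    rw [mul_vecMulVec, h4, zero_vecMulVec]
  have hP2 : vecMulVec v X.aug * X.bd = 0 := by
    rw [vecMulVec_mul, X.aug_bd, vecMulVec_zero]
  have hP : vecMulVec (fun p : D × E => v p.1 * w p.2) (X.tensor Y).aug =
      vecMulVec v X.aug ⊗ₖ vecMulVec w Y.aug := by
    ext ⟨a, b⟩ ⟨c, d⟩
    simp only [vecMulVec_apply, Cx.tensor, kroneckerMap_apply]
    ring
  refine ⟨H ⊗ₖ 1 + vecMulVec v X.aug ⊗ₖ K, fun p => v p.1 * w p.2, ?_, ?_, ?_, ?_, ?_, ?_⟩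
  · intro p hp
    exact ⟨h1 _ (left_ne_zero_of_mul hp), k1 _ (right_ne_zero_of_mul hp)⟩
  · rintro ⟨a', b'⟩ ⟨a, b⟩ h ⟨ha, hb⟩
    simp only [Matrix.add_apply, kroneckerMap_apply, Matrix.one_apply, vecMulVec_apply] at h
    by_cases h0 : v a' * X.aug a * K b' b = 0
    · rw [h0, add_zero] at h
      have hbb : b' = b := by
        by_contra hne
        simp [hne] at h
      subst hbb
      exact ⟨h2 _ _ (left_ne_zero_of_mul h) ha, hb⟩
    · exact ⟨h1 _ (left_ne_zero_of_mul (left_ne_zero_of_mul h0)),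
        k2 _ _ (right_ne_zero_of_mul h0) hb⟩
  · have : (X.tensor Y).aug ⬝ᵥ (fun p => v p.1 * w p.2) = (X.aug ⬝ᵥ v) * (Y.aug ⬝ᵥ w) := by
      simp only [dotProduct, Fintype.sum_prod_type, Cx.tensor, Finset.sum_mul_sum]
      exact Finset.sum_congr rfl fun _ _ => Finset.sum_congr rfl fun _ _ => by ring
    rw [this, h3, k3, one_mul]
  · have key : ∀ (M : Matrix D D (ZMod 2)) (N : Matrix E E (ZMod 2)),
        (M ⊗ₖ N) *ᵥ (fun p : D × E => v p.1 * w p.2) =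
          fun p => (M *ᵥ v) p.1 * (N *ᵥ w) p.2 := by
      intro M N
      ext ⟨c, d⟩
      simp only [Matrix.mulVec, dotProduct, Fintype.sum_prod_type, kroneckerMap_apply,
        Finset.sum_mul_sum]
      exact Finset.sum_congr rfl fun _ _ => Finset.sum_congr rfl fun _ _ => by ring
    simp only [Cx.tensor, Matrix.add_mulVec, key, h4, k4]
    ext
    simp
  · simp only [Cx.tensor, Matrix.vecMul_add, vecMul_kronecker, h5, k5]
    ext
    simp
  · have hcomm : ∀ M : Matrix (D × E) (D × E) (ZMod 2), M + M = 0 := add_self_eq_zero_matrix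
    have e1 : (X.tensor Y).bd * (H ⊗ₖ 1 + vecMulVec v X.aug ⊗ₖ K) +
        (H ⊗ₖ 1 + vecMulVec v X.aug ⊗ₖ K) * (X.tensor Y).bd =
        (X.bd * H + H * X.bd) ⊗ₖ 1 + vecMulVec v X.aug ⊗ₖ (Y.bd * K + K * Y.bd) +
          (H ⊗ₖ Y.bd + H ⊗ₖ Y.bd) := by
      simp only [Cx.tensor, Matrix.add_mul, Matrix.mul_add, ← Matrix.mul_kronecker_mul, hP1, hP2,
        Matrix.mul_one, Matrix.one_mul, Matrix.zero_kronecker, Matrix.add_kronecker,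
        Matrix.kronecker_add]
      abel
    rw [e1, hcomm, add_zero, ← h6, ← k6, hP, Matrix.add_kronecker, Matrix.kronecker_add,
      Matrix.one_kronecker_one]
    calc _ = 1 + vecMulVec v X.aug ⊗ₖ vecMulVec w Y.aug +
          (vecMulVec v X.aug ⊗ₖ (1 : Matrix E E (ZMod 2)) + vecMulVec v X.aug ⊗ₖ 1) := by
            rw [hcomm, add_zero]
      _ = _ := by abel

theorem mulVec_col (M : Matrix D E (ZMod 2)) (N : Matrix E B (ZMod 2)) (b : B) :
    M *ᵥ N.col b = (M * N).col b := rfl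

theorem Act.IsCx.bd_translate {Z : Cx D} {β : Act G D} (hβ : β.IsCx Z) (g : G) (x : D → ZMod 2) :
    Z.bd *ᵥ (fun d => x (β.act g⁻¹ d)) = fun d => (Z.bd *ᵥ x) (β.act g⁻¹ d) := by
  ext d
  simp only [Matrix.mulVec, dotProduct]
  rw [← (β.equiv g).sum_comp]
  refine Finset.sum_congr rfl fun d' _ => ?_
  change Z.bd d (β.act g d') * x (β.act g⁻¹ (β.act g d')) = _
  rw [β.inv_act, ← hβ.bd g⁻¹, β.inv_act]

theorem Act.IsCx.aug_translate {Z : Cx D} {β : Act G D} (hβ : β.IsCx Z) (g : G)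
    (x : D → ZMod 2) : Z.aug ⬝ᵥ (fun d => x (β.act g⁻¹ d)) = Z.aug ⬝ᵥ x := by
  simp only [dotProduct]
  rw [← (β.equiv g).sum_comp]
  refine Finset.sum_congr rfl fun d' _ => ?_
  change Z.aug (β.act g d') * x (β.act g⁻¹ (β.act g d')) = _
  rw [β.inv_act, hβ.aug]

theorem mul_col_congr (X : Cx B) (M N : Matrix D B (ZMod 2)) (b : B)
    (h : ∀ b', X.bd b' b ≠ 0 → M.col b' = N.col b') : (M * X.bd).col b = (N * X.bd).col b := by
  ext d
  simp only [Matrix.col_apply, Matrix.mul_apply]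
  refine Finset.sum_congr rfl fun b' _ => ?_
  by_cases h0 : X.bd b' b = 0
  · rw [h0, mul_zero, mul_zero]
  · congr 1
    exact congrFun (h b' h0) d

/-- Equivariant chain maps subordinate to acyclic carriers. -/
theorem exists_carried_hom (X : Cx B) (α : Act G B) (hα : α.IsCx X) (Z : Cx D) (β : Act G D)
    (hβ : β.IsCx Z) (γ : B → G) (hγ : ∀ g b, γ (α.act g b) = g * γ b)
    (S : B → Set D) (hmono : ∀ b' b, X.bd b' b ≠ 0 → S b' ⊆ S b)
    (hequiv : ∀ g b d, d ∈ S b → β.act g d ∈ S (α.act g b)) (hS : ∀ b, Contr Z (S b)) :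
    ∃ f : Matrix D B (ZMod 2), Equivar α β f ∧ IsHom X Z f ∧ ∀ b d, f d b ≠ 0 → d ∈ S b := by
  obtain ⟨f, hf, hR⟩ := exists_equivar X α hα β γ hγ
    (fun b u x => (∀ d, x d ≠ 0 → d ∈ S b) ∧ Z.bd *ᵥ x = u ∧ Z.aug ⬝ᵥ x = X.aug b)
    (by
      rintro g b u x ⟨h1, h2, h3⟩
      refine ⟨fun d hd => ?_, ?_, ?_⟩
      · have := hequiv g b _ (h1 _ hd)
        rwa [β.act_inv] at this
      · rw [hβ.bd_translate, h2]
      · rw [hβ.aug_translate, h3, hα.aug])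
    (by
      intro f b hlow
      have hsub : ∀ b', X.bd b' b ≠ 0 → (∀ d, f d b' ≠ 0 → d ∈ S b') ∧
          Z.bd *ᵥ f.col b' = (f * X.bd).col b' ∧ Z.aug ⬝ᵥ f.col b' = X.aug b' :=
        fun b' h => hlow b' (X.deg_lt _ _ h)
      have hbd : Z.bd *ᵥ (f * X.bd).col b = 0 := by
        rw [mulVec_col, ← Matrix.mul_assoc]
        have h0 : ((f * X.bd) * X.bd).col b = 0 := by
          rw [Matrix.mul_assoc, X.bd_bd, Matrix.mul_zero]
          rfl
        rw [← h0]
        exact mul_col_congr X _ _ b fun b' h => (hsub b' h).2.1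
      have hau : Z.aug ⬝ᵥ (f * X.bd).col b = 0 := by
        change (Z.aug ᵥ* (f * X.bd)) b = 0
        rw [← Matrix.vecMul_vecMul]
        have h0 : (X.aug ᵥ* X.bd) b = 0 := by rw [X.aug_bd]; rfl
        rw [← h0]
        simp only [Matrix.vecMul, dotProduct]
        refine Finset.sum_congr rfl fun b' _ => ?_
        by_cases h : X.bd b' b = 0
        · rw [h, mul_zero, mul_zero]
        · congr 1
          exact (hsub b' h).2.2
      have hsupp : ∀ d, (f * X.bd).col b d ≠ 0 → d ∈ S b := by
        intro d hd
        simp only [Matrix.col_apply, Matrix.mul_apply] at hd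
        obtain ⟨b', -, hb'⟩ := Finset.exists_ne_zero_of_sum_ne_zero hd
        have hb0 := right_ne_zero_of_mul hb'
        exact hmono b' b hb0 ((hsub b' hb0).1 d (left_ne_zero_of_mul hb'))
      obtain ⟨y, hy1, hy2, hy3⟩ := (hS b).exists_preimage _ hsupp hbd hau
      obtain ⟨v, hv1, hv2, hv3⟩ := (hS b).exists_vertex
      refine ⟨y + X.aug b • v, fun d hd => ?_, ?_, ?_⟩
      · by_cases h : y d = 0
        · refine hv1 d fun h' => hd ?_
          simp [h, h']
        · exact hy1 d h
      · rw [Matrix.mulVec_add, hy2, Matrix.mulVec_smul, hv2, smul_zero, add_zero]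
      · rw [dotProduct_add, hy3, dotProduct_smul, hv3]
        simp)
  refine ⟨f, hf, ⟨?_, ?_⟩, fun b d hd => (hR b).1 d hd⟩
  · ext d b
    exact congrFun (hR b).2.1 d
  · ext b
    exact (hR b).2.2

/-- Two equivariant chain maps from a free complex to a contractible one are equivariantly
homotopic. -/
theorem exists_homotopy (X : Cx B) (α : Act G B) (hα : α.IsCx X) (Z : Cx D) (β : Act G D)
    (hβ : β.IsCx Z) (γ : B → G) (hγ : ∀ g b, γ (α.act g b) = g * γ b)
    (hZ : Contr Z Set.univ) {f g : Matrix D B (ZMod 2)} (hf : IsHom X Z f) (hg : IsHom X Z g)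
    (hfe : Equivar α β f) (hge : Equivar α β g) :
    ∃ h : Matrix D B (ZMod 2), Equivar α β h ∧ Z.bd * h + h * X.bd = f + g := by
  have hψ : Z.bd * (f + g) = (f + g) * X.bd := by
    rw [Matrix.mul_add, Matrix.add_mul, hf.bd, hg.bd]
  have hψa : Z.aug ᵥ* (f + g) = 0 := by
    rw [Matrix.vecMul_add, hf.aug, hg.aug]
    ext
    exact CharTwo.add_self_eq_zero _
  have hψe : Equivar α β (f + g) := hfe.add hge
  obtain ⟨h, hh, hR⟩ := exists_equivar X α hα β γ hγ
    (fun b u x => Z.bd *ᵥ x = (f + g).col b + u ∧ Z.aug ⬝ᵥ x = 0)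
    (by
      rintro k b u x ⟨h1, h2⟩
      refine ⟨?_, by rw [hβ.aug_translate, h2]⟩
      rw [hβ.bd_translate, h1]
      ext d
      have := hψe k (β.act k⁻¹ d) b
      rw [β.act_inv] at this
      simp only [Pi.add_apply, Matrix.col_apply, this])
    (by
      intro h b hlow
      have hsub : ∀ b', X.bd b' b ≠ 0 → Z.bd *ᵥ h.col b' = (f + g).col b' + (h * X.bd).col b' ∧
          Z.aug ⬝ᵥ h.col b' = 0 := fun b' h => hlow b' (X.deg_lt _ _ h)
      have hbd : Z.bd *ᵥ ((f + g).col b + (h * X.bd).col b) = 0 := by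
        have h1 : Z.bd *ᵥ (h * X.bd).col b = ((f + g) * X.bd).col b := by
          rw [mulVec_col, ← Matrix.mul_assoc,
            mul_col_congr X (Z.bd * h) ((f + g) + h * X.bd) b fun b' h => (hsub b' h).1,
            Matrix.add_mul, Matrix.mul_assoc h, X.bd_bd, Matrix.mul_zero, add_zero]
        rw [Matrix.mulVec_add, h1, mulVec_col, hψ]
        ext d
        exact CharTwo.add_self_eq_zero _
      have hau : Z.aug ⬝ᵥ ((f + g).col b + (h * X.bd).col b) = 0 := by
        rw [dotProduct_add]
        have h1 : Z.aug ⬝ᵥ (f + g).col b = 0 := congrFun hψa b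
        have h2 : Z.aug ⬝ᵥ (h * X.bd).col b = 0 := by
          change (Z.aug ᵥ* (h * X.bd)) b = 0
          rw [← Matrix.vecMul_vecMul]
          simp only [Matrix.vecMul, dotProduct]
          refine Finset.sum_eq_zero fun b' _ => ?_
          by_cases h : X.bd b' b = 0
          · rw [h, mul_zero]
          · have := (hsub b' h).2
            simp only [dotProduct, Matrix.col_apply] at this
            rw [this, zero_mul]
        rw [h1, h2, add_zero]
      obtain ⟨y, -, hy2, hy3⟩ := hZ.exists_preimage _ (fun _ _ => trivial) hbd hau
      exact ⟨y, hy2, hy3⟩)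
  refine ⟨h, hh, ?_⟩
  have h1 : Z.bd * h = (f + g) + h * X.bd := by
    ext d b
    exact congrFun (hR b).1 d
  rw [h1, add_assoc, add_self_eq_zero_matrix, add_zero]

end Models

section Spheres

theorem sum_units_const (x : ZMod 2) : ∑ _s : ℤˣ, x = 0 := by
  rw [Finset.sum_const, Finset.card_univ, show Fintype.card ℤˣ = 2 from rfl, two_nsmul]
  exact CharTwo.add_self_eq_zero x

/-- The antipodal cell structure on the `(d - 1)`-sphere with two cells in each dimension. -/
def Cx.sphere (d : ℕ) : Cx (Fin d × ℤˣ) where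
  bd := Matrix.of fun p q => if p.1.val + 1 = q.1.val then 1 else 0
  aug p := if p.1.val = 0 then 1 else 0
  deg p := p.1.val
  bd_bd := by
    ext p q
    rw [Matrix.mul_apply, Fintype.sum_prod_type]
    exact Finset.sum_eq_zero fun i _ => sum_units_const _
  aug_bd := by
    ext q
    simp only [Matrix.vecMul, dotProduct, Fintype.sum_prod_type]
    exact Finset.sum_eq_zero fun i _ => sum_units_const _
  deg_lt := by
    intro p q h
    have : p.1.val + 1 = q.1.val := by
      by_contra h'
      exact h (if_neg h')
    omega

theorem Cx.sphere_bd_apply {d : ℕ} (p q : Fin d × ℤˣ) :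
    (Cx.sphere d).bd p q = if p.1.val + 1 = q.1.val then 1 else 0 := rfl

/-- Changing the sign of a cell. -/
def signAct (A : Type) : Act ℤˣ (A × ℤˣ) :=
  ⟨fun g p => (p.1, g * p.2), fun a => by simp, fun g h a => by simp [mul_assoc]⟩

theorem signAct_isCx (d : ℕ) : (signAct (Fin d)).IsCx (Cx.sphere d) :=
  ⟨fun _ _ _ => rfl, fun _ _ => rfl, fun _ _ => rfl⟩

variable {L : ℕ}

/-- The subdivision of an interval into `2 * L` vertices and edges: the even numbers are the
vertices, the odd ones are the edges. The interval has `L` edges. -/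
def Cx.line (L : ℕ) : Cx (Fin (2 * L + 1)) where
  bd := Matrix.of fun c' c =>
    if c.val % 2 = 1 ∧ (c'.val + 1 = c.val ∨ c'.val = c.val + 1) then 1 else 0
  aug c := if c.val % 2 = 0 then 1 else 0
  deg c := c.val % 2
  bd_bd := by
    ext p q
    rw [Matrix.mul_apply]
    refine Finset.sum_eq_zero fun c _ => ?_
    simp only [Matrix.of_apply]
    by_cases h : q.val % 2 = 1 ∧ (c.val + 1 = q.val ∨ c.val = q.val + 1)
    · rw [if_neg (by omega), zero_mul]
    · rw [if_neg h, mul_zero]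
  aug_bd := by
    ext q
    simp only [Matrix.vecMul, dotProduct, Matrix.of_apply]
    by_cases hq : q.val % 2 = 1
    · have hq' := q.isLt
      rw [Finset.sum_eq_add (⟨q.val - 1, by omega⟩ : Fin (2 * L + 1)) ⟨q.val + 1, by omega⟩]
      · rw [if_pos (by simp; omega), if_pos (by simp; omega), if_pos (by simp; omega),
          if_pos (by simp; omega)]
        rfl
      · simp [Fin.ext_iff]
      · rintro c - ⟨h1, h2⟩
        rw [if_neg (c := _ ∧ _), mul_zero]
        rintro ⟨-, h⟩
        simp only [ne_eq, Fin.ext_iff] at h1 h2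
        omega
      · simp
      · simp
    · exact Finset.sum_eq_zero fun c _ => by rw [if_neg (c := _ ∧ _) (fun h => hq h.1), mul_zero]
  deg_lt := by
    intro p q h
    have : q.val % 2 = 1 ∧ (p.val + 1 = q.val ∨ p.val = q.val + 1) := by
      by_contra h'
      exact h (if_neg h')
    omega

theorem Cx.line_bd_ne_zero {c' c : Fin (2 * L + 1)} (h : (Cx.line L).bd c' c ≠ 0) :
    c.val % 2 = 1 ∧ (c'.val + 1 = c.val ∨ c'.val = c.val + 1) := by
  by_contra h'
  exact h (if_neg h')

def revAct (L : ℕ) : Act ℤˣ (Fin (2 * L + 1)) := Act.ofInv Fin.rev Fin.rev_rev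

theorem revAct_isCx (L : ℕ) : (revAct L).IsCx (Cx.line L) where
  bd g b a := by
    rcases Int.units_eq_one_or g with rfl | rfl
    · rfl
    · have ha := a.isLt
      have hb := b.isLt
      simp only [revAct, Act.ofInv, Cx.line, Matrix.of_apply, show ((-1 : ℤˣ) = 1) = False by
        decide, if_false,
        Fin.val_rev]
      exact if_congr (by omega) rfl rfl
  aug g b := by
    rcases Int.units_eq_one_or g with rfl | rfl
    · rfl
    · have hb := b.isLt
      simp only [revAct, Act.ofInv, Cx.line, show ((-1 : ℤˣ) = 1) = False by decide, if_false,
        Fin.val_rev]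
      exact if_congr (by omega) rfl rfl
  deg g b := by
    rcases Int.units_eq_one_or g with rfl | rfl
    · rfl
    · have hb := b.isLt
      simp only [revAct, Act.ofInv, Cx.line, show ((-1 : ℤˣ) = 1) = False by decide, if_false,
        Fin.val_rev]
      omega

/-- The diagonal action on a power. -/
def powAct {G A : Type} [Group G] (α : Act G A) : ∀ n, Act G (Pw A n)
  | 0 => ⟨fun _ a => a, fun _ => rfl, fun _ _ _ => rfl⟩
  | n + 1 => α.prod (powAct α n)

theorem Act.IsCx.pow {G A : Type} [Group G] [Fintype A] [DecidableEq A] {α : Act G A} {X : Cx A}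
    (hα : α.IsCx X) : ∀ n, (powAct α n).IsCx (X.pow n)
  | 0 => ⟨fun _ _ _ => rfl, fun _ _ => rfl, fun _ _ => rfl⟩
  | n + 1 => hα.prod (Act.IsCx.pow hα n)

/-- The grid structure on the cube. -/
abbrev Cx.cube (n L : ℕ) : Cx (Pw (Fin (2 * L + 1)) n) := (Cx.line L).pow n

/-- The end of the interval with a given sign. -/
def endp (L : ℕ) (s : ℤˣ) : Fin (2 * L + 1) := if s = 1 then Fin.last _ else 0

/-- The chains of the standard equivariant map from the sphere to the boundary of a cube. -/
def cubeChain (L : ℕ) : ∀ n, ℕ → ℤˣ → Pw (Fin (2 * L + 1)) n → ZMod 2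
  | 0, i, _, _ => if i = 0 then 1 else 0
  | n + 1, i, s, c => (if c.1 = endp L s then 1 else 0) * cubeChain L n i s c.2 +
      (if c.1.val % 2 = 1 then 1 else 0) * (if i = 0 then 0 else cubeChain L n (i - 1) (-s)) c.2

theorem tensor_bd_mulVec {A B : Type} [Fintype A] [DecidableEq A] [Fintype B] [DecidableEq B]
    (X : Cx A) (Y : Cx B) (u : A → ZMod 2) (v : B → ZMod 2) :
    (X.tensor Y).bd *ᵥ (fun p => u p.1 * v p.2) =
      (fun p => (X.bd *ᵥ u) p.1 * v p.2) + fun p => u p.1 * (Y.bd *ᵥ v) p.2 := by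
  have key : ∀ (M : Matrix A A (ZMod 2)) (N : Matrix B B (ZMod 2)),
      (M ⊗ₖ N) *ᵥ (fun p : A × B => u p.1 * v p.2) =
        fun p => (M *ᵥ u) p.1 * (N *ᵥ v) p.2 := by
    intro M N
    ext ⟨c, d⟩
    simp only [Matrix.mulVec, dotProduct, Fintype.sum_prod_type, kroneckerMap_apply,
      Finset.sum_mul_sum]
    exact Finset.sum_congr rfl fun _ _ => Finset.sum_congr rfl fun _ _ => by ring
  simp only [Cx.tensor, Matrix.add_mulVec, key, Matrix.one_mulVec]

theorem line_bd_endp (s : ℤˣ) :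
    (Cx.line L).bd *ᵥ (fun c => if c = endp L s then 1 else 0) = 0 := by
  ext c
  simp only [Matrix.mulVec, dotProduct]
  refine Finset.sum_eq_zero fun c' _ => ?_
  by_cases h : c' = endp L s
  · subst h
    have h0 : (Cx.line L).bd c (endp L s) = 0 := by
      by_contra h0
      have := (Cx.line_bd_ne_zero h0).1
      rcases Int.units_eq_one_or s with rfl | rfl <;> simp [endp] at this
    rw [h0, zero_mul]
  · rw [if_neg h, mul_zero]

theorem line_bd_edges (s : ℤˣ) :
    (Cx.line L).bd *ᵥ (fun c => if c.val % 2 = 1 then 1 else 0) =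
      (fun c => if c = endp L s then 1 else 0) + fun c => if c = endp L (-s) then 1 else 0 := by
  ext c
  have hc := c.isLt
  have key : ((Cx.line L).bd *ᵥ (fun c => if c.val % 2 = 1 then 1 else 0)) c =
      (if c = 0 then 1 else 0) + if c = Fin.last _ then 1 else 0 := by
    simp only [Matrix.mulVec, dotProduct]
    by_cases hodd : c.val % 2 = 1
    · rw [Finset.sum_eq_zero, if_neg, if_neg, add_zero]
      · rintro rfl
        simp at hodd
      · rintro rfl
        simp at hodd
      · intro c' _
        by_cases h : (Cx.line L).bd c c' = 0
        · rw [h, zero_mul]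
        · have := Cx.line_bd_ne_zero h
          omega
    · have h1 : ∀ c' : Fin (2 * L + 1), (Cx.line L).bd c c' * (if c'.val % 2 = 1 then 1 else 0) =
          (if c'.val = c.val + 1 then 1 else 0) +
            if c'.val = c.val - 1 then (if c.val = 0 then 0 else 1) else 0 := by
        intro c'
        simp only [Cx.line, Matrix.of_apply]
        split_ifs <;> first | omega | simp
      rw [Finset.sum_congr rfl fun c' _ => h1 c',
        Fin.sum_univ_eq_sum_range (fun c' => (if c' = c.val + 1 then (1 : ZMod 2) else 0) +
          if c' = c.val - 1 then (if c.val = 0 then 0 else 1) else 0), Finset.sum_add_distrib,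
        Finset.sum_ite_eq', Finset.sum_ite_eq']
      simp only [Finset.mem_range, Fin.ext_iff, Fin.val_zero, Fin.val_last]
      split_ifs <;> first | omega | rfl
  rw [key]
  rcases Int.units_eq_one_or s with rfl | rfl <;> simp [endp, add_comm]

theorem cubeChain_succ (n i : ℕ) (s : ℤˣ) : cubeChain L (n + 1) i s =
    (fun p : Fin (2 * L + 1) × Pw (Fin (2 * L + 1)) n =>
      (if p.1 = endp L s then 1 else 0) * cubeChain L n i s p.2) +
    fun p : Fin (2 * L + 1) × Pw (Fin (2 * L + 1)) n => (if p.1.val % 2 = 1 then 1 else 0) *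
      (if i = 0 then 0 else cubeChain L n (i - 1) (-s)) p.2 := rfl

theorem cubeChain_zero_of_lt : ∀ n i s, n < i → cubeChain L n i s = 0
  | 0, i, s, h => funext fun _ => if_neg (by omega)
  | n + 1, i, s, h => by
    rw [cubeChain_succ, cubeChain_zero_of_lt n i s (by omega),
      cubeChain_zero_of_lt n (i - 1) (-s) (by omega)]
    refine funext fun p => ?_
    change _ * (0 : ZMod 2) + _ * (if i = 0 then 0 else 0 : Pw (Fin (2 * L + 1)) n → ZMod 2) _ = 0
    simp

theorem cubeChain_bd_aux₀ {A B : Type} (u u' o : A → ZMod 2) (v : B → ZMod 2) :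
    ((fun p : A × B => (0 : A → ZMod 2) p.1 * v p.2) + fun p => u p.1 * (0 : B → ZMod 2) p.2) +
      ((fun p => (u + u') p.1 * (0 : B → ZMod 2) p.2) + fun p => o p.1 * (0 : B → ZMod 2) p.2) =
        0 := by
  ext p
  simp

theorem cubeChain_bd_aux {A B : Type} (u u' o : A → ZMod 2) (v a b w w₁ w₂ : B → ZMod 2)
    (h : w = w₁ + w₂) :
    ((fun p : A × B => (0 : A → ZMod 2) p.1 * v p.2) + fun p => u p.1 * (a + b) p.2) +
      ((fun p => (u + u') p.1 * b p.2) + fun p => o p.1 * w p.2) =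
      ((fun p => u p.1 * a p.2) + fun p => o p.1 * w₁ p.2) +
        ((fun p => u' p.1 * b p.2) + fun p => o p.1 * w₂ p.2) := by
  subst h
  ext p
  simp only [Pi.add_apply, Pi.zero_apply]
  linear_combination CharTwo.add_self_eq_zero (u p.1 * b p.2)

theorem cubeChain_bd : ∀ n i s, (Cx.cube n L).bd *ᵥ cubeChain L n i s =
    if i = 0 then 0 else cubeChain L n (i - 1) s + cubeChain L n (i - 1) (-s)
  | 0, i, s => by
    have h0 : (Cx.cube 0 L).bd *ᵥ cubeChain L 0 i s = 0 := Matrix.zero_mulVec _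
    rw [h0]
    split_ifs
    · rfl
    · ext c
      exact (CharTwo.add_self_eq_zero _).symm
  | n + 1, i, s => by
    have h1 := cubeChain_bd n i s
    have h2 := cubeChain_bd n (i - 1) (-s)
    have a1 := tensor_bd_mulVec (Cx.line L) (Cx.cube n L) (fun c => if c = endp L s then 1 else 0)
      (cubeChain L n i s)
    have a2 := tensor_bd_mulVec (Cx.line L) (Cx.cube n L) (fun c => if c.val % 2 = 1 then 1 else 0)
      (if i = 0 then 0 else cubeChain L n (i - 1) (-s))
    rw [cubeChain_succ]
    refine (Matrix.mulVec_add _ _ _).trans ?_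
    refine (congrArg₂ (· + ·) a1 a2).trans ?_
    rw [line_bd_endp, line_bd_edges s, h1]
    by_cases hi : i = 0
    · subst hi
      simp only [if_true, Matrix.mulVec_zero]
      exact cubeChain_bd_aux₀ (fun c => if c = endp L s then 1 else 0)
        (fun c => if c = endp L (-s) then 1 else 0)
        (fun c => if c.val % 2 = 1 then 1 else 0) _
    · have h2' : (Cx.cube n L).bd *ᵥ (if i = 0 then 0 else cubeChain L n (i - 1) (-s)) =
          (if i - 1 = 0 then 0 else cubeChain L n (i - 1 - 1) (-s)) +
            if i - 1 = 0 then 0 else cubeChain L n (i - 1 - 1) (- -s) := by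
        rw [if_neg hi, h2]
        split_ifs <;> simp
      simp only [if_neg hi] at h2' ⊢
      rw [cubeChain_succ, cubeChain_succ, h2']
      exact cubeChain_bd_aux (fun c => if c = endp L s then 1 else 0)
        (fun c => if c = endp L (-s) then 1 else 0)
        (fun c => if c.val % 2 = 1 then 1 else 0)
        (cubeChain L n i s) (cubeChain L n (i - 1) s) (cubeChain L n (i - 1) (-s)) _ _ _ rfl

theorem tensor_aug_dot {A B : Type} [Fintype A] [DecidableEq A] [Fintype B] [DecidableEq B]
    (X : Cx A) (Y : Cx B) (u : A → ZMod 2) (v : B → ZMod 2) :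
    (X.tensor Y).aug ⬝ᵥ (fun p => u p.1 * v p.2) = (X.aug ⬝ᵥ u) * (Y.aug ⬝ᵥ v) := by
  simp only [dotProduct, Cx.tensor, Fintype.sum_prod_type, Finset.sum_mul_sum]
  exact Finset.sum_congr rfl fun _ _ => Finset.sum_congr rfl fun _ _ => by ring

theorem cubeChain_aug : ∀ n i s, (Cx.cube n L).aug ⬝ᵥ cubeChain L n i s = if i = 0 then 1 else 0
  | 0, i, s => by
    change ∑ c : Unit, (1 : ZMod 2) * (if i = 0 then 1 else 0) = _
    simp
  | n + 1, i, s => by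
    have a1 := tensor_aug_dot (Cx.line L) (Cx.cube n L) (fun c => if c = endp L s then 1 else 0)
      (cubeChain L n i s)
    have a2 := tensor_aug_dot (Cx.line L) (Cx.cube n L) (fun c => if c.val % 2 = 1 then 1 else 0)
      (if i = 0 then 0 else cubeChain L n (i - 1) (-s))
    have e1 : (Cx.line L).aug ⬝ᵥ (fun c => if c = endp L s then 1 else 0) = 1 := by
      simp only [dotProduct, mul_ite, mul_one, mul_zero, Finset.sum_ite_eq', Finset.mem_univ,
        if_true]
      rcases Int.units_eq_one_or s with rfl | rfl <;> simp [endp, Cx.line]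
    have e2 : (Cx.line L).aug ⬝ᵥ (fun c => if c.val % 2 = 1 then 1 else 0) = 0 := by
      refine Finset.sum_eq_zero fun c _ => ?_
      simp only [Cx.line]
      split_ifs <;> first | omega | rfl
    rw [cubeChain_succ]
    refine (dotProduct_add _ _ _).trans ((congrArg₂ (· + ·) a1 a2).trans ?_)
    rw [e1, e2, one_mul, zero_mul, add_zero, cubeChain_aug]

theorem rev_eq_endp (s : ℤˣ) (c : Fin (2 * L + 1)) : c.rev = endp L (-s) ↔ c = endp L s := by
  have := c.isLt
  rcases Int.units_eq_one_or s with rfl | rfl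
  · rw [endp, endp, if_neg (by decide), if_pos rfl, Fin.ext_iff, Fin.ext_iff, Fin.val_rev,
      Fin.val_zero, Fin.val_last]
    omega
  · rw [endp, endp, if_pos (by decide), if_neg (by decide), Fin.ext_iff, Fin.ext_iff, Fin.val_rev,
      Fin.val_zero, Fin.val_last]
    omega

theorem cubeChain_act (g : ℤˣ) : ∀ n i s c,
    cubeChain L n i (g * s) ((powAct (revAct L) n).act g c) = cubeChain L n i s c := by
  rcases Int.units_eq_one_or g with rfl | rfl
  · intro n i s c
    rw [Act.one, one_mul]
  · intro n
    induction n with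
    | zero => exact fun _ _ _ => rfl
    | succ n ih =>
      intro i s c
      have h1 := ih i s c.2
      have h2 := ih (i - 1) (-s) c.2
      have hc := c.1.isLt
      have e : ((powAct (revAct L) (n + 1)).act (-1) c).1 = c.1.rev := rfl
      have e' : ((powAct (revAct L) (n + 1)).act (-1) c).2 = (powAct (revAct L) n).act (-1) c.2 :=
        rfl
      simp only [cubeChain, e, e', neg_mul, one_mul, rev_eq_endp, Fin.val_rev] at h1 h2 ⊢
      rw [h1]
      congr 1
      congr 1
      · exact if_congr (by omega) rfl rfl
      · split_ifs
        · rfl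
        · exact h2

/-- The top-dimensional cell of the cube. -/
def topcell : ∀ n, Pw (Fin (2 * 1 + 1)) n
  | 0 => ()
  | n + 1 => ((1 : Fin (2 * 1 + 1)), topcell n)

theorem cubeChain_topcell : ∀ n i s, cubeChain 1 n i s (topcell n) = if i = n then 1 else 0
  | 0, i, s => rfl
  | n + 1, i, s => by
    have h1 : (1 : Fin (2 * 1 + 1)) ≠ endp 1 s := by
      rcases Int.units_eq_one_or s with rfl | rfl <;> decide
    have h2 := cubeChain_topcell n (i - 1) (-s)
    change (if (1 : Fin (2 * 1 + 1)) = endp 1 s then 1 else 0) * cubeChain 1 n i s (topcell n) +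
      (if (1 : Fin (2 * 1 + 1)).val % 2 = 1 then 1 else 0) *
        (if i = 0 then 0 else cubeChain 1 n (i - 1) (-s)) (topcell n) = _
    rw [if_neg h1, zero_mul, zero_add, if_pos (by decide), one_mul]
    by_cases hi : i = 0
    · subst hi
      simp
    · rw [if_neg hi, h2]
      exact if_congr (by omega) rfl rfl

/-- The cells in the boundary of the cube. -/
def onBd (L : ℕ) : ∀ n, Pw (Fin (2 * L + 1)) n → Prop
  | 0, _ => False
  | n + 1, c => (c.1 = 0 ∨ c.1 = Fin.last _) ∨ onBd L n c.2

noncomputable instance (n : ℕ) : DecidablePred (onBd L n) := fun _ => Classical.propDecidable _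

theorem onBd_of_cubeChain_ne_zero : ∀ n i s c, i < n → cubeChain L n i s c ≠ 0 → onBd L n c
  | 0, _, _, _, h, _ => absurd h (Nat.not_lt_zero _)
  | n + 1, i, s, c, hi, h => by
    by_contra hb
    simp only [onBd, not_or] at hb
    apply h
    have h1 : c.1 ≠ endp L s := by
      rcases Int.units_eq_one_or s with rfl | rfl
      · exact hb.1.2
      · exact hb.1.1
    by_cases hi0 : i = 0
    · simp [cubeChain, h1, hi0]
    · have h2 : cubeChain L n (i - 1) (-s) c.2 = 0 := by
        by_contra h0
        exact hb.2 (onBd_of_cubeChain_ne_zero n _ _ _ (by omega) h0)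
      simp [cubeChain, h1, hi0, h2]

theorem onBd_face : ∀ n c' c, (Cx.cube n L).bd c' c ≠ 0 → onBd L n c → onBd L n c'
  | 0, _, _, _, hb => hb.elim
  | n + 1, c', c, h, hb => by
    rcases Cx.tensor_bd_ne_zero (X := Cx.line L) (Y := Cx.cube n L) h with ⟨h1, h2⟩ | ⟨h1, h2⟩
    · have h3 := (Cx.line_bd_ne_zero h1).1
      rcases hb with (hb | hb) | hb
      · rw [hb] at h3
        simp at h3
      · rw [hb] at h3
        simp at h3
      · exact Or.inr (h2 ▸ hb)
    · rcases hb with hb | hb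
      · exact Or.inl (h1 ▸ hb)
      · exact Or.inr (onBd_face n _ _ h2 hb)

theorem onBd_act (g : ℤˣ) : ∀ n c, onBd L n c → onBd L n ((powAct (revAct L) n).act g c) := by
  rcases Int.units_eq_one_or g with rfl | rfl
  · intro n c h
    rwa [Act.one]
  · intro n
    induction n with
    | zero => exact fun _ h => h
    | succ n ih =>
      rintro c (h | h)
      · have e : ((powAct (revAct L) (n + 1)).act (-1) c).1 = c.1.rev := rfl
        refine Or.inl ?_
        rw [e]
        rcases h with h | h <;> rw [h] <;> simp
      · exact Or.inr (ih _ h)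

/-- The sign of the first coordinate that differs from the midpoint. -/
def cellSign (L : ℕ) : ∀ n, Pw (Fin (2 * L + 1)) n → ℤˣ
  | 0, _ => 1
  | n + 1, c => if c.1.val < L then -1 else if L < c.1.val then 1 else cellSign L n c.2

theorem cellSign_act (hL : 0 < L) (g : ℤˣ) : ∀ n c, onBd L n c →
    cellSign L n ((powAct (revAct L) n).act g c) = g * cellSign L n c := by
  rcases Int.units_eq_one_or g with rfl | rfl
  · intro n c _
    rw [Act.one, one_mul]
  · intro n
    induction n with
    | zero => exact fun _ h => h.elim
    | succ n ih =>
      intro c h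
      have e : ((powAct (revAct L) (n + 1)).act (-1) c).1 = c.1.rev := rfl
      have e' : ((powAct (revAct L) (n + 1)).act (-1) c).2 = (powAct (revAct L) n).act (-1) c.2 :=
        rfl
      have hc := c.1.isLt
      simp only [cellSign, e, e', Fin.val_rev]
      by_cases h1 : c.1.val < L
      · rw [if_neg (by omega), if_pos (by omega), if_pos h1]
        rfl
      · by_cases h2 : L < c.1.val
        · rw [if_pos (by omega), if_neg h1, if_pos h2]
          rfl
        · rw [if_neg (by omega), if_neg (by omega), if_neg h1, if_neg h2]
          refine ih c.2 (h.resolve_left ?_)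
          rintro (h | h) <;> rw [h] at h1 h2 <;> simp at h1 h2 <;> omega

section Sub

variable {G B : Type} [Group G] [Fintype B] [DecidableEq B]

def Act.sub (α : Act G B) (p : B → Prop) (hp : ∀ g b, p b → p (α.act g b)) : Act G {b // p b} :=
  ⟨fun g b => ⟨α.act g b, hp g b b.2⟩, fun b => Subtype.ext (α.one b),
    fun g h b => Subtype.ext (α.mul g h b)⟩

theorem Act.IsCx.sub {α : Act G B} {X : Cx B} (h : α.IsCx X) (p : B → Prop) [DecidablePred p]
    (hp : ∀ b' b, X.bd b' b ≠ 0 → p b → p b') (hp' : ∀ g b, p b → p (α.act g b)) :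
    (α.sub p hp').IsCx (X.sub p hp) :=
  ⟨fun g b a => h.bd g b a, fun g b => h.aug g b, fun g b => h.deg g b⟩

end Sub

/-- The cells of the boundary of the subdivided cube. -/
abbrev SphCell (n L : ℕ) : Type := {c : Pw (Fin (2 * L + 1)) n // onBd L n c}

/-- The subdivided boundary of the cube. -/
noncomputable def Cx.sph (n L : ℕ) : Cx (SphCell n L) := (Cx.cube n L).sub (onBd L n) (onBd_face n)

def sphAct (n L : ℕ) : Act ℤˣ (SphCell n L) :=
  (powAct (revAct L) n).sub (onBd L n) fun g c => onBd_act g n c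

theorem sphAct_isCx (n L : ℕ) : (sphAct n L).IsCx (Cx.sph n L) :=
  ((revAct_isCx L).pow n).sub _ _ _

/-- The comparison map between the two cell structures on the sphere. -/
def sphMat (n L : ℕ) : Matrix (SphCell n L) (Fin n × ℤˣ) (ZMod 2) :=
  Matrix.of fun c p => cubeChain L n p.1 p.2 c

theorem sphMat_equivar (n L : ℕ) : Equivar (signAct (Fin n)) (sphAct n L) (sphMat n L) :=
  fun g c p => cubeChain_act g n p.1 p.2 c.1

theorem sphMat_isHom (n L : ℕ) : IsHom (Cx.sphere n) (Cx.sph n L) (sphMat n L) where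
  bd := by
    ext c ⟨i, s⟩
    have h := congrFun (cubeChain_bd (L := L) n i s) c
    have h1 : ((Cx.sph n L).bd * sphMat n L) c (i, s) =
        ((Cx.cube n L).bd *ᵥ cubeChain L n i s) c := by
      rw [Matrix.mul_apply]
      refine sum_subtype_eq_sum (onBd L n)
        (fun c' => (Cx.cube n L).bd c c' * cubeChain L n i s c') fun c' hc' => ?_
      have : cubeChain L n i s c' = 0 := by
        by_contra h0
        exact hc' (onBd_of_cubeChain_ne_zero n i s c' i.isLt h0)
      rw [this, mul_zero]
    rw [h1, h, Matrix.mul_apply, Fintype.sum_prod_type]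
    simp only [Cx.sphere_bd_apply, sphMat, Matrix.of_apply]
    by_cases hi : i.val = 0
    · rw [if_pos hi]
      refine (Finset.sum_eq_zero fun j _ => Finset.sum_eq_zero fun t _ => ?_).symm
      rw [if_neg (by omega), mul_zero]
    · rw [if_neg hi, Finset.sum_eq_single (⟨i.val - 1, by omega⟩ : Fin n)]
      · simp only [show i.val - 1 + 1 = i.val by omega, if_true, mul_one]
        rw [show (Finset.univ : Finset ℤˣ) = {1, -1} from rfl, Finset.sum_pair (by decide)]
        rcases Int.units_eq_one_or s with rfl | rfl
        · rfl
        · rw [add_comm]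
          rfl
      · intro j _ hj
        refine Finset.sum_eq_zero fun t _ => ?_
        rw [if_neg, mul_zero]
        intro h'
        exact hj (Fin.ext (by simp; omega))
      · simp
  aug := by
    ext ⟨i, s⟩
    refine (sum_subtype_eq_sum (onBd L n)
        (fun c' => (Cx.cube n L).aug c' * cubeChain L n i s c') fun c' hc' => ?_).trans
        (cubeChain_aug n i s)
    have : cubeChain L n i s c' = 0 := by
      by_contra h0
      exact hc' (onBd_of_cubeChain_ne_zero n i s c' i.isLt h0)
    rw [this, mul_zero]

end Spheres

section Cup

variable {B E : Type} [Fintype B] [DecidableEq B] [Fintype E] [DecidableEq E]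

/-- The part of the boundary that changes the sign. -/
def signBd (X : Cx B) (s : B → ℤˣ) : Matrix B B (ZMod 2) :=
  Matrix.of fun b' b => X.bd b' b * if s b' = s b then 0 else 1

theorem signBd_comm (X : Cx B) (s : B → ℤˣ) : X.bd * signBd X s = signBd X s * X.bd := by
  have h : signBd X s = X.bd * Matrix.diagonal (fun b => if s b = 1 then 1 else 0) +
      Matrix.diagonal (fun b => if s b = 1 then 1 else 0) * X.bd := by
    ext b' b
    rw [Matrix.add_apply, Matrix.mul_diagonal, Matrix.diagonal_mul, signBd, Matrix.of_apply]
    rcases Int.units_eq_one_or (s b) with h | h <;>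
      rcases Int.units_eq_one_or (s b') with h' | h' <;>
        simp [h, h', CharTwo.add_self_eq_zero]
  rw [h, Matrix.mul_add, Matrix.add_mul, ← Matrix.mul_assoc, X.bd_bd, Matrix.zero_mul, zero_add,
    Matrix.mul_assoc _ X.bd X.bd, X.bd_bd, Matrix.mul_zero, add_zero, Matrix.mul_assoc]

theorem signBd_pow_comm (X : Cx B) (s : B → ℤˣ) (i : ℕ) :
    X.bd * signBd X s ^ i = signBd X s ^ i * X.bd :=
  (Commute.pow_right (signBd_comm X s : Commute _ _) i)


/-- A chain map to the product with a cube, built from a sign function on the cells. -/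
def cupMat (X : Cx B) (s : B → ℤˣ) (n : ℕ) (N : Matrix E B (ZMod 2)) :
    Matrix (Pw (Fin (2 * 1 + 1)) n × E) B (ZMod 2) :=
  Matrix.of fun p b => ∑ i ∈ Finset.range (n + 1),
    cubeChain 1 n i (s b) p.1 * (N * signBd X s ^ i) p.2 b

theorem cubeChain_top_add {L : ℕ} (n : ℕ) (s : ℤˣ) :
    cubeChain L n n s + cubeChain L n n (-s) = 0 := by
  have h := cubeChain_bd (L := L) n (n + 1) s
  rw [if_neg (by omega), cubeChain_zero_of_lt n (n + 1) s (by omega), Matrix.mulVec_zero] at h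
  exact h.symm

theorem cupMat_isHom {X : Cx B} {Z : Cx E} {N : Matrix E B (ZMod 2)} (hN : IsHom X Z N)
    (s : B → ℤˣ) (n : ℕ) : IsHom X ((Cx.cube n 1).tensor Z) (cupMat X s n N) where
  bd := by
    ext p b
    have hcol : (((Cx.cube n 1).tensor Z).bd * cupMat X s n N) p b =
        (((Cx.cube n 1).tensor Z).bd *ᵥ ∑ i ∈ Finset.range (n + 1),
          fun p => cubeChain 1 n i (s b) p.1 * (N * signBd X s ^ i) p.2 b) p := by
      rw [Matrix.mul_apply]
      simp only [Matrix.mulVec, dotProduct, Finset.sum_apply]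
      rfl
    have hZ : ∀ i, Z.bd *ᵥ (fun e => (N * signBd X s ^ i : Matrix E B (ZMod 2)) e b) =
        fun e => (N * signBd X s ^ i * X.bd : Matrix E B (ZMod 2)) e b := by
      intro i
      have : Z.bd * (N * signBd X s ^ i) = N * signBd X s ^ i * X.bd := by
        rw [← Matrix.mul_assoc, hN.bd, Matrix.mul_assoc, signBd_pow_comm, Matrix.mul_assoc]
      ext e
      rw [← this]
      rfl
    rw [hcol, Matrix.mulVec_sum, Finset.sum_apply]
    have h1 : ∀ i, (((Cx.cube n 1).tensor Z).bd *ᵥ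
        fun p => cubeChain 1 n i (s b) p.1 * (N * signBd X s ^ i) p.2 b) p =
        (if i = 0 then 0 else cubeChain 1 n (i - 1) (s b) p.1 + cubeChain 1 n (i - 1) (-s b) p.1) *
          (N * signBd X s ^ i) p.2 b +
        cubeChain 1 n i (s b) p.1 * (N * signBd X s ^ i * X.bd) p.2 b := by
      intro i
      rw [tensor_bd_mulVec (Cx.cube n 1) Z (cubeChain 1 n i (s b))
        (fun e => (N * signBd X s ^ i : Matrix E B (ZMod 2)) e b), hZ, cubeChain_bd]
      by_cases hi : i = 0
      · simp [hi]
      · simp [hi]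
    have h2 : (cupMat X s n N * X.bd) p b = ∑ i ∈ Finset.range (n + 1),
        (cubeChain 1 n i (s b) p.1 * (N * signBd X s ^ i * X.bd) p.2 b +
          (cubeChain 1 n i (s b) p.1 + cubeChain 1 n i (-s b) p.1) *
            (N * signBd X s ^ (i + 1)) p.2 b) := by
      rw [Matrix.mul_apply]
      simp only [cupMat, Matrix.of_apply, Finset.sum_mul]
      rw [Finset.sum_comm]
      refine Finset.sum_congr rfl fun i _ => ?_
      rw [pow_succ, ← Matrix.mul_assoc, Matrix.mul_apply (N := X.bd),
        Matrix.mul_apply (N := signBd X s), Finset.mul_sum, Finset.mul_sum,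
        ← Finset.sum_add_distrib]
      refine Finset.sum_congr rfl fun b' _ => ?_
      rw [show signBd X s b' b = X.bd b' b * if s b' = s b then 0 else 1 from rfl]
      split_ifs with h
      · rw [h]
        ring
      · have h' : s b' = -s b := by
          rcases Int.units_eq_one_or (s b) with e | e <;>
            rcases Int.units_eq_one_or (s b') with e' | e' <;> simp_all
        rw [h']
        linear_combination (-1 : ZMod 2) * CharTwo.add_self_eq_zero
          (cubeChain 1 n i (s b) p.1 * (N * signBd X s ^ i) p.2 b' * X.bd b' b)
    rw [Finset.sum_congr rfl fun i _ => h1 i, h2, Finset.sum_add_distrib, Finset.sum_add_distrib,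
      add_comm]
    congr 1
    rw [Finset.sum_range_succ', Finset.sum_range_succ]
    have h3 := congrFun (cubeChain_top_add (L := 1) n (s b)) p.1
    rw [Pi.add_apply, Pi.zero_apply] at h3
    rw [h3]
    simp
  aug := by
    ext b
    have hcol : (((Cx.cube n 1).tensor Z).aug ᵥ* cupMat X s n N) b =
        ((Cx.cube n 1).tensor Z).aug ⬝ᵥ ∑ i ∈ Finset.range (n + 1),
          fun p => cubeChain 1 n i (s b) p.1 * (N * signBd X s ^ i) p.2 b := by
      simp only [Matrix.vecMul, dotProduct, Finset.sum_apply]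
      rfl
    rw [hcol, dotProduct_sum, Finset.sum_eq_single 0]
    · rw [tensor_aug_dot (Cx.cube n 1) Z (cubeChain 1 n 0 (s b))
        (fun e => (N * signBd X s ^ 0 : Matrix E B (ZMod 2)) e b), cubeChain_aug, if_pos rfl,
          one_mul, pow_zero,
        Matrix.mul_one]
      exact congrFun hN.aug b
    · intro i _ hi
      rw [tensor_aug_dot (Cx.cube n 1) Z (cubeChain 1 n i (s b))
        (fun e => (N * signBd X s ^ i : Matrix E B (ZMod 2)) e b), cubeChain_aug, if_neg hi,
          zero_mul]
    · simp

theorem signBd_equivar {G : Type} [Group G] {X : Cx B} {β : Act G B} (hβ : β.IsCx X)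
    {s : B → ℤˣ} {χ : G →* ℤˣ} (hs : ∀ g b, s (β.act g b) = χ g * s b) :
    Equivar β β (signBd X s) := fun g b a => by
  simp only [signBd, Matrix.of_apply, hβ.bd g b a, hs, mul_right_inj]

theorem Equivar.pow {G : Type} [Group G] {β : Act G B} {M : Matrix B B (ZMod 2)}
    (hM : Equivar β β M) (i : ℕ) : Equivar β β (M ^ i) := by
  induction i with
  | zero => exact Equivar.one β
  | succ i ih => exact ih.mul hM

theorem cupMat_equivar {G : Type} [Group G] {X : Cx B} {β : Act G B} (hβ : β.IsCx X)
    {s : B → ℤˣ} {χ : G →* ℤˣ} (hs : ∀ g b, s (β.act g b) = χ g * s b) {δ : Act G E}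
    {N : Matrix E B (ZMod 2)} (hN : Equivar β δ N) (n : ℕ) :
    Equivar β (((powAct (revAct 1) n).comap χ).prod δ) (cupMat X s n N) := by
  intro g p b
  rw [cupMat, Matrix.of_apply, Matrix.of_apply]
  refine Finset.sum_congr rfl fun i _ => ?_
  have h1 := (hN.mul ((signBd_equivar hβ hs).pow i)) g p.2 b
  have h2 := cubeChain_act (L := 1) (χ g) n i (s b) p.1
  rw [hs]
  exact congrArg₂ (· * ·) h2 h1

theorem cupMat_topcell (X : Cx B) (s : B → ℤˣ) (n : ℕ) (N : Matrix E B (ZMod 2)) (e : E) (b : B) :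
    cupMat X s n N (topcell n, e) b = (N * signBd X s ^ n) e b := by
  simp only [cupMat, Matrix.of_apply, cubeChain_topcell]
  rw [Finset.sum_eq_single n]
  · simp
  · intro i _ hi
    rw [if_neg hi, zero_mul]
  · simp

end Cup

section Diagonal

/-- The coefficients of the diagonal-like chain map `diagMat`. -/
def diagCoef (p₁ p₂ u v : ℕ × ℤˣ) : ZMod 2 :=
  if v.1 < u.1 then (if p₁ = v then 1 else 0) * (if p₂ = u then 1 else 0) +
    (if p₁ = u then 1 else 0) * (if p₂ = (v.1, -v.2) then 1 else 0)
  else if u.1 = v.1 then (if p₁ = u then 1 else 0) * (if p₂ = u then 1 else 0) else 0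

/-- An equivariant chain map of the square of a sphere which turns the sign change of the second
factor into the exchange of the two factors. -/
def diagMat (n : ℕ) : Matrix ((Fin n × ℤˣ) × (Fin n × ℤˣ)) ((Fin n × ℤˣ) × (Fin n × ℤˣ)) (ZMod 2) :=
  Matrix.of fun p q => diagCoef (p.1.1, p.1.2) (p.2.1, p.2.2) (q.1.1, q.1.2) (q.2.1, q.2.2)

theorem diagCoef_neg (p₁ p₂ u v : ℕ × ℤˣ) (g : ℤˣ) :
    diagCoef (p₁.1, g * p₁.2) (p₂.1, g * p₂.2) (u.1, g * u.2) (v.1, g * v.2) =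
      diagCoef p₁ p₂ u v := by
  simp only [diagCoef, Prod.ext_iff, ← mul_neg, mul_right_inj]

theorem diagCoef_swap (p₁ p₂ u v : ℕ × ℤˣ) :
    diagCoef p₂ p₁ u (v.1, -v.2) = diagCoef p₁ p₂ u v := by
  simp only [diagCoef, neg_neg, Prod.mk.eta]
  split_ifs with h1 h2 <;> ring

theorem sum_signs (f : ℤˣ → ZMod 2) : ∑ s, f s = f 1 + f (-1) :=
  Finset.sum_pair (by decide)

theorem sum_sphere_bd_mul {n : ℕ} (f : ℕ × ℤˣ → ZMod 2) (h : ∀ s, f (n, s) = 0) (p : Fin n × ℤˣ) :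
    ∑ q : Fin n × ℤˣ, (Cx.sphere n).bd p q * f (q.1, q.2) = f (p.1 + 1, 1) + f (p.1 + 1, -1) := by
  rw [Fintype.sum_prod_type]
  simp only [Cx.sphere_bd_apply, sum_signs, ite_mul, one_mul, zero_mul, ← ite_add_zero]
  by_cases hp : p.1.val + 1 < n
  · rw [Finset.sum_eq_single (⟨p.1.val + 1, hp⟩ : Fin n)]
    · simp
    · intro i _ hi
      rw [if_neg]
      intro h'
      exact hi (Fin.ext h'.symm)
    · simp
  · rw [show p.1.val + 1 = n by omega, h, h, Finset.sum_eq_zero, add_zero]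
    intro i _
    rw [if_neg (by omega)]

theorem sum_mul_sphere_bd {n : ℕ} (f : ℕ × ℤˣ → ZMod 2) (p : Fin n × ℤˣ) :
    ∑ q : Fin n × ℤˣ, f (q.1, q.2) * (Cx.sphere n).bd q p =
      if p.1.val = 0 then 0 else f (p.1 - 1, 1) + f (p.1 - 1, -1) := by
  rw [Fintype.sum_prod_type]
  simp only [Cx.sphere_bd_apply, sum_signs, mul_ite, mul_one, mul_zero, ← ite_add_zero]
  by_cases hp : p.1.val = 0
  · rw [if_pos hp, Finset.sum_eq_zero]
    intro i _
    rw [if_neg (by omega)]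
  · rw [if_neg hp, Finset.sum_eq_single (⟨p.1.val - 1, by omega⟩ : Fin n)]
    · rw [if_pos (by simp; omega)]
    · intro i _ hi
      rw [if_neg]
      intro h'
      exact hi (Fin.ext (by simp; omega))
    · simp

theorem tensor_bd_apply_mul {A B C : Type} [Fintype A] [DecidableEq A] [Fintype B] [DecidableEq B]
    (X : Cx A) (Y : Cx B) (M : Matrix (A × B) C (ZMod 2)) (p : A × B) (c : C) :
    ((X.tensor Y).bd * M) p c =
      ∑ a, X.bd p.1 a * M (a, p.2) c + ∑ b, Y.bd p.2 b * M (p.1, b) c := by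
  rw [Cx.tensor, Matrix.add_mul, Matrix.add_apply, Matrix.mul_apply, Matrix.mul_apply,
    Fintype.sum_prod_type, Fintype.sum_prod_type]
  simp [kroneckerMap_apply, Matrix.one_apply]

theorem mul_tensor_bd_apply {A B C : Type} [Fintype A] [DecidableEq A] [Fintype B] [DecidableEq B]
    (X : Cx A) (Y : Cx B) (M : Matrix C (A × B) (ZMod 2)) (p : A × B) (c : C) :
    (M * (X.tensor Y).bd) c p =
      ∑ a, M c (a, p.2) * X.bd a p.1 + ∑ b, M c (p.1, b) * Y.bd b p.2 := by
  rw [Cx.tensor, Matrix.mul_add, Matrix.add_apply, Matrix.mul_apply, Matrix.mul_apply,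
    Fintype.sum_prod_type, Fintype.sum_prod_type]
  simp [kroneckerMap_apply, Matrix.one_apply]

theorem sum_ite_sign (i j : ℕ) (s : ℤˣ) :
    ((if (i, (1 : ℤˣ)) = (j, s) then 1 else 0) + if (i, (-1 : ℤˣ)) =
      (j, s) then 1 else 0 : ZMod 2) =
      if i = j then 1 else 0 := by
  rcases Int.units_eq_one_or s with rfl | rfl <;> by_cases h : i = j <;> simp [h]

theorem sum_ite_sign' (i j : ℕ) (s : ℤˣ) :
    ((if (i, s) = (j, (1 : ℤˣ)) then 1 else 0) + if (i, s) =
      (j, (-1 : ℤˣ)) then 1 else 0 : ZMod 2) =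
      if i = j then 1 else 0 := by
  rcases Int.units_eq_one_or s with rfl | rfl <;> by_cases h : i = j <;> simp [h]

theorem diagCoef_bd (p₁ p₂ u v : ℕ × ℤˣ) :
    (diagCoef (p₁.1 + 1, 1) p₂ u v + diagCoef (p₁.1 + 1, -1) p₂ u v) +
      (diagCoef p₁ (p₂.1 + 1, 1) u v + diagCoef p₁ (p₂.1 + 1, -1) u v) =
    (if u.1 = 0 then 0 else diagCoef p₁ p₂ (u.1 - 1, 1) v + diagCoef p₁ p₂ (u.1 - 1, -1) v) +
      if v.1 = 0 then 0 else diagCoef p₁ p₂ u (v.1 - 1, 1) + diagCoef p₁ p₂ u (v.1 - 1, -1) := by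
  obtain ⟨p, s⟩ := p₁
  obtain ⟨q, t⟩ := p₂
  obtain ⟨i, a⟩ := u
  obtain ⟨r, b⟩ := v
  have e : ∀ i j : ℕ, j ≠ 0 → (if i + 1 = j then (1 : ZMod 2) else 0) =
      if i = j - 1 then 1 else 0 := fun i j _ => if_congr (by omega) rfl rfl
  have e0 : ∀ i : ℕ, (if i + 1 = 0 then (1 : ZMod 2) else 0) = 0 := fun i => if_neg (by omega)
  rcases lt_trichotomy i r with h | rfl | h
  · have h0 : r ≠ 0 := by omega
    simp only [diagCoef, if_neg h0, if_neg h.not_gt, if_neg h.ne, if_neg (show ¬r < i - 1 by omega),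
      if_neg (show i - 1 ≠ r by omega), if_neg (show ¬r - 1 < i by omega), add_zero, ite_self,
      zero_add]
    exact (CharTwo.add_self_eq_zero _).symm
  · simp only [diagCoef, lt_self_iff_false, if_false, if_true]
    by_cases h0 : i = 0
    · subst h0
      simp only [if_true]
      linear_combination (if (q, t) = (0, a) then 1 else 0) * sum_ite_sign (p + 1) 0 a +
        (if (p, s) = (0, a) then 1 else 0) * sum_ite_sign (q + 1) 0 a +
        (if (q, t) = (0, a) then 1 else 0) * e0 p + (if (p, s) = (0, a) then 1 else 0) * e0 q
    · simp only [if_neg h0, if_pos (show i - 1 < i by omega), if_neg (show ¬i < i - 1 by omega),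
        if_neg (show i - 1 ≠ i by omega), neg_neg]
      linear_combination (if (q, t) = (i, a) then 1 else 0) * sum_ite_sign (p + 1) i a +
        (if (p, s) = (i, a) then 1 else 0) * sum_ite_sign (q + 1) i a +
        (if (q, t) = (i, a) then 1 else 0) * e p i h0 +
        (if (p, s) = (i, a) then 1 else 0) * e q i h0 -
        (if (q, t) = (i, a) then 1 else 0) * sum_ite_sign' p (i - 1) s -
        (if (p, s) = (i, a) then 1 else 0) * sum_ite_sign' q (i - 1) t
  · have hi : i ≠ 0 := by omega
    have key : (if r = 0 then (0 : ZMod 2) else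
        diagCoef (p, s) (q, t) (i, a) (r - 1, 1) + diagCoef (p, s) (q, t) (i, a) (r - 1, -1)) =
        (if p + 1 = r then 1 else 0) * (if (q, t) = (i, a) then 1 else 0) +
          (if (p, s) = (i, a) then 1 else 0) * (if q + 1 = r then 1 else 0) := by
      by_cases h0 : r = 0
      · subst h0
        simp
      · simp only [diagCoef, if_neg h0, if_pos (show r - 1 < i by omega), neg_neg]
        linear_combination (if (q, t) = (i, a) then 1 else 0) * sum_ite_sign' p (r - 1) s +
          (if (p, s) = (i, a) then 1 else 0) * sum_ite_sign' q (r - 1) t -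
          (if (q, t) = (i, a) then 1 else 0) * e p r h0 -
          (if (p, s) = (i, a) then 1 else 0) * e q r h0
    have key' : diagCoef (p, s) (q, t) (i - 1, 1) (r, b) + diagCoef (p, s) (q, t) (i - 1, -1)
      (r, b) =
        (if (p, s) = (r, b) then 1 else 0) * (if q + 1 = i then 1 else 0) +
          (if p + 1 = i then 1 else 0) * (if (q, t) = (r, -b) then 1 else 0) := by
      by_cases h1 : r < i - 1
      · simp only [diagCoef, if_pos h1]
        linear_combination (if (p, s) = (r, b) then 1 else 0) * sum_ite_sign' q (i - 1) t +
          (if (q, t) = (r, -b) then 1 else 0) * sum_ite_sign' p (i - 1) s -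
          (if (p, s) = (r, b) then 1 else 0) * e q i hi -
          (if (q, t) = (r, -b) then 1 else 0) * e p i hi
      · obtain rfl : i = r + 1 := by omega
        simp only [diagCoef, add_tsub_cancel_right, lt_self_iff_false, if_false, if_true,
          Nat.add_right_cancel_iff]
        by_cases hp : p = r <;> by_cases hq : q = r <;>
          simp only [hp, hq, Prod.mk.injEq, if_true, if_false, true_and, false_and, mul_zero,
            zero_mul, add_zero, mul_one, one_mul] <;>
          rcases Int.units_eq_one_or s with rfl | rfl <;>
          rcases Int.units_eq_one_or t with rfl | rfl <;>
          rcases Int.units_eq_one_or b with rfl | rfl <;> decide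
    rw [key, if_neg hi, key']
    simp only [diagCoef, if_pos h]
    linear_combination (if (q, t) = (i, a) then 1 else 0) * sum_ite_sign (p + 1) r b +
      (if (q, t) = (r, -b) then 1 else 0) * sum_ite_sign (p + 1) i a +
      (if (p, s) = (r, b) then 1 else 0) * sum_ite_sign (q + 1) i a +
      (if (p, s) = (i, a) then 1 else 0) * sum_ite_sign (q + 1) r (-b)

theorem diagCoef_eq_zero_left {p₁ p₂ u v : ℕ × ℤˣ} (h : p₁.1 ≠ u.1) (h' : p₁.1 ≠ v.1) :
    diagCoef p₁ p₂ u v = 0 := by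
  have h1 : p₁ ≠ u := fun e => h (congrArg Prod.fst e)
  have h2 : p₁ ≠ v := fun e => h' (congrArg Prod.fst e)
  simp [diagCoef, h1, h2]

theorem diagCoef_eq_zero_right {p₁ p₂ u v : ℕ × ℤˣ} (h : p₂.1 ≠ u.1) (h' : p₂.1 ≠ v.1) :
    diagCoef p₁ p₂ u v = 0 := by
  have h1 : p₂ ≠ u := fun e => h (congrArg Prod.fst e)
  have h2 : p₂ ≠ (v.1, -v.2) := fun e => h' (by rw [e])
  simp [diagCoef, h1, h2]

theorem diagMat_isHom (n : ℕ) : IsHom ((Cx.sphere n).tensor (Cx.sphere n))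
    ((Cx.sphere n).tensor (Cx.sphere n)) (diagMat n) where
  bd := by
    ext p q
    rw [tensor_bd_apply_mul, mul_tensor_bd_apply]
    simp only [diagMat, Matrix.of_apply]
    have hq := q.1.1.isLt
    have hq' := q.2.1.isLt
    rw [sum_sphere_bd_mul (fun a => diagCoef a (p.2.1, p.2.2) (q.1.1, q.1.2) (q.2.1, q.2.2)),
      sum_sphere_bd_mul (fun a => diagCoef (p.1.1, p.1.2) a (q.1.1, q.1.2) (q.2.1, q.2.2)),
      sum_mul_sphere_bd (fun a => diagCoef (p.1.1, p.1.2) (p.2.1, p.2.2) a (q.2.1, q.2.2)),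
      sum_mul_sphere_bd (fun a => diagCoef (p.1.1, p.1.2) (p.2.1, p.2.2) (q.1.1, q.1.2) a)]
    · exact diagCoef_bd (p.1.1, p.1.2) (p.2.1, p.2.2) (q.1.1, q.1.2) (q.2.1, q.2.2)
    · exact fun s => diagCoef_eq_zero_right hq.ne' hq'.ne'
    · exact fun s => diagCoef_eq_zero_left hq.ne' hq'.ne'
  aug := by
    ext ⟨⟨i, a⟩, ⟨r, b⟩⟩
    simp only [Matrix.vecMul, dotProduct, diagMat, Matrix.of_apply, Cx.tensor, Cx.sphere, diagCoef]
    have e : ∀ (j : Fin n) (c : ℤˣ) (p : Fin n × ℤˣ),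
        ((p.1.val, p.2) = (j.val, c)) ↔ p = (j, c) := by
      intro j c p
      simp [Prod.ext_iff, Fin.ext_iff]
    simp only [e, Fintype.sum_prod_type (α₁ := Fin n × ℤˣ)]
    rcases lt_trichotomy i.val r.val with h | h | h
    · simp [h.not_gt, h.ne, (show r.val ≠ 0 by omega)]
    · obtain rfl : i = r := Fin.ext h
      rw [Finset.sum_eq_single (i, a), Finset.sum_eq_single (i, a)]
      · simp
      · intro x _ hx
        simp [hx]
      · simp
      · intro x _ hx
        simp [hx]
      · simp
    · simp [h, (show i.val ≠ 0 by omega), mul_add, Finset.sum_add_distrib]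

end Diagonal

section Mix

variable {n : ℕ} {T E H : Type} [Fintype T] [DecidableEq T] [Fintype E] [DecidableEq E] [Group H]

/-- Two copies of a map, composed with the diagonal-like map `diagMat`. -/
def mixMat (φ : Matrix E ((Fin n × ℤˣ) × T) (ZMod 2)) :
    Matrix (E × E) ((Fin n × ℤˣ) × ((Fin n × ℤˣ) × (T × T))) (ZMod 2) :=
  ((φ ⊗ₖ φ).submatrix id (Equiv.prodProdProdComm (Fin n × ℤˣ) (Fin n × ℤˣ) T T) *
    (diagMat n ⊗ₖ (1 : Matrix (T × T) (T × T) (ZMod 2)))).submatrix id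
      (Equiv.prodAssoc (Fin n × ℤˣ) (Fin n × ℤˣ) (T × T)).symm

theorem mixMat_apply (φ : Matrix E ((Fin n × ℤˣ) × T) (ZMod 2)) (e : E × E) (w v : Fin n × ℤˣ)
    (t : T × T) : mixMat φ e (w, (v, t)) =
      ∑ p, φ e.1 (p.1, t.1) * φ e.2 (p.2, t.2) * diagMat n p (w, v) := by
  rw [mixMat, Matrix.submatrix_apply, Matrix.mul_apply, Fintype.sum_prod_type]
  refine Finset.sum_congr rfl fun p _ => ?_
  rw [Finset.sum_eq_single t]
  · simp [Equiv.prodProdProdComm]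
  · intro t' _ ht
    simp [ht]
  · simp

theorem mixMat_isHom {Y : Cx T} {Z : Cx E} {φ : Matrix E ((Fin n × ℤˣ) × T) (ZMod 2)}
    (hφ : IsHom ((Cx.sphere n).tensor Y) Z φ) :
    IsHom ((Cx.sphere n).tensor ((Cx.sphere n).tensor (Y.tensor Y))) (Z.tensor Z) (mixMat φ) := by
  refine IsHom.submatrix (Y := ((Cx.sphere n).tensor (Cx.sphere n)).tensor (Y.tensor Y)) ?_ _ ?_ ?_
  · refine IsHom.comp (Y := ((Cx.sphere n).tensor (Cx.sphere n)).tensor (Y.tensor Y)) ?_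
      ((diagMat_isHom n).tensor (IsHom.one _))
    refine (hφ.tensor hφ).submatrix _ ?_ ?_
    · ext ⟨⟨a, b⟩, ⟨c, d⟩⟩ ⟨⟨a', b'⟩, ⟨c', d'⟩⟩
      simp only [Cx.tensor, Matrix.add_apply, kroneckerMap_apply, Matrix.submatrix_apply,
        Equiv.prodProdProdComm_apply, ← Matrix.one_kronecker_one]
      ring
    · ext ⟨⟨a, b⟩, ⟨c, d⟩⟩
      simp only [Cx.tensor, Function.comp, Equiv.prodProdProdComm_apply]
      ring
  · ext ⟨a, b, c, d⟩ ⟨a', b', c', d'⟩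
    simp only [Cx.tensor, Matrix.add_apply, kroneckerMap_apply, Matrix.submatrix_apply,
      Equiv.prodAssoc_symm_apply, ← Matrix.one_kronecker_one]
    ring
  · ext ⟨a, b, c, d⟩
    simp only [Cx.tensor, Function.comp, Equiv.prodAssoc_symm_apply]
    ring

/-- The wreath product acting on pairs. -/
def pairAct (β : Act (H × ℤˣ) E) : Act (Wr H × ℤˣ) (E × E) where
  act g p := swapIf g.1.s (β.act (g.1.l, g.2) p.1, β.act (g.1.r, g.2) p.2)
  one p := by
    have h2 := β.one p.1
    have h3 := β.one p.2
    simp only [Prod.one_eq_mk] at h2 h3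
    simp [Wr.one_def, swapIf, h2, h3]
  mul := by
    rintro ⟨⟨s, l, r⟩, γ⟩ ⟨⟨s', l', r'⟩, γ'⟩ p
    have h2 := fun l l' => β.mul (l, γ) (l', γ')
    simp only [Prod.mk_mul_mk] at h2
    rcases Int.units_eq_one_or s with rfl | rfl <;>
      rcases Int.units_eq_one_or s' with rfl | rfl <;> simp_all [Wr.mul_def, swapIf]

/-- The action on a sphere times another factor. -/
def sphProd (n : ℕ) (β : Act (H × ℤˣ) T) : Act (H × ℤˣ) ((Fin n × ℤˣ) × T) :=
  ((signAct (Fin n)).comap (MonoidHom.snd H ℤˣ)).prod β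

theorem diagMat_neg (g : ℤˣ) (p q : (Fin n × ℤˣ) × (Fin n × ℤˣ)) :
    diagMat n ((p.1.1, g * p.1.2), (p.2.1, g * p.2.2)) ((q.1.1, g * q.1.2), (q.2.1, g * q.2.2)) =
      diagMat n p q :=
  diagCoef_neg (p.1.1, p.1.2) (p.2.1, p.2.2) (q.1.1, q.1.2) (q.2.1, q.2.2) g

theorem diagMat_swap (p q : (Fin n × ℤˣ) × (Fin n × ℤˣ)) :
    diagMat n (p.2, p.1) (q.1, (q.2.1, -q.2.2)) = diagMat n p q :=
  diagCoef_swap (p.1.1, p.1.2) (p.2.1, p.2.2) (q.1.1, q.1.2) (q.2.1, q.2.2)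

theorem mixMat_equivar {β : Act (H × ℤˣ) T} {δ : Act (H × ℤˣ) E}
    {φ : Matrix E ((Fin n × ℤˣ) × T) (ZMod 2)} (hφ : Equivar (sphProd n β) δ φ) :
    Equivar (sphProd n (wrAct ((signAct (Fin n)).comap mulMonoidHom) β)) (pairAct δ)
      (mixMat φ) := by
  rintro ⟨⟨s, l, r⟩, γ⟩ ⟨e₁, e₂⟩ ⟨w, v, t₁, t₂⟩
  have h1 : ∀ w t, φ (δ.act (l, γ) e₁) ((w.1, γ * w.2), β.act (l, γ) t) = φ e₁ (w, t) :=
    fun w t => hφ (l, γ) e₁ (w, t)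
  have h2 : ∀ w t, φ (δ.act (r, γ) e₂) ((w.1, γ * w.2), β.act (r, γ) t) = φ e₂ (w, t) :=
    fun w t => hφ (r, γ) e₂ (w, t)
  have hb : (sphProd n (wrAct ((signAct (Fin n)).comap mulMonoidHom) β)).act (⟨s, l, r⟩, γ)
      (w, v, t₁, t₂) = ((w.1, γ * w.2), (v.1, s * γ * v.2),
        swapIf s (β.act (l, γ) t₁, β.act (r, γ) t₂)) := rfl
  have he : (pairAct δ).act (⟨s, l, r⟩, γ) (e₁, e₂) =
      swapIf s (δ.act (l, γ) e₁, δ.act (r, γ) e₂) := rfl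
  rw [hb, he, mixMat_apply, mixMat_apply]
  let σ : (Fin n × ℤˣ) × (Fin n × ℤˣ) ≃ (Fin n × ℤˣ) × (Fin n × ℤˣ) :=
    Equiv.prodCongr ((signAct (Fin n)).equiv γ) ((signAct (Fin n)).equiv γ)
  rcases Int.units_eq_one_or s with rfl | rfl
  · rw [← σ.sum_comp]
    refine Finset.sum_congr rfl fun p _ => ?_
    have h3 := diagMat_neg γ p (w, v)
    simp only [swapIf, if_true, one_mul]
    exact congrArg₂ (· * ·) (congrArg₂ (· * ·) (h1 p.1 t₁) (h2 p.2 t₂)) h3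
  · rw [← ((Equiv.prodComm _ _).trans σ).sum_comp]
    refine Finset.sum_congr rfl fun p _ => ?_
    have h3 := (diagMat_neg γ (p.2, p.1) (w, (v.1, -v.2))).trans (diagMat_swap p (w, v))
    have h4 : -1 * γ * v.2 = γ * -v.2 := by simp
    simp only [swapIf, show ((-1 : ℤˣ) = 1) = False by decide, if_false, h4]
    refine congrArg₂ (· * ·) ((congrArg₂ (· * ·) (h2 p.2 t₂) (h1 p.1 t₁)).trans (mul_comm _ _)) h3

end Mix

section Phi

/-- The domain of the test map, as a cell complex. -/
abbrev srcCx (n j : ℕ) : Cx ((Fin n × ℤˣ) × Tr (Fin n × ℤˣ) j) :=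
  (Cx.sphere n).tensor ((Cx.sphere n).tree j)

abbrev srcTree (n j : ℕ) : Act (TG j × ℤˣ) (Tr (Fin n × ℤˣ) j) :=
  treeAct ((signAct (Fin n)).comap mulMonoidHom) j

/-- The target of the test map, as a cell complex. -/
abbrev tgtCx (n j : ℕ) : Cx (Tr (Pw (Fin (2 * 1 + 1)) n) j) := (Cx.cube n 1).tree j

abbrev tgtAct (n j : ℕ) : Act (TG j × ℤˣ) (Tr (Pw (Fin (2 * 1 + 1)) n) j) :=
  treeAct ((powAct (revAct 1) n).comap (MonoidHom.fst ℤˣ ℤˣ)) j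

theorem srcAct_isCx (n j : ℕ) : (sphProd n (srcTree n j)).IsCx (srcCx n j) :=
  ((signAct_isCx n).comap _).prod (((signAct_isCx n).comap _).tree j)

/-- The sign used to build the model map. -/
def rootSign {n : ℕ} {T : Type} (b : (Fin n × ℤˣ) × ((Fin n × ℤˣ) × T)) : ℤˣ := b.1.2 * b.2.1.2

/-- The model equivariant map, on the level of chains. -/
def phi (n : ℕ) : ∀ j, Matrix (Tr (Pw (Fin (2 * 1 + 1)) n) j) ((Fin n × ℤˣ) × Tr (Fin n × ℤˣ) j)
    (ZMod 2)
  | 0 => Matrix.of fun _ p => (Cx.sphere n).aug p.1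
  | j + 1 => cupMat (srcCx n (j + 1)) rootSign n (mixMat (phi n j))

theorem phi_isHom (n : ℕ) : ∀ j, IsHom (srcCx n j) (tgtCx n j) (phi n j)
  | 0 => by
    have h : (fun p : (Fin n × ℤˣ) × Unit => (Cx.sphere n).aug p.1) = (srcCx n 0).aug := by
      ext p
      exact (mul_one _).symm
    have h' : (Matrix.of fun _ p => (Cx.sphere n).aug p.1 :
      Matrix Unit ((Fin n × ℤˣ) × Unit) (ZMod 2)) = phi n 0 := rfl
    have h0 := (srcCx n 0).aug_bd
    rw [← h] at h0
    constructor
    · refine (Matrix.zero_mul _).trans ?_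
      ext a b
      exact (congrFun h0 b).symm
    · rw [← h]
      ext b
      change ∑ a : Unit, (1 : ZMod 2) * (Cx.sphere n).aug b.1 = _
      simp
  | j + 1 => cupMat_isHom (X := srcCx n (j + 1)) (mixMat_isHom (phi_isHom n j)) rootSign n

theorem phi_equivar (n : ℕ) : ∀ j, Equivar (sphProd n (srcTree n j)) (tgtAct n j) (phi n j)
  | 0 => fun _ _ _ => rfl
  | j + 1 => by
    let χ : Wr (TG j) × ℤˣ →* ℤˣ :=
      ⟨⟨fun g => g.1.s, rfl⟩, fun a b => by
        change (a.1 * b.1).s = a.1.s * b.1.s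
        rw [Wr.mul_def]
        split_ifs <;> rfl⟩
    refine cupMat_equivar (χ := χ) (srcAct_isCx n (j + 1)) ?_ (mixMat_equivar (phi_equivar n j)) n
    rintro ⟨⟨s, l, r⟩, γ⟩ ⟨w, v, t₁, t₂⟩
    change γ * w.2 * (s * γ * v.2) = s * (w.2 * v.2)
    rcases Int.units_eq_one_or γ with rfl | rfl <;> rcases Int.units_eq_one_or s with rfl | rfl <;>
      simp

/-- The top cell of the target of the test map. -/
def topTree (n : ℕ) : ∀ j, Tr (Pw (Fin (2 * 1 + 1)) n) j
  | 0 => ()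
  | j + 1 => (topcell n, (topTree n j, topTree n j))

/-- All labels of the tree are cells of the top dimension. -/
def IsFull {n : ℕ} : ∀ j, Tr (Fin n × ℤˣ) j → Prop
  | 0, _ => True
  | j + 1, t => t.1.1.val + 1 = n ∧ IsFull j t.2.1 ∧ IsFull j t.2.2

/-- The sign changing part of the boundary of a sphere. -/
def flipBd (n : ℕ) : Matrix (Fin n × ℤˣ) (Fin n × ℤˣ) (ZMod 2) := Matrix.of fun p q =>
  if p.1.val + 1 = q.1 then (if p.2 = -q.2 then (1 : ZMod 2) else 0) else 0

theorem sum_mul_flipBd {n : ℕ} (g : Fin n × ℤˣ → ZMod 2) (q : Fin n × ℤˣ) :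
    ∑ p, g p * flipBd n p q = ∑ a, g (a, -q.2) * if a.val + 1 = q.1 then 1 else 0 := by
  rw [Fintype.sum_prod_type]
  refine Finset.sum_congr rfl fun a _ => ?_
  rw [Finset.sum_eq_single (-q.2)]
  · simp [flipBd]
  · intro s _ hs
    simp [flipBd, hs]
  · exact fun h => absurd (Finset.mem_univ _) h

theorem signBd_src_eq {n : ℕ} {T : Type} [Fintype T] [DecidableEq T] (Y : Cx T) :
    signBd ((Cx.sphere n).tensor ((Cx.sphere n).tensor Y)) rootSign =
      flipBd n ⊗ₖ (1 : Matrix ((Fin n × ℤˣ) × T) ((Fin n × ℤˣ) × T) (ZMod 2)) +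
      (1 : Matrix (Fin n × ℤˣ) (Fin n × ℤˣ) (ZMod 2)) ⊗ₖ
        (flipBd n ⊗ₖ (1 : Matrix T T (ZMod 2))) := by
  have hsgn : ∀ a b : ℤˣ, (if a = b then (0 : ZMod 2) else 1) = if a = -b then 1 else 0 := by
    decide
  have e1 : ∀ a b c : ℤˣ, (a * b = c * b) = (a = c) := by decide
  have e2 : ∀ a b c : ℤˣ, (a * b = a * c) = (b = c) := by decide
  have k : ∀ (v' v : Fin n × ℤˣ) (t' t : T),
      (1 : Matrix ((Fin n × ℤˣ) × T) ((Fin n × ℤˣ) × T) (ZMod 2)) (v', t') (v, t) =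
        (1 : Matrix (Fin n × ℤˣ) (Fin n × ℤˣ) (ZMod 2)) v' v * (1 : Matrix T T (ZMod 2)) t' t := by
    intro v' v t' t
    rw [← Matrix.one_kronecker_one]
    rfl
  ext ⟨w', v', t'⟩ ⟨w, v, t⟩
  simp only [signBd, rootSign, Cx.tensor, Matrix.of_apply, Matrix.add_apply, kroneckerMap_apply, k]
  by_cases hv : v' = v
  · subst hv
    by_cases hw : w' = w
    · subst hw
      simp [flipBd]
    · simp only [e1, hsgn, Matrix.one_apply_ne hw, zero_mul, add_zero, Cx.sphere_bd_apply, flipBd,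
        Matrix.of_apply]
      split_ifs <;> simp
  · by_cases hw : w' = w
    · subst hw
      simp only [e2, hsgn, Matrix.one_apply_ne hv, zero_mul, add_zero, mul_zero, zero_add,
        Cx.sphere_bd_apply, flipBd, Matrix.of_apply]
      split_ifs <;> simp
    · simp [Matrix.one_apply_ne hv, Matrix.one_apply_ne hw]

theorem sum_mul_signBd_src {n : ℕ} {T : Type} [Fintype T] [DecidableEq T] (Y : Cx T)
    (f : (Fin n × ℤˣ) × ((Fin n × ℤˣ) × T) → ZMod 2) (w v : Fin n × ℤˣ) (t : T) :
    ∑ b, f b * signBd ((Cx.sphere n).tensor ((Cx.sphere n).tensor Y)) rootSign b (w, v, t) =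
      (∑ a, f ((a, -w.2), v, t) * if a.val + 1 = w.1 then 1 else 0) +
        ∑ a, f (w, (a, -v.2), t) * if a.val + 1 = v.1 then 1 else 0 := by
  rw [signBd_src_eq, ← sum_mul_flipBd (fun p => f (p, v, t)), ← sum_mul_flipBd
    (fun p => f (w, p, t))]
  simp only [Matrix.add_apply, mul_add, Finset.sum_add_distrib, kroneckerMap_apply]
  congr 1
  · rw [Fintype.sum_prod_type]
    refine Finset.sum_congr rfl fun p _ => ?_
    rw [Finset.sum_eq_single (v, t)]
    · simp
    · intro x _ hx
      simp [hx]
    · simp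
  · rw [Fintype.sum_prod_type, Finset.sum_eq_single w]
    · rw [Fintype.sum_prod_type]
      refine Finset.sum_congr rfl fun p _ => ?_
      rw [Finset.sum_eq_single t]
      · simp
      · intro x _ hx
        simp [hx]
      · simp
    · intro x _ hx
      simp [hx]
    · simp

theorem sum_fin_pred {n : ℕ} (g : ℕ → ZMod 2) (i : Fin n) :
    (∑ a : Fin n, g a * if a.val + 1 = i.val then 1 else 0) =
      if i.val = 0 then 0 else g (i - 1) := by
  by_cases hi : i.val = 0
  · rw [if_pos hi]
    refine Finset.sum_eq_zero fun a _ => ?_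
    rw [if_neg (by omega), mul_zero]
  · rw [if_neg hi, Finset.sum_eq_single (⟨i.val - 1, by omega⟩ : Fin n)]
    · simp only
      rw [if_pos (by omega), mul_one]
    · intro a _ ha
      rw [if_neg, mul_zero]
      intro h
      exact ha (Fin.ext (by simp; omega))
    · simp

/-- Iterating the sign changing boundary produces binomial coefficients. -/
theorem mix_signBd_pow {n : ℕ} {T E : Type} [Fintype T] [DecidableEq T] [Fintype E]
    [DecidableEq E] (Y : Cx T) {φ : Matrix E ((Fin n × ℤˣ) × T) (ZMod 2)} {e : E × E} {t : T × T}
    {q : ℕ} (h₁ : ∀ w : Fin n × ℤˣ, φ e.1 (w, t.1) = if w.1.val = q then 1 else 0)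
    (h₂ : ∀ w : Fin n × ℤˣ, φ e.2 (w, t.2) = if w.1.val = q then 1 else 0) :
    ∀ (m : ℕ) (w v : Fin n × ℤˣ),
      (mixMat φ * signBd ((Cx.sphere n).tensor ((Cx.sphere n).tensor (Y.tensor Y))) rootSign ^ m)
        e (w, v, t) =
      if q ≤ w.1.val ∧ q ≤ v.1.val ∧ w.1.val + v.1.val = 2 * q + m then
        (m.choose (w.1.val - q) : ZMod 2) else 0
  | 0, w, v => by
    rw [pow_zero, Matrix.mul_one, mixMat_apply]
    simp only [h₁, h₂, diagMat, Matrix.of_apply, diagCoef]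
    have e : ∀ (j : Fin n) (c : ℤˣ) (p : Fin n × ℤˣ),
        ((p.1.val, p.2) = (j.val, c)) ↔ p = (j, c) := by
      intro j c p
      simp [Prod.ext_iff, Fin.ext_iff]
    simp only [e, Fintype.sum_prod_type (α₁ := Fin n × ℤˣ)]
    rcases lt_trichotomy w.1.val v.1.val with h | h | h
    · simp only [h.not_gt, h.ne, if_false, mul_zero, Finset.sum_const_zero]
      rw [if_neg (by omega)]
    · have h' : w.1 = v.1 := Fin.ext h
      rw [Finset.sum_eq_single w, Finset.sum_eq_single w]
      · simp only [h, lt_self_iff_false, if_false, if_true, Prod.mk.eta, mul_one]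
        by_cases hq : v.1.val = q
        · rw [if_pos hq, if_pos (by omega), hq, Nat.sub_self]
          simp
        · rw [if_neg hq, if_neg (by omega), zero_mul]
      · intro x _ hx
        simp [h, hx]
      · simp
      · intro x _ hx
        simp [h, hx]
      · simp
    · have hne : ¬(w.1.val = q ∧ v.1.val = q) := by omega
      rw [if_neg (by omega)]
      refine Finset.sum_eq_zero fun x _ => Finset.sum_eq_zero fun y _ => ?_
      rw [if_pos h]
      by_cases hx : x.1.val = q
      · by_cases hy : y.1.val = q
        · have : (x = (v.1, v.2) → y ≠ (w.1, w.2)) ∧ (x = (w.1, w.2) → y ≠ (v.1, -v.2)) := by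
            constructor
            · rintro rfl rfl
              exact hne ⟨hy, hx⟩
            · rintro rfl rfl
              exact hne ⟨hx, hy⟩
          simp only [mul_add, ← ite_and, mul_ite, mul_one, mul_zero]
          rw [if_neg (fun h => this.1 h.1.2 h.1.1), if_neg (fun h => this.2 h.1.2 h.1.1), add_zero]
        · simp [hy]
      · simp [hx]
  | m + 1, w, v => by
    have ih := mix_signBd_pow Y h₁ h₂ m
    rw [pow_succ, ← Matrix.mul_assoc, Matrix.mul_apply, sum_mul_signBd_src]
    simp only [ih]
    rw [sum_fin_pred (fun a => if q ≤ a ∧ q ≤ v.1.val ∧ a + v.1.val = 2 * q + m then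
        (m.choose (a - q) : ZMod 2) else 0) w.1,
      sum_fin_pred (fun a => if q ≤ w.1.val ∧ q ≤ a ∧ w.1.val + a = 2 * q + m then
        (m.choose (w.1.val - q) : ZMod 2) else 0) v.1]
    obtain ⟨⟨i, hi⟩, a⟩ := w
    obtain ⟨⟨r, hr⟩, b⟩ := v
    simp only
    by_cases hc : q ≤ i ∧ q ≤ r ∧ i + r = 2 * q + (m + 1)
    · obtain ⟨k, rfl⟩ := Nat.exists_eq_add_of_le hc.1
      rw [if_pos hc]
      have e2 : (if r = 0 then (0 : ZMod 2) else if q ≤ q + k ∧ q ≤ r - 1 ∧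
          q + k + (r - 1) = 2 * q + m then (m.choose (q + k - q) : ZMod 2) else 0) =
          (m.choose k : ZMod 2) := by
        by_cases hk : k = m + 1
        · rw [hk, Nat.choose_succ_self, Nat.cast_zero]
          split_ifs <;> first | omega | rfl
        · rw [if_neg (by omega), if_pos (by omega), add_tsub_cancel_left]
      rw [e2, add_tsub_cancel_left]
      rcases k with _ | k
      · simp only [add_zero, Nat.choose_zero_right]
        split_ifs <;> first | omega | simp
      · rw [if_neg (by omega), if_pos (by omega), show q + (k + 1) - 1 - q = k by omega,
          Nat.choose_succ_succ, Nat.cast_add]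
    · rw [if_neg hc]
      split_ifs <;> first | omega | simp

theorem choose_two_pow_sub_one (a : ℕ) : ∀ b, b < 2 ^ a →
    (((2 ^ a - 1).choose b : ℕ) : ZMod 2) = 1
  | 0, _ => by simp
  | b + 1, hb => by
    have ih := choose_two_pow_sub_one a b (by omega)
    have h := Nat.choose_succ_succ (2 ^ a - 1) b
    have h2 : 2 ∣ (2 ^ a).choose (b + 1) :=
      Nat.Prime.dvd_choose_pow Nat.prime_two (by omega) (by omega)
    have h1 : (2 ^ a - 1).succ = 2 ^ a := by
      have := Nat.one_le_two_pow (n := a)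
      omega
    rw [h1] at h
    have h3 : (((2 ^ a).choose (b + 1) : ℕ) : ZMod 2) = 0 := (ZMod.natCast_eq_zero_iff _ _).2 h2
    rw [h, Nat.cast_add, ih] at h3
    revert h3
    generalize (((2 ^ a - 1).choose b.succ : ℕ) : ZMod 2) = x
    revert x
    decide

theorem phi_top {r : ℕ} : ∀ j, j ≤ r + 1 → ∀ (w : Fin (2 ^ (r + 1) - 1) × ℤˣ)
    (t : Tr (Fin (2 ^ (r + 1) - 1) × ℤˣ) j), IsFull j t →
    phi (2 ^ (r + 1) - 1) j (topTree _ j) (w, t) = if w.1.val = 2 ^ j - 1 then 1 else 0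
  | 0, _, w, t, _ => by
    simp [phi, Cx.sphere]
  | j + 1, hj, w, ⟨v, t₁, t₂⟩, ht => by
    have h1 := fun w => phi_top j (by omega) w t₁ ht.2.1
    have h2 := fun w => phi_top j (by omega) w t₂ ht.2.2
    have hv : v.1.val + 1 = 2 ^ (r + 1) - 1 := ht.1
    have key := mix_signBd_pow ((Cx.sphere (2 ^ (r + 1) - 1)).tree j)
      (e := (topTree _ j, topTree _ j))
      (t := (t₁, t₂)) h1 h2 (2 ^ (r + 1) - 1) w v
    refine (cupMat_topcell _ _ _ _ _ _).trans (key.trans ?_)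
    have hp : 2 ^ j ≤ 2 ^ r := Nat.pow_le_pow_right (by norm_num) (by omega)
    have hp' : 1 ≤ 2 ^ j := Nat.one_le_two_pow
    have hr : 2 ^ (r + 1) = 2 ^ r * 2 := pow_succ _ _
    have hj' : 2 ^ (j + 1) = 2 ^ j * 2 := pow_succ _ _
    by_cases hw : w.1.val = 2 ^ (j + 1) - 1
    · rw [if_pos hw, if_pos (by omega)]
      exact choose_two_pow_sub_one (r + 1) _ (by omega)
    · rw [if_neg hw, if_neg (by omega)]

end Phi

/-- The cells of the subdivided interval allowed for a set of numbers which may contain nonnegative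
numbers (`p`) and nonpositive numbers (`q`). -/
def lineCarrier (p q : Prop) : Set (Fin (2 * 1 + 1)) := {c | (c ≠ 0 → p) ∧ (c ≠ 2 → q)}

theorem contr_lineCarrier {p q : Prop} (h : p ∨ q) : Contr (Cx.line 1) (lineCarrier p q) := by
  by_cases hp : p
  · refine ⟨Matrix.of fun a b => if a = 1 ∧ b = 0 then 1 else 0, fun a => if a = 2 then 1 else 0,
      ?_, ?_, by decide, by decide, by decide, by decide⟩
    · intro d hd
      have : d = 2 := by
        by_contra h'
        exact hd (if_neg h')
      exact ⟨fun _ => hp, fun h' => absurd this h'⟩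
    · intro a b hab hb
      have : a = 1 ∧ b = 0 := by
        by_contra h'
        exact hab (if_neg h')
      exact ⟨fun _ => hp, fun _ => hb.2 (by rw [this.2]; decide)⟩
  · have hq := h.resolve_left hp
    refine ⟨Matrix.of fun a b => if a = 1 ∧ b = 2 then 1 else 0, fun a => if a = 0 then 1 else 0,
      ?_, ?_, by decide, by decide, by decide, by decide⟩
    · intro d hd
      have : d = 0 := by
        by_contra h'
        exact hd (if_neg h')
      exact ⟨fun h' => absurd this h', fun _ => hq⟩
    · intro a b hab hb
      have : a = 1 ∧ b = 2 := by
        by_contra h'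
        exact hab (if_neg h')
      exact ⟨fun _ => hb.1 (by rw [this.2]; decide), fun _ => hq⟩

theorem contr_unit : Contr Cx.unit Set.univ :=
  ⟨0, 1, fun _ _ => trivial, fun _ _ _ _ => trivial, by decide, by decide, by decide, by decide⟩

theorem contr_line_univ : Contr (Cx.line 1) Set.univ := by
  have h : lineCarrier True True = Set.univ := by
    ext
    simp [lineCarrier]
  exact h ▸ contr_lineCarrier (Or.inl trivial)

theorem contr_pow_univ {A : Type} [Fintype A] [DecidableEq A] {X : Cx A}
    (h : Contr X Set.univ) : ∀ n, Contr (X.pow n) Set.univ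
  | 0 => contr_unit
  | n + 1 => by
    have h1 := h.tensor (contr_pow_univ h n)
    rw [Set.univ_prod_univ] at h1
    exact h1

theorem contr_tree_univ {A : Type} [Fintype A] [DecidableEq A] {X : Cx A}
    (h : Contr X Set.univ) : ∀ n, Contr (X.tree n) Set.univ
  | 0 => contr_unit
  | n + 1 => by
    have h1 := h.tensor ((contr_tree_univ h n).tensor (contr_tree_univ h n))
    rw [Set.univ_prod_univ, Set.univ_prod_univ] at h1
    exact h1

theorem deg_le_topcell : ∀ n c, (Cx.cube n 1).deg c ≤ (Cx.cube n 1).deg (topcell n)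
  | 0, _ => le_rfl
  | n + 1, c => by
    have h : c.1.val % 2 ≤ 1 := by omega
    exact add_le_add h (deg_le_topcell n c.2)

theorem deg_le_topTree (n : ℕ) : ∀ j c, (tgtCx n j).deg c ≤ (tgtCx n j).deg (topTree n j)
  | 0, _ => le_rfl
  | j + 1, c => add_le_add (deg_le_topcell n c.1)
      (add_le_add (deg_le_topTree n j c.2.1) (deg_le_topTree n j c.2.2))

theorem tgt_bd_topTree (n j : ℕ) (c : Tr (Pw (Fin (2 * 1 + 1)) n) j) :
    (tgtCx n j).bd (topTree n j) c = 0 := by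
  by_contra h
  exact absurd ((tgtCx n j).deg_lt _ _ h) (deg_le_topTree n j c).not_gt

theorem act_topcell (g : ℤˣ) : ∀ n, (powAct (revAct 1) n).act g (topcell n) = topcell n
  | 0 => rfl
  | n + 1 => by
    refine Prod.ext ?_ (act_topcell g n)
    change (revAct 1).act g 1 = 1
    revert g
    decide

theorem act_topTree (n : ℕ) : ∀ j g, (tgtAct n j).act g (topTree n j) = topTree n j
  | 0, _ => rfl
  | j + 1, ⟨⟨s, l, r⟩, γ⟩ => by
    refine Prod.ext (act_topcell s n) ?_
    have h1 := act_topTree n j (l, γ)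
    have h2 := act_topTree n j (r, γ)
    change swapIf s ((tgtAct n j).act (l, γ) (topTree n j), (tgtAct n j).act (r, γ) (topTree n j)) =
      (topTree n j, topTree n j)
    rw [h1, h2]
    simp [swapIf]

theorem sum_mul_sphere_bd_eq_zero {d : ℕ} (f : Fin d × ℤˣ → ZMod 2)
    (hf : ∀ a s, f (a, s) = f (a, 1))
    (q : Fin d × ℤˣ) : ∑ p, f p * (Cx.sphere d).bd p q = 0 := by
  rw [Fintype.sum_prod_type]
  refine Finset.sum_eq_zero fun a _ => ?_
  simp only [hf a, Cx.sphere_bd_apply]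
  exact sum_units_const _

theorem sum_mul_tensor_bd {A B : Type} [Fintype A] [DecidableEq A] [Fintype B] [DecidableEq B]
    (X : Cx A) (Y : Cx B) (f : A × B → ZMod 2) (p : A × B) :
    ∑ x, f x * (X.tensor Y).bd x p =
      ∑ a, f (a, p.2) * X.bd a p.1 + ∑ b, f (p.1, b) * Y.bd b p.2 :=
  mul_tensor_bd_apply X Y (Matrix.of fun (_ : Unit) x => f x) p ()

/-- The tree all of whose labels are the same. -/
def constTree {A : Type} (a : A) : ∀ j, Tr A j
  | 0 => ()
  | j + 1 => (a, (constTree a j, constTree a j))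

theorem isFull_constTree {n : ℕ} {a : Fin n × ℤˣ} (ha : a.1.val + 1 = n) :
    ∀ j, IsFull j (constTree a j)
  | 0 => trivial
  | j + 1 => ⟨ha, isFull_constTree ha j, isFull_constTree ha j⟩

theorem exists_act_constTree {n : ℕ} (a : Fin n × ℤˣ) :
    ∀ j, ∃ t : TG j, (srcTree n j).act (t, -1) (constTree a j) = constTree a j
  | 0 => ⟨1, rfl⟩
  | j + 1 => by
    obtain ⟨t, ht⟩ := exists_act_constTree a j
    refine ⟨(⟨-1, t, t⟩ : Wr (TG j)), ?_⟩
    change ((a.1, -1 * -1 * a.2), swapIf (-1) ((srcTree n j).act (t, -1) (constTree a j),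
      (srcTree n j).act (t, -1) (constTree a j))) = (a, (constTree a j, constTree a j))
    rw [ht]
    simp [swapIf]

theorem sum_mul_bd_constTree {n : ℕ} (a : Fin n) : ∀ (j : ℕ) (f : Tr (Fin n × ℤˣ) j → ZMod 2),
    (∀ t c, f ((srcTree n j).act (t, 1) c) = f c) →
      ∑ c, f c * ((Cx.sphere n).tree j).bd c (constTree (a, 1) j) = 0
  | 0, f, _ => Finset.sum_eq_zero fun _ _ => mul_zero _
  | j + 1, f, hf => by
    refine (sum_mul_tensor_bd (Cx.sphere n) (((Cx.sphere n).tree j).tensor ((Cx.sphere n).tree j))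
      f _).trans ?_
    rw [sum_mul_tensor_bd ((Cx.sphere n).tree j) ((Cx.sphere n).tree j)
      (fun c => f ((constTree (a, 1) (j + 1) : _ × _).1, c))]
    have h0 : ∀ c, (srcTree n j).act (1, 1) c = c := fun c => (srcTree n j).one c
    have key : ∀ (s : ℤˣ) (l r : TG j) (v : Fin n × ℤˣ) (c c' : Tr (Fin n × ℤˣ) j),
        f ((v.1, s * v.2), swapIf s ((srcTree n j).act (l, 1) c, (srcTree n j).act (r, 1) c')) =
          f (v, c, c') := by
      intro s l r v c c'
      have h := hf (⟨s, l, r⟩ : Wr (TG j)) (v, c, c')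
      have e : s * 1 * v.2 = s * v.2 := by rw [mul_one]
      rw [← h, ← e]
      rfl
    have h1 : ∑ x, f (x, (constTree (a, 1) j, constTree (a, 1) j)) * (Cx.sphere n).bd x (a, 1) =
      0 := by
      refine sum_mul_sphere_bd_eq_zero (fun x => f (x, (constTree (a, 1) j, constTree (a, 1) j)))
        (fun b s => ?_) (a, 1)
      have h := key s 1 1 (b, 1) (constTree (a, 1) j) (constTree (a, 1) j)
      simp only [h0, mul_one, swapIf, ite_self] at h
      exact h
    have h2 := sum_mul_bd_constTree a j (fun c => f ((a, 1), c, constTree (a, 1) j)) fun t c => by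
      have h := key 1 t 1 (a, 1) c (constTree (a, 1) j)
      simp only [h0, mul_one, swapIf, if_true] at h
      exact h
    have h3 := sum_mul_bd_constTree a j (fun c => f ((a, 1), constTree (a, 1) j, c)) fun t c => by
      have h := key 1 1 t (a, 1) (constTree (a, 1) j) c
      simp only [h0, mul_one, swapIf, if_true] at h
      exact h
    have h4 := congrArg₂ (· + ·) h1 (congrArg₂ (· + ·) h2 h3)
    simp only [add_zero] at h4
    exact h4

/-- Invariant cochains vanish on the boundary of the top cells. -/
theorem sum_mul_bd_src {d n : ℕ} (j : ℕ) (w : Fin d × ℤˣ) (a : Fin n)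
    (f : (Fin d × ℤˣ) × Tr (Fin n × ℤˣ) j → ZMod 2)
    (hf : ∀ g w c, f ((w.1, g.2 * w.2), (srcTree n j).act g c) = f (w, c)) :
    ∑ p, f p * ((Cx.sphere d).tensor ((Cx.sphere n).tree j)).bd p (w, constTree (a, 1) j) = 0 := by
  rw [sum_mul_tensor_bd]
  obtain ⟨t, ht⟩ := exists_act_constTree (a, 1) j
  have h1 : ∑ x, f (x, constTree (a, 1) j) * (Cx.sphere d).bd x w = 0 := by
    refine sum_mul_sphere_bd_eq_zero (fun x => f (x, constTree (a, 1) j)) (fun b s => ?_) w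
    rcases Int.units_eq_one_or s with rfl | rfl
    · rfl
    · have h := hf (t, -1) (b, 1) (constTree (a, 1) j)
      rw [ht] at h
      exact h
  have h2 := sum_mul_bd_constTree a j (fun c => f (w, c)) fun t c => by
    have h := hf (t, 1) w c
    simp only [one_mul] at h
    exact h
  rw [h1, h2, add_zero]

/-- The inclusion of spheres. -/
def inclMat (d n : ℕ) : Matrix (Fin n × ℤˣ) (Fin d × ℤˣ) (ZMod 2) :=
  Matrix.of fun p q => if p.1.val = q.1.val ∧ p.2 = q.2 then 1 else 0

theorem inclMat_isHom {d n : ℕ} (h : d ≤ n) :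
    IsHom (Cx.sphere d) (Cx.sphere n) (inclMat d n) := by
  have key : ∀ (f : Fin n × ℤˣ → ZMod 2) (q : Fin d × ℤˣ),
      ∑ p, f p * inclMat d n p q = f (q.1.castLE h, q.2) := by
    intro f q
    rw [Finset.sum_eq_single (q.1.castLE h, q.2)]
    · simp [inclMat]
    · intro p _ hp
      have : ¬(p.1.val = q.1.val ∧ p.2 = q.2) := fun h' => hp (Prod.ext (Fin.ext h'.1) h'.2)
      simp [inclMat, this]
    · exact fun h => absurd (Finset.mem_univ _) h
  constructor
  · ext p q
    rw [Matrix.mul_apply, key, Matrix.mul_apply, Cx.sphere_bd_apply]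
    by_cases hp : p.1.val + 1 = q.1.val
    · rw [if_pos (by exact hp), Finset.sum_eq_single (⟨p.1.val, by omega⟩, p.2)]
      · simp [inclMat, Cx.sphere_bd_apply, hp]
      · intro x _ hx
        have : ¬(p.1.val = x.1.val ∧ p.2 = x.2) :=
          fun h' => hx (Prod.ext (Fin.ext h'.1.symm) h'.2.symm)
        simp [inclMat, this]
      · exact fun h => absurd (Finset.mem_univ _) h
    · rw [if_neg (by exact hp)]
      symm
      refine Finset.sum_eq_zero fun x _ => ?_
      by_cases hx : p.1.val = x.1.val
      · rw [Cx.sphere_bd_apply, if_neg (by omega), mul_zero]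
      · rw [inclMat, Matrix.of_apply, if_neg (fun h => hx h.1), zero_mul]
  · ext q
    exact key _ q

theorem inclMat_equivar (d n : ℕ) : Equivar (signAct (Fin d)) (signAct (Fin n)) (inclMat d n) := by
  intro g p q
  simp [inclMat, signAct]

/-- Some carrier of an equivariant carrier on the product of spheres contains the top cell. -/
theorem exists_topTree_mem_carrier {r k n L : ℕ} (hk : k = 2 ^ r) (hn : n = 2 ^ (r + 1) - 1)
    (hL : 0 < L)
    (S : SphCell k L × Tr (SphCell n L) r → Set (Tr (Pw (Fin (2 * 1 + 1)) n) r))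
    (hmono : ∀ b' b, ((Cx.sph k L).tensor ((Cx.sph n L).tree r)).bd b' b ≠ 0 → S b' ⊆ S b)
    (hequiv : ∀ g w c d, d ∈ S (w, c) → (tgtAct n r).act g d ∈
      S ((sphAct k L).act g.2 w, (treeAct ((sphAct n L).comap mulMonoidHom) r).act g c))
    (hS : ∀ b, Contr (tgtCx n r) (S b)) : ∃ b, topTree n r ∈ S b := by
  by_contra! hcon
  have hk1 : 1 ≤ k := hk ▸ Nat.one_le_two_pow
  have hnk : n = k * 2 - 1 := by rw [hn, pow_succ, hk]
  have hkn : k ≤ n := by omega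
  have htop : ∀ w t, IsFull r t →
      phi n r (topTree n r) (w, t) = if w.1.val = 2 ^ r - 1 then 1 else 0 := by
    subst hn
    exact phi_top r (by omega)
  let αS := ((sphAct k L).comap (MonoidHom.snd (TG r) ℤˣ)).prod
    (treeAct ((sphAct n L).comap mulMonoidHom) r)
  let αC := ((signAct (Fin k)).comap (MonoidHom.snd (TG r) ℤˣ)).prod (srcTree n r)
  have hαS : αS.IsCx ((Cx.sph k L).tensor ((Cx.sph n L).tree r)) :=
    ((sphAct_isCx k L).comap _).prod (((sphAct_isCx n L).comap _).tree r)
  have hαC : αC.IsCx ((Cx.sphere k).tensor ((Cx.sphere n).tree r)) :=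
    ((signAct_isCx k).comap _).prod (((signAct_isCx n).comap _).tree r)
  have hβ : (tgtAct n r).IsCx (tgtCx n r) := (((revAct_isCx 1).pow n).comap _).tree r
  obtain ⟨γS, hγS⟩ := exists_sign ((sphAct n L).comap mulMonoidHom) (fun c => cellSign L n c.1)
    (fun g c => cellSign_act hL (g.1 * g.2) n c.1 c.2) (sphAct k L) (fun c => cellSign L k c.1)
    (fun g c => cellSign_act hL g k c.1 c.2) r
  obtain ⟨γC, hγC⟩ := exists_sign ((signAct (Fin n)).comap mulMonoidHom) (fun c => c.2)
    (fun g c => rfl) (signAct (Fin k)) (fun c => c.2) (fun g c => rfl) r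
  obtain ⟨Φ, hΦe, hΦh, hΦS⟩ := exists_carried_hom _ αS hαS (tgtCx n r)
    (tgtAct n r) hβ γS hγS S hmono
    (fun g b d hd => hequiv g b.1 b.2 d hd) hS
  have hκh := (sphMat_isHom k L).tensor ((sphMat_isHom n L).tree r)
  have hκe : Equivar αC αS (sphMat k L ⊗ₖ treeMat (sphMat n L) r) :=
    ((sphMat_equivar k L).comap _).kronecker (((sphMat_equivar n L).comap _).tree r)
  have hιh := (inclMat_isHom hkn).tensor (IsHom.one ((Cx.sphere n).tree r))
  have hιe : Equivar αC (sphProd n (srcTree n r)) (inclMat k n ⊗ₖ 1) :=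
    ((inclMat_equivar k n).comap _).kronecker (Equivar.one _)
  obtain ⟨h, hhe, hh⟩ := exists_homotopy _ αC hαC (tgtCx n r) (tgtAct n r) hβ γC hγC
    (contr_tree_univ (contr_pow_univ contr_line_univ n) r) ((phi_isHom n r).comp hιh)
    (hΦh.comp hκh) ((phi_equivar n r).mul hιe) (hΦe.mul hκe)
  let a : Fin n := ⟨n - 1, by omega⟩
  let w : Fin k × ℤˣ := (⟨k - 1, by omega⟩, 1)
  have e := congrFun (congrFun hh (topTree n r)) (w, constTree (a, 1) r)
  rw [Matrix.add_apply, Matrix.add_apply] at e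
  have e1 : ((tgtCx n r).bd * h) (topTree n r) (w, constTree (a, 1) r) = 0 := by
    rw [Matrix.mul_apply]
    exact Finset.sum_eq_zero fun c _ => by rw [tgt_bd_topTree, zero_mul]
  have e2 : (h * ((Cx.sphere k).tensor ((Cx.sphere n).tree r)).bd) (topTree n r)
      (w, constTree (a, 1) r) = 0 := by
    rw [Matrix.mul_apply]
    refine sum_mul_bd_src r w a (fun p => h (topTree n r) p) fun g w c => ?_
    have := hhe g (topTree n r) (w, c)
    rw [act_topTree] at this
    exact this
  have e3 : (Φ * (sphMat k L ⊗ₖ treeMat (sphMat n L) r)) (topTree n r) (w, constTree (a, 1) r) =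
      0 := by
    rw [Matrix.mul_apply]
    refine Finset.sum_eq_zero fun b _ => ?_
    have : Φ (topTree n r) b = 0 := by
      by_contra h'
      exact hcon b (hΦS b _ h')
    rw [this, zero_mul]
  have e4 : (phi n r * (inclMat k n ⊗ₖ (1 : Matrix (Tr (Fin n × ℤˣ) r) (Tr (Fin n × ℤˣ) r)
    (ZMod 2)))) (topTree n r)
      (w, constTree (a, 1) r) = 1 := by
    rw [Matrix.mul_apply, Finset.sum_eq_single ((w.1.castLE hkn, 1), constTree (a, 1) r)]
    · have ha : a.val + 1 = n := by
        change n - 1 + 1 = n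
        omega
      have hw : (w.1.castLE hkn).val = 2 ^ r - 1 := by rw [← hk]; rfl
      rw [htop (w.1.castLE hkn, 1) (constTree (a, 1) r) (isFull_constTree ha r), if_pos hw]
      simp [inclMat, w]
    · rintro ⟨x, t⟩ _ hx
      by_cases ht : t = constTree (a, 1) r
      · have : ¬(x.1.val = w.1.val ∧ x.2 = w.2) := fun h' =>
          hx (Prod.ext (Prod.ext (Fin.ext h'.1) h'.2) ht)
        rw [kroneckerMap_apply, inclMat, Matrix.of_apply, if_neg this, zero_mul, mul_zero]
      · rw [kroneckerMap_apply, Matrix.one_apply_ne ht, mul_zero, mul_zero]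
    · exact fun h => absurd (Finset.mem_univ _) h
  rw [e1, e2, e3, e4] at e
  exact absurd e (by decide)

section Carrier

/-- The cells allowed for a set of vectors. -/
def vecCarrier : ∀ n, Set (Fin n → ℝ) → Set (Pw (Fin (2 * 1 + 1)) n)
  | 0, _ => Set.univ
  | n + 1, Z => lineCarrier (∃ z ∈ Z, 0 ≤ z 0) (∃ z ∈ Z, z 0 ≤ 0) ×ˢ vecCarrier n (Fin.tail '' Z)

theorem vecCarrier_mono : ∀ n {Z W : Set (Fin n → ℝ)}, Z ⊆ W → vecCarrier n Z ⊆ vecCarrier n W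
  | 0, _, _, _ => subset_rfl
  | n + 1, _, _, h => fun _ hc =>
    ⟨⟨fun h0 => (hc.1.1 h0).imp fun _ hz => ⟨h hz.1, hz.2⟩,
      fun h2 => (hc.1.2 h2).imp fun _ hz => ⟨h hz.1, hz.2⟩⟩,
      vecCarrier_mono n (Set.image_mono h) hc.2⟩

theorem contr_vecCarrier : ∀ n {Z : Set (Fin n → ℝ)}, Z.Nonempty →
    Contr (Cx.cube n 1) (vecCarrier n Z)
  | 0, _, _ => contr_unit
  | n + 1, Z, h => by
    obtain ⟨z, hz⟩ := h
    refine Contr.tensor (contr_lineCarrier ?_) (contr_vecCarrier n ⟨_, z, hz, rfl⟩)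
    exact (le_total 0 (z 0)).imp (fun h => ⟨z, hz, h⟩) fun h => ⟨z, hz, h⟩

/-- The action of the signs by negation. -/
def negAct (V : Type) [InvolutiveNeg V] : Act ℤˣ V := Act.ofInv Neg.neg neg_neg

theorem act_mem_vecCarrier (g : ℤˣ) : ∀ n {Z W : Set (Fin n → ℝ)},
    (∀ z ∈ Z, (negAct _).act g z ∈ W) → ∀ c ∈ vecCarrier n Z,
      (powAct (revAct 1) n).act g c ∈ vecCarrier n W := by
  rcases Int.units_eq_one_or g with rfl | rfl
  · intro n Z W h c hc
    rw [Act.one]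
    exact vecCarrier_mono n (fun z hz => h z hz) hc
  · intro n
    induction n with
    | zero => exact fun _ _ _ => trivial
    | succ n ih =>
      rintro Z W h ⟨c, d⟩ hc
      refine ⟨⟨fun h0 => ?_, fun h0 => ?_⟩, ih (Z := Fin.tail '' Z) (W := Fin.tail '' W) ?_ d hc.2⟩
      · obtain ⟨z, hz, hz'⟩ := hc.1.2 (by
          rintro rfl
          exact h0 (show Fin.rev (2 : Fin (2 * 1 + 1)) = 0 by decide))
        exact ⟨-z, h z hz, by simpa using hz'⟩
      · obtain ⟨z, hz, hz'⟩ := hc.1.1 (by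
          rintro rfl
          exact h0 (show Fin.rev (0 : Fin (2 * 1 + 1)) = 2 by decide))
        exact ⟨-z, h z hz, by simpa using hz'⟩
      · rintro _ ⟨z, hz, rfl⟩
        exact ⟨-z, h z hz, rfl⟩

theorem exists_of_topcell_mem : ∀ n {Z : Set (Fin n → ℝ)}, topcell n ∈ vecCarrier n Z →
    ∀ i, (∃ z ∈ Z, 0 ≤ z i) ∧ ∃ z ∈ Z, z i ≤ 0
  | 0, _, _, i => i.elim0
  | n + 1, Z, h, i => by
    refine Fin.cases ⟨h.1.1 (show (1 : Fin (2 * 1 + 1)) ≠ 0 by decide),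
      h.1.2 (show (1 : Fin (2 * 1 + 1)) ≠ 2 by decide)⟩ (fun i => ?_) i
    obtain ⟨⟨_, ⟨z, hz, rfl⟩, h1⟩, ⟨_, ⟨w, hw, rfl⟩, h2⟩⟩ := exists_of_topcell_mem n h.2 i
    exact ⟨⟨z, hz, h1⟩, ⟨w, hw, h2⟩⟩

theorem dist_zero_le_of_topcell_mem {n : ℕ} {Z : Set (Fin n → ℝ)} (h : topcell n ∈ vecCarrier n Z)
    {y : Fin n → ℝ} {η : ℝ} (hη : 0 ≤ η) (hZ : ∀ z ∈ Z, dist z y ≤ η) : dist y 0 ≤ η := by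
  rw [dist_pi_le_iff hη]
  intro i
  obtain ⟨⟨z, hz, h1⟩, ⟨w, hw, h2⟩⟩ := exists_of_topcell_mem n h i
  have h3 := (dist_le_pi_dist z y i).trans (hZ z hz)
  have h4 := (dist_le_pi_dist w y i).trans (hZ w hw)
  rw [Real.dist_eq, abs_le] at h3 h4 ⊢
  simp only [Pi.zero_apply]
  constructor <;> linarith

variable {n : ℕ}

/-- The cells allowed for a set of trees. -/
def treeCarrier (n : ℕ) : ∀ j, Set (Tr (Fin n → ℝ) j) → Set (Tr (Pw (Fin (2 * 1 + 1)) n) j)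
  | 0, _ => Set.univ
  | j + 1, V => vecCarrier n ((fun v => v.1) '' V) ×ˢ
    (treeCarrier n j ((fun v => v.2.1) '' V) ×ˢ treeCarrier n j ((fun v => v.2.2) '' V))

theorem treeCarrier_mono : ∀ j {Z W : Set (Tr (Fin n → ℝ) j)}, Z ⊆ W →
    treeCarrier n j Z ⊆ treeCarrier n j W
  | 0, _, _, _ => subset_rfl
  | j + 1, _, _, h => fun _ hc =>
    ⟨vecCarrier_mono n (Set.image_mono h) hc.1, treeCarrier_mono j (Set.image_mono h) hc.2.1,
      treeCarrier_mono j (Set.image_mono h) hc.2.2⟩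

theorem contr_treeCarrier : ∀ j {Z : Set (Tr (Fin n → ℝ) j)}, Z.Nonempty →
    Contr (tgtCx n j) (treeCarrier n j Z)
  | 0, _, _ => contr_unit
  | j + 1, _, h => (contr_vecCarrier n (h.image _)).tensor
      ((contr_treeCarrier j (h.image _)).tensor (contr_treeCarrier j (h.image _)))

/-- The action on trees of vectors in the target. -/
abbrev vecTree (n j : ℕ) : Act (TG j × ℤˣ) (Tr (Fin n → ℝ) j) :=
  treeAct ((negAct (Fin n → ℝ)).comap (MonoidHom.fst ℤˣ ℤˣ)) j

theorem act_mem_treeCarrier : ∀ j (g : TG j × ℤˣ) {Z W : Set (Tr (Fin n → ℝ) j)},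
    (∀ z ∈ Z, (vecTree n j).act g z ∈ W) → ∀ c ∈ treeCarrier n j Z,
      (tgtAct n j).act g c ∈ treeCarrier n j W
  | 0, _, _, _, _, _, _ => trivial
  | j + 1, ⟨⟨s, l, r⟩, γ⟩, Z, W, h, ⟨c, d, e⟩, hc => by
    have h1 : (powAct (revAct 1) n).act s c ∈ vecCarrier n ((fun v => v.1) '' W) := by
      refine act_mem_vecCarrier s n ?_ c hc.1
      rintro _ ⟨z, hz, rfl⟩
      exact ⟨_, h z hz, rfl⟩
    refine ⟨h1, ?_⟩
    change swapIf s ((tgtAct n j).act (l, γ) d, (tgtAct n j).act (r, γ) e) ∈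
      treeCarrier n j ((fun v => v.2.1) '' W) ×ˢ treeCarrier n j ((fun v => v.2.2) '' W)
    rcases Int.units_eq_one_or s with rfl | rfl
    · refine ⟨act_mem_treeCarrier j (l, γ) ?_ d hc.2.1, act_mem_treeCarrier j
        (r, γ) ?_ e hc.2.2⟩ <;>
      · rintro _ ⟨z, hz, rfl⟩
        exact ⟨_, h z hz, rfl⟩
    · refine ⟨act_mem_treeCarrier j (r, γ) ?_ e hc.2.2, act_mem_treeCarrier j
        (l, γ) ?_ d hc.2.1⟩ <;>
      · rintro _ ⟨z, hz, rfl⟩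
        exact ⟨_, h z hz, rfl⟩

instance Tr.metricSpace {A : Type} [MetricSpace A] : ∀ j, MetricSpace (Tr A j)
  | 0 => inferInstanceAs (MetricSpace PUnit)
  | j + 1 => have := Tr.metricSpace (A := A) j; inferInstanceAs
      (MetricSpace (A × (Tr A j × Tr A j)))

instance Tr.compactSpace {A : Type} [MetricSpace A] [CompactSpace A] : ∀ j, CompactSpace (Tr A j)
  | 0 => inferInstanceAs (CompactSpace PUnit)
  | j + 1 => have := Tr.compactSpace (A := A) j
    inferInstanceAs (CompactSpace (A × (Tr A j × Tr A j)))

theorem Tr.dist_le {A : Type} [MetricSpace A] {j : ℕ} {x y : Tr A (j + 1)} {η : ℝ} :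
    dist x y ≤ η ↔ dist x.1 y.1 ≤ η ∧ dist x.2.1 y.2.1 ≤ η ∧ dist x.2.2 y.2.2 ≤ η := by
  change max (dist x.1 y.1) (max (dist x.2.1 y.2.1) (dist x.2.2 y.2.2)) ≤ η ↔ _
  rw [max_le_iff, max_le_iff]

theorem dist_zero_le_of_topTree_mem {η : ℝ} (hη : 0 ≤ η) : ∀ j {Z : Set (Tr (Fin n → ℝ) j)},
    topTree n j ∈ treeCarrier n j Z → ∀ y, (∀ z ∈ Z, dist z y ≤ η) →
      dist y (constTree 0 j) ≤ η
  | 0, _, _, _, _ => hη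
  | j + 1, Z, h, y, hZ => by
    refine Tr.dist_le.2 ⟨dist_zero_le_of_topcell_mem h.1 hη ?_,
      dist_zero_le_of_topTree_mem hη j h.2.1 _ ?_, dist_zero_le_of_topTree_mem hη j h.2.2 _ ?_⟩ <;>
    rintro _ ⟨z, hz, rfl⟩
    · exact (Tr.dist_le.1 (hZ z hz)).1
    · exact (Tr.dist_le.1 (hZ z hz)).2.1
    · exact (Tr.dist_le.1 (hZ z hz)).2.2

end Carrier

section Points

variable {L : ℕ}

/-- The points of a cell of the subdivided cube `[-1, 1]ⁿ`. -/
def cellPts (L : ℕ) : ∀ n, Pw (Fin (2 * L + 1)) n → Set (Fin n → ℝ)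
  | 0, _ => Set.univ
  | n + 1, c => {x | |L * x 0 - (c.1.val - L)| ≤ (c.1.val % 2 : ℕ) ∧ Fin.tail x ∈ cellPts L n c.2}

theorem cellPts_nonempty (hL : 0 < L) : ∀ n c, (cellPts L n c).Nonempty
  | 0, _ => ⟨0, trivial⟩
  | n + 1, c => by
    obtain ⟨x, hx⟩ := cellPts_nonempty hL n c.2
    refine ⟨Fin.cons ((c.1.val - L) / L) x, ?_, hx⟩
    have : (L : ℝ) ≠ 0 := by positivity
    rw [Fin.cons_zero, mul_div_cancel₀ _ this, sub_self, abs_zero]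
    positivity

theorem cellPts_mono : ∀ n c' c, (Cx.cube n L).bd c' c ≠ 0 → cellPts L n c' ⊆ cellPts L n c
  | 0, _, _, h => absurd rfl h
  | n + 1, c', c, h => by
    rintro x ⟨hx, hx'⟩
    rcases Cx.tensor_bd_ne_zero h with ⟨h1, h2⟩ | ⟨h1, h2⟩
    · refine ⟨?_, h2 ▸ hx'⟩
      obtain ⟨h3, h4⟩ := Cx.line_bd_ne_zero h1
      have h5 : c'.1.val % 2 = 0 := by omega
      rw [h5, Nat.cast_zero, abs_nonpos_iff] at hx
      rw [h3, Nat.cast_one, abs_le]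
      rcases h4 with h4 | h4
      · have : (c'.1.val : ℝ) + 1 = c.1.val := by exact_mod_cast h4
        constructor <;> linarith
      · have : (c'.1.val : ℝ) = c.1.val + 1 := by exact_mod_cast h4
        constructor <;> linarith
    · exact ⟨h1 ▸ hx, cellPts_mono n _ _ h2 hx'⟩

theorem neg_mem_cellPts : ∀ n c, ∀ x ∈ cellPts L n c,
    -x ∈ cellPts L n ((powAct (revAct L) n).act (-1) c)
  | 0, _, _, _ => trivial
  | n + 1, c, x, hx => by
    refine ⟨?_, neg_mem_cellPts n c.2 _ hx.2⟩
    have e : ((powAct (revAct L) (n + 1)).act (-1) c).1 = c.1.rev := rfl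
    have h1 := hx.1
    have hc := c.1.isLt
    have h2 : (c.1.rev.val : ℝ) = 2 * L - c.1.val := by
      rw [Fin.val_rev, show 2 * L + 1 - (c.1.val + 1) = 2 * L - c.1.val by omega,
        Nat.cast_sub (by omega)]
      push_cast
      ring
    have h3 : c.1.rev.val % 2 = c.1.val % 2 := by
      rw [Fin.val_rev]
      omega
    rw [e, h2, h3, ← abs_neg, Pi.neg_apply]
    convert h1 using 2
    ring

theorem abs_le_one_of_mem_cellPts (hL : 0 < L) : ∀ n c, ∀ x ∈ cellPts L n c, ∀ i, |x i| ≤ 1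
  | 0, _, _, _, i => i.elim0
  | n + 1, c, x, hx, i => by
    refine Fin.cases ?_ (fun i => abs_le_one_of_mem_cellPts hL n c.2 _ hx.2 i) i
    have h1 := abs_le.1 hx.1
    have hc := c.1.isLt
    have hL' : (0 : ℝ) < L := by exact_mod_cast hL
    have h2 : c.1.val + c.1.val % 2 ≤ 2 * L := by omega
    have h3 : c.1.val % 2 ≤ c.1.val := Nat.mod_le _ _
    have h2' : (c.1.val : ℝ) + (c.1.val % 2 : ℕ) ≤ 2 * L := by exact_mod_cast h2
    have h3' : ((c.1.val % 2 : ℕ) : ℝ) ≤ c.1.val := by exact_mod_cast h3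
    rw [abs_le]
    constructor
    · by_contra! h
      nlinarith
    · by_contra! h
      nlinarith

theorem exists_abs_eq_one_of_onBd (hL : 0 < L) : ∀ n c, onBd L n c → ∀ x ∈ cellPts L n c,
    ∃ i, |x i| = 1
  | 0, _, h, _, _ => h.elim
  | n + 1, c, h, x, hx => by
    have hL' : (L : ℝ) ≠ 0 := by positivity
    rcases h with (h | h) | h
    · refine ⟨0, ?_⟩
      have h1 := hx.1
      rw [h] at h1
      simp only [Fin.val_zero, Nat.zero_mod, Nat.cast_zero, abs_nonpos_iff, zero_sub,
        sub_neg_eq_add] at h1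
      have : x 0 = -1 := by
        apply mul_left_cancel₀ hL'
        linarith
      rw [this, abs_neg, abs_one]
    · refine ⟨0, ?_⟩
      have h1 := hx.1
      rw [h] at h1
      simp only [Fin.val_last, Nat.mul_mod_right, Nat.cast_zero, abs_nonpos_iff, Nat.cast_mul,
        Nat.cast_ofNat] at h1
      have : x 0 = 1 := by
        apply mul_left_cancel₀ hL'
        linarith
      rw [this, abs_one]
    · obtain ⟨i, hi⟩ := exists_abs_eq_one_of_onBd hL n c.2 h _ hx.2
      exact ⟨i.succ, hi⟩

theorem norm_eq_one_of_onBd (hL : 0 < L) {n : ℕ} {c : Pw (Fin (2 * L + 1)) n} (h : onBd L n c)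
    {x : Fin n → ℝ} (hx : x ∈ cellPts L n c) : ‖x‖ = 1 := by
  refine le_antisymm ((pi_norm_le_iff_of_nonneg zero_le_one).2
    (abs_le_one_of_mem_cellPts hL n c x hx)) ?_
  obtain ⟨i, hi⟩ := exists_abs_eq_one_of_onBd hL n c h x hx
  exact hi ▸ norm_le_pi_norm x i

theorem dist_le_of_mem_cellPts (hL : 0 < L) : ∀ n c, ∀ x ∈ cellPts L n c, ∀ y ∈ cellPts L n c,
    ∀ i, |x i - y i| ≤ 2 / L
  | 0, _, _, _, _, _, i => i.elim0
  | n + 1, c, x, hx, y, hy, i => by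
    refine Fin.cases ?_ (fun i => dist_le_of_mem_cellPts hL n c.2 _ hx.2 _ hy.2 i) i
    have h1 := abs_le.1 hx.1
    have h2 := abs_le.1 hy.1
    have hL' : (0 : ℝ) < L := by exact_mod_cast hL
    have h3 : c.1.val % 2 ≤ 1 := by omega
    have h3' : ((c.1.val % 2 : ℕ) : ℝ) ≤ 1 := by exact_mod_cast h3
    have h4 : |(x 0 - y 0) * L| ≤ 2 := abs_le.2 ⟨by linarith, by linarith⟩
    rw [le_div_iff₀ hL']
    rwa [abs_mul, abs_of_pos hL'] at h4

/-- The unit sphere of the maximum norm. -/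
abbrev Sph (n : ℕ) : Type := Metric.sphere (0 : Fin n → ℝ) 1

/-- The points of a cell in the boundary of the cube. -/
def sphPts (L n : ℕ) (c : SphCell n L) : Set (Sph n) := {x | x.1 ∈ cellPts L n c.1}

theorem sphPts_nonempty (hL : 0 < L) (n : ℕ) (c : SphCell n L) : (sphPts L n c).Nonempty := by
  obtain ⟨x, hx⟩ := cellPts_nonempty hL n c.1
  exact ⟨⟨x, by simpa using norm_eq_one_of_onBd hL c.2 hx⟩, hx⟩

theorem sphPts_mono (n : ℕ) (c' c : SphCell n L) (h : (Cx.sph n L).bd c' c ≠ 0) :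
    sphPts L n c' ⊆ sphPts L n c := fun _ hx => cellPts_mono n c'.1 c.1 h hx

theorem act_mem_sphPts (n : ℕ) (g : ℤˣ) (c : SphCell n L) (x : Sph n) (hx : x ∈ sphPts L n c) :
    (negAct (Sph n)).act g x ∈ sphPts L n ((sphAct n L).act g c) := by
  rcases Int.units_eq_one_or g with rfl | rfl
  · rw [Act.one, Act.one]
    exact hx
  · exact neg_mem_cellPts n c.1 x.1 hx

theorem dist_le_of_mem_sphPts (hL : 0 < L) (n : ℕ) (c : SphCell n L) (x : Sph n)
    (hx : x ∈ sphPts L n c) (y : Sph n) (hy : y ∈ sphPts L n c) : dist x y ≤ 2 / L :=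
  (dist_pi_le_iff (by positivity)).2 (dist_le_of_mem_cellPts hL n c.1 x.1 hx y.1 hy)

variable {A X : Type} (P : A → Set X)

/-- Trees whose labels lie in the sets attached to the labels of a given tree. -/
def treePts : ∀ j, Tr A j → Set (Tr X j)
  | 0, _ => Set.univ
  | j + 1, c => P c.1 ×ˢ (treePts j c.2.1 ×ˢ treePts j c.2.2)

variable {P}

theorem treePts_nonempty (h : ∀ a, (P a).Nonempty) : ∀ j c, (treePts P j c).Nonempty
  | 0, _ => ⟨(), trivial⟩
  | j + 1, c => (h c.1).prod ((treePts_nonempty h j c.2.1).prod (treePts_nonempty h j c.2.2))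

theorem treePts_mono [Fintype A] [DecidableEq A] {C : Cx A}
    (h : ∀ a' a, C.bd a' a ≠ 0 → P a' ⊆ P a) :
    ∀ j c' c, (C.tree j).bd c' c ≠ 0 → treePts P j c' ⊆ treePts P j c
  | 0, _, _, h0 => absurd rfl h0
  | j + 1, ⟨a', b', c'⟩, ⟨a, b, c⟩, h0 => by
    rcases Cx.tensor_bd_ne_zero h0 with ⟨h1, h2⟩ | ⟨h1, h2⟩
    · obtain ⟨rfl, rfl⟩ := Prod.ext_iff.1 h2
      exact Set.prod_mono (h _ _ h1) subset_rfl
    · simp only at h1 h2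
      subst h1
      rcases Cx.tensor_bd_ne_zero h2 with ⟨h3, h4⟩ | ⟨h3, h4⟩
      · simp only at h3 h4
        subst h4
        exact Set.prod_mono subset_rfl (Set.prod_mono (treePts_mono h j _ _ h3) subset_rfl)
      · simp only at h3 h4
        subst h3
        exact Set.prod_mono subset_rfl (Set.prod_mono subset_rfl (treePts_mono h j _ _ h4))

theorem act_mem_treePts {α : Act (ℤˣ × ℤˣ) A} {ξ : Act (ℤˣ × ℤˣ) X}
    (h : ∀ g a, ∀ x ∈ P a, ξ.act g x ∈ P (α.act g a)) :
    ∀ j g c, ∀ x ∈ treePts P j c, (treeAct ξ j).act g x ∈ treePts P j ((treeAct α j).act g c)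
  | 0, _, _, _, _ => trivial
  | j + 1, ⟨⟨s, l, r⟩, γ⟩, ⟨a, b, c⟩, ⟨x, y, z⟩, hx => by
    refine ⟨h (s, γ) a x hx.1, ?_⟩
    have h1 := act_mem_treePts h j (l, γ) b y hx.2.1
    have h2 := act_mem_treePts h j (r, γ) c z hx.2.2
    rcases Int.units_eq_one_or s with rfl | rfl
    · exact ⟨h1, h2⟩
    · exact ⟨h2, h1⟩

theorem dist_le_of_mem_treePts [MetricSpace X] {η : ℝ} (hη : 0 ≤ η)
    (h : ∀ a, ∀ x ∈ P a, ∀ y ∈ P a, dist x y ≤ η) :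
    ∀ j c, ∀ x ∈ treePts P j c, ∀ y ∈ treePts P j c, dist x y ≤ η
  | 0, _, _, _, _, _ => hη
  | j + 1, _, _, hx, _, hy => Tr.dist_le.2 ⟨h _ _ hx.1 _ hy.1,
      dist_le_of_mem_treePts hη h j _ _ hx.2.1 _ hy.2.1,
      dist_le_of_mem_treePts hη h j _ _ hx.2.2 _ hy.2.2⟩

end Points

/-- A Borsuk-Ulam type theorem for the symmetries of binary trees. -/
theorem exists_eq_zero_of_equivariant {r k n : ℕ} (hk : k = 2 ^ r) (hn : n = 2 ^ (r + 1) - 1)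
    (h : Sph k × Tr (Sph n) r → Tr (Fin n → ℝ) r) (hcont : Continuous h)
    (hequiv : ∀ (g : TG r × ℤˣ) x c, h ((negAct (Sph k)).act g.2 x,
      (treeAct ((negAct (Sph n)).comap mulMonoidHom) r).act g c) = (vecTree n r).act g (h (x, c))) :
    ∃ p, h p = constTree 0 r := by
  by_contra! hne
  obtain ⟨η, hη, hη'⟩ : ∃ η : ℝ, 0 < η ∧ ∀ p, η ≤ dist (h p) (constTree 0 r) := by
    rcases isEmpty_or_nonempty (Sph k × Tr (Sph n) r) with hE | hE
    · exact ⟨1, one_pos, fun p => hE.elim p⟩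
    · obtain ⟨p, -, hp⟩ := isCompact_univ.exists_isMinOn Set.univ_nonempty
        (hcont.dist (continuous_const (y := constTree (0 : Fin n → ℝ) r))).continuousOn
      exact ⟨_, dist_pos.2 (hne p), fun q => hp (Set.mem_univ q)⟩
  obtain ⟨δ, hδ, hδ'⟩ := Metric.uniformContinuous_iff.1
    (CompactSpace.uniformContinuous_of_continuous hcont) (η / 2) (half_pos hη)
  obtain ⟨L, hL⟩ := exists_nat_gt (2 / δ)
  have hL0 : (0 : ℝ) < L := lt_trans (by positivity) hL
  have hL1 : 0 < L := by exact_mod_cast hL0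
  have hL2 : 2 / (L : ℝ) < δ := by
    rw [div_lt_iff₀ hδ] at hL
    rw [div_lt_iff₀ hL0]
    linarith
  let pts : SphCell k L × Tr (SphCell n L) r → Set (Sph k × Tr (Sph n) r) :=
    fun b => sphPts L k b.1 ×ˢ treePts (sphPts L n) r b.2
  have hpts : ∀ b, (pts b).Nonempty := fun b =>
    (sphPts_nonempty hL1 k b.1).prod (treePts_nonempty (sphPts_nonempty hL1 n) r b.2)
  obtain ⟨b, hb⟩ := exists_topTree_mem_carrier hk hn hL1 (fun b => treeCarrier n r (h '' pts b))
    (fun b' b hbd => by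
      refine treeCarrier_mono r (Set.image_mono ?_)
      rcases Cx.tensor_bd_ne_zero hbd with ⟨h1, h2⟩ | ⟨h1, h2⟩
      · exact Set.prod_mono (sphPts_mono k _ _ h1) (h2 ▸ subset_rfl)
      · exact Set.prod_mono (h1 ▸ subset_rfl) (treePts_mono (sphPts_mono n) r _ _ h2))
    (fun g w c d hd => by
      refine act_mem_treeCarrier r g ?_ d hd
      rintro _ ⟨⟨x, t⟩, hp, rfl⟩
      refine ⟨_, ⟨act_mem_sphPts k g.2 w x hp.1, act_mem_treePts (fun g c x hx =>
        act_mem_sphPts n (g.1 * g.2) c x hx) r g c t hp.2⟩, hequiv g x t⟩)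
    (fun b => contr_treeCarrier r ((hpts b).image h))
  obtain ⟨p, hp⟩ := hpts b
  have := dist_zero_le_of_topTree_mem (half_pos hη).le r hb (h p) (by
    rintro _ ⟨q, hq, rfl⟩
    refine (hδ' (lt_of_le_of_lt ?_ hL2)).le
    exact max_le (dist_le_of_mem_sphPts hL1 k _ _ hq.1 _ hp.1)
      (dist_le_of_mem_treePts (by positivity) (dist_le_of_mem_sphPts hL1 n) r _ _ hq.2 _ hp.2))
  linarith [hη' p]

section Leaves

variable {n : ℕ} (F : (Fin n → ℝ) → Fin n → ℝ) (ε : ℝ)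

/-- The sum of `F` over the leaves of the tree with root `y` and displacements `c`. -/
def leafSum : ∀ j, (Fin n → ℝ) → Tr (Sph n) j → Fin n → ℝ
  | 0, y, _ => F y
  | j + 1, y, c => leafSum j (y + (ε * 4 ^ j) • c.1.1) c.2.1 +
      leafSum j (y - (ε * 4 ^ j) • c.1.1) c.2.2

/-- The differences of the sums of `F` over the two subtrees of each node. -/
def leafDiff : ∀ j, (Fin n → ℝ) → Tr (Sph n) j → Tr (Fin n → ℝ) j
  | 0, _, _ => ()
  | j + 1, y, c => (leafSum F ε j (y + (ε * 4 ^ j) • c.1.1) c.2.1 -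
      leafSum F ε j (y - (ε * 4 ^ j) • c.1.1) c.2.2,
      (leafDiff j (y + (ε * 4 ^ j) • c.1.1) c.2.1, leafDiff j (y - (ε * 4 ^ j) • c.1.1) c.2.2))

/-- The leaves of the tree with root `y` and displacements `c`. -/
def leaf : ∀ j, (Fin n → ℝ) → Tr (Sph n) j → (Fin j → Bool) → Fin n → ℝ
  | 0, y, _, _ => y
  | j + 1, y, c, a => if a 0 then leaf j (y + (ε * 4 ^ j) • c.1.1) c.2.1 (Fin.tail a)
      else leaf j (y - (ε * 4 ^ j) • c.1.1) c.2.2 (Fin.tail a)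

variable {F}

theorem continuous_leafSum (hF : Continuous F) : ∀ j,
    Continuous fun p : (Fin n → ℝ) × Tr (Sph n) j => leafSum F ε j p.1 p.2
  | 0 => hF.comp continuous_fst
  | j + 1 => by
    have ih := continuous_leafSum hF j
    have h1 : Continuous fun p : (Fin n → ℝ) × (Sph n × (Tr (Sph n) j × Tr (Sph n) j)) =>
        (p.1 + (ε * 4 ^ j) • p.2.1.1, p.2.2.1) := by fun_prop
    have h2 : Continuous fun p : (Fin n → ℝ) × (Sph n × (Tr (Sph n) j × Tr (Sph n) j)) =>
        (p.1 - (ε * 4 ^ j) • p.2.1.1, p.2.2.2) := by fun_prop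
    exact (ih.comp h1).add (ih.comp h2)

theorem continuous_leafDiff (hF : Continuous F) : ∀ j,
    Continuous fun p : (Fin n → ℝ) × Tr (Sph n) j => leafDiff F ε j p.1 p.2
  | 0 => continuous_const
  | j + 1 => by
    have hs := continuous_leafSum ε hF j
    have ih := continuous_leafDiff hF j
    have h1 : Continuous fun p : (Fin n → ℝ) × (Sph n × (Tr (Sph n) j × Tr (Sph n) j)) =>
        (p.1 + (ε * 4 ^ j) • p.2.1.1, p.2.2.1) := by fun_prop
    have h2 : Continuous fun p : (Fin n → ℝ) × (Sph n × (Tr (Sph n) j × Tr (Sph n) j)) =>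
        (p.1 - (ε * 4 ^ j) • p.2.1.1, p.2.2.2) := by fun_prop
    exact ((hs.comp h1).sub (hs.comp h2)).prodMk ((ih.comp h1).prodMk (ih.comp h2))

theorem negAct_sph_val (γ : ℤˣ) (x : Sph n) :
    ((negAct (Sph n)).act γ x).1 = ((γ : ℤ) : ℝ) • x.1 := by
  rcases Int.units_eq_one_or γ with rfl | rfl <;> simp [negAct, Act.ofInv]

theorem leafSum_act (heven : ∀ x, F (-x) = F x) : ∀ j (g : TG j × ℤˣ) y (c : Tr (Sph n) j),
    leafSum F ε j (((g.2 : ℤ) : ℝ) • y)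
      ((treeAct ((negAct (Sph n)).comap mulMonoidHom) j).act g c) = leafSum F ε j y c
  | 0, ⟨_, γ⟩, y, _ => by
    rcases Int.units_eq_one_or γ with rfl | rfl <;> simp [leafSum, heven]
  | j + 1, ⟨⟨s, l, r⟩, γ⟩, y, ⟨v, L, R⟩ => by
    have h1 := leafSum_act heven j (l, γ) (y + (ε * 4 ^ j) • v.1) L
    have h2 := leafSum_act heven j (r, γ) (y - (ε * 4 ^ j) • v.1) R
    set α := (negAct (Sph n)).comap (mulMonoidHom (α := ℤˣ))
    change leafSum F ε j (((γ : ℤ) : ℝ) • y + (ε * 4 ^ j) • ((negAct (Sph n)).act (s * γ) v).1)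
        (swapIf s ((treeAct α j).act (l, γ) L, (treeAct α j).act (r, γ) R)).1 +
      leafSum F ε j (((γ : ℤ) : ℝ) • y - (ε * 4 ^ j) • ((negAct (Sph n)).act (s * γ) v).1)
        (swapIf s ((treeAct α j).act (l, γ) L, (treeAct α j).act (r, γ) R)).2 =
      leafSum F ε j (y + (ε * 4 ^ j) • v.1) L + leafSum F ε j (y - (ε * 4 ^ j) • v.1) R
    rw [← h1, ← h2, negAct_sph_val, smul_add, smul_sub]
    rcases Int.units_eq_one_or s with rfl | rfl
    · simp [swapIf, smul_comm (ε * 4 ^ j)]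
    · simp [swapIf, smul_comm (ε * 4 ^ j), add_comm, sub_eq_add_neg]

theorem leafDiff_act (heven : ∀ x, F (-x) = F x) : ∀ j (g : TG j × ℤˣ) y (c : Tr (Sph n) j),
    leafDiff F ε j (((g.2 : ℤ) : ℝ) • y)
      ((treeAct ((negAct (Sph n)).comap mulMonoidHom) j).act g c) =
      (vecTree n j).act g (leafDiff F ε j y c)
  | 0, _, _, _ => rfl
  | j + 1, ⟨⟨s, l, r⟩, γ⟩, y, ⟨v, L, R⟩ => by
    have h1 := leafSum_act ε heven j (l, γ) (y + (ε * 4 ^ j) • v.1) L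
    have h2 := leafSum_act ε heven j (r, γ) (y - (ε * 4 ^ j) • v.1) R
    have h3 := leafDiff_act heven j (l, γ) (y + (ε * 4 ^ j) • v.1) L
    have h4 := leafDiff_act heven j (r, γ) (y - (ε * 4 ^ j) • v.1) R
    set α := (negAct (Sph n)).comap (mulMonoidHom (α := ℤˣ))
    have e1 : (((γ : ℤ) : ℝ) • y + (ε * 4 ^ j) • ((negAct (Sph n)).act (s * γ) v).1) =
        if s = 1 then ((γ : ℤ) : ℝ) • (y + (ε * 4 ^ j) • v.1)
        else ((γ : ℤ) : ℝ) • (y - (ε * 4 ^ j) • v.1) := by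
      rw [negAct_sph_val]
      rcases Int.units_eq_one_or s with rfl | rfl <;>
        simp [smul_add, smul_comm (ε * 4 ^ j), sub_eq_add_neg]
    have e2 : (((γ : ℤ) : ℝ) • y - (ε * 4 ^ j) • ((negAct (Sph n)).act (s * γ) v).1) =
        if s = 1 then ((γ : ℤ) : ℝ) • (y - (ε * 4 ^ j) • v.1)
        else ((γ : ℤ) : ℝ) • (y + (ε * 4 ^ j) • v.1) := by
      rw [negAct_sph_val]
      rcases Int.units_eq_one_or s with rfl | rfl <;>
        simp [smul_add, smul_sub, smul_comm (ε * 4 ^ j)]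
    have key : ∀ y₁ y₂ : Fin n → ℝ,
        y₁ = (if s = 1 then ((γ : ℤ) : ℝ) • (y + (ε * 4 ^ j) • v.1)
          else ((γ : ℤ) : ℝ) • (y - (ε * 4 ^ j) • v.1)) →
        y₂ = (if s = 1 then ((γ : ℤ) : ℝ) • (y - (ε * 4 ^ j) • v.1)
          else ((γ : ℤ) : ℝ) • (y + (ε * 4 ^ j) • v.1)) →
        ∀ p, p = swapIf s ((treeAct α j).act (l, γ) L, (treeAct α j).act (r, γ) R) →
        ((leafSum F ε j y₁ p.1 - leafSum F ε j y₂ p.2,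
          (leafDiff F ε j y₁ p.1, leafDiff F ε j y₂ p.2)) :
            (Fin n → ℝ) × (Tr (Fin n → ℝ) j × Tr (Fin n → ℝ) j)) =
        ((negAct (Fin n → ℝ)).act s (leafSum F ε j (y + (ε * 4 ^ j) • v.1) L -
            leafSum F ε j (y - (ε * 4 ^ j) • v.1) R),
          swapIf s ((vecTree n j).act (l, γ) (leafDiff F ε j (y + (ε * 4 ^ j) • v.1) L),
            (vecTree n j).act (r, γ) (leafDiff F ε j (y - (ε * 4 ^ j) • v.1) R))) := by
      rintro _ _ rfl rfl _ rfl
      rw [← h1, ← h2, ← h3, ← h4]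
      rcases Int.units_eq_one_or s with rfl | rfl <;> simp [swapIf, negAct, Act.ofInv]
    exact key _ _ e1 e2 _ rfl

theorem smul_leaf_eq : ∀ j y (c : Tr (Sph n) j), leafDiff F ε j y c = constTree 0 j →
    ∀ a, (2 ^ j : ℝ) • F (leaf ε j y c a) = leafSum F ε j y c
  | 0, y, _, _, _ => by simp [leaf, leafSum]
  | j + 1, y, ⟨v, L, R⟩, h, a => by
    have h0 : leafSum F ε j (y + (ε * 4 ^ j) • v.1) L = leafSum F ε j (y - (ε * 4 ^ j) • v.1) R :=
      sub_eq_zero.1 (congrArg Prod.fst h)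
    have h1 := smul_leaf_eq j _ L (congrArg (fun t => t.2.1) h) (Fin.tail a)
    have h2 := smul_leaf_eq j _ R (congrArg (fun t => t.2.2) h) (Fin.tail a)
    change _ = leafSum F ε j (y + (ε * 4 ^ j) • v.1) L + leafSum F ε j (y - (ε * 4 ^ j) • v.1) R
    change _ • F (if a 0 then leaf ε j (y + (ε * 4 ^ j) • v.1) L (Fin.tail a)
      else leaf ε j (y - (ε * 4 ^ j) • v.1) R (Fin.tail a)) = _
    rw [pow_succ', mul_smul, two_smul]
    split_ifs
    · rw [h1, h0]
    · rw [h2, h0]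

variable {ε}

theorem dist_leaf_le (hε : 0 ≤ ε) : ∀ j y (c : Tr (Sph n) j) a,
    dist (leaf ε j y c a) y ≤ ε * (4 ^ j - 1) / 3
  | 0, y, _, _ => by simp [leaf]
  | j + 1, y, ⟨v, L, R⟩, a => by
    have hv : ‖v.1‖ = 1 := by simp
    have h1 := dist_leaf_le hε j (y + (ε * 4 ^ j) • v.1) L (Fin.tail a)
    have h2 := dist_leaf_le hε j (y - (ε * 4 ^ j) • v.1) R (Fin.tail a)
    have h3 : ‖(ε * 4 ^ j) • v.1‖ = ε * 4 ^ j := by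
      rw [norm_smul, hv, mul_one, Real.norm_of_nonneg (by positivity)]
    change dist (if a 0 then leaf ε j (y + (ε * 4 ^ j) • v.1) L (Fin.tail a)
      else leaf ε j (y - (ε * 4 ^ j) • v.1) R (Fin.tail a)) y ≤ _
    have h4 : ε * 4 ^ (j + 1) = 4 * (ε * 4 ^ j) := by ring
    split_ifs
    · refine (dist_triangle _ _ _).trans ((add_le_add_left h1 _).trans ?_)
      rw [dist_self_add_left, h3]
      linarith
    · refine (dist_triangle _ _ _).trans ((add_le_add_left h2 _).trans ?_)
      rw [dist_self_sub_left, h3]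
      linarith

theorem leaf_injective (hε : 0 < ε) : ∀ j y (c : Tr (Sph n) j), Function.Injective (leaf ε j y c)
  | 0, _, _ => Function.injective_of_subsingleton _
  | j + 1, y, ⟨v, L, R⟩ => by
    have hv : ‖v.1‖ = 1 := by simp
    have h3 : ‖(ε * 4 ^ j) • v.1‖ = ε * 4 ^ j := by
      rw [norm_smul, hv, mul_one, Real.norm_of_nonneg (by positivity)]
    have hne : ∀ a b, leaf ε j (y + (ε * 4 ^ j) • v.1) L a ≠ leaf ε j
      (y - (ε * 4 ^ j) • v.1) R b := by
      intro a b hab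
      have h1 := dist_leaf_le hε.le j (y + (ε * 4 ^ j) • v.1) L a
      have h2 := dist_leaf_le hε.le j (y - (ε * 4 ^ j) • v.1) R b
      rw [← hab] at h2
      have h4 := dist_triangle_left (y + (ε * 4 ^ j) • v.1) (y - (ε * 4 ^ j) • v.1)
        (leaf ε j (y + (ε * 4 ^ j) • v.1) L a)
      have h5 : dist (y + (ε * 4 ^ j) • v.1) (y - (ε * 4 ^ j) • v.1) = 2 * (ε * 4 ^ j) := by
        rw [dist_eq_norm, add_sub_sub_cancel, ← two_smul ℝ, norm_smul, h3]
        norm_num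
      have h6 : 0 < ε * 4 ^ j := by positivity
      linarith
    intro a b hab
    have ih1 := leaf_injective hε j (y + (ε * 4 ^ j) • v.1) L
    have ih2 := leaf_injective hε j (y - (ε * 4 ^ j) • v.1) R
    change (if a 0 then leaf ε j (y + (ε * 4 ^ j) • v.1) L (Fin.tail a)
      else leaf ε j (y - (ε * 4 ^ j) • v.1) R (Fin.tail a)) =
      (if b 0 then leaf ε j (y + (ε * 4 ^ j) • v.1) L (Fin.tail b)
      else leaf ε j (y - (ε * 4 ^ j) • v.1) R (Fin.tail b)) at hab
    rw [← Fin.cons_self_tail a, ← Fin.cons_self_tail b]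
    cases ha : a 0 <;> cases hb : b 0 <;> simp only [ha, hb, if_true, Bool.false_eq_true, if_false]
      at hab
    · rw [ih2 hab]
    · exact absurd hab.symm (hne _ _)
    · exact absurd hab (hne _ _)
    · rw [ih1 hab]

end Leaves

/-- A continuous even self-map of a space of dimension `2 ^ (r + 1) - 1` takes the same value at
`2 ^ r` distinct points that are arbitrarily close to each other. -/
theorem exists_injective_forall_eq {r k n : ℕ} (hk : k = 2 ^ r) (hn : n = 2 ^ (r + 1) - 1)
    {F : (Fin n → ℝ) → Fin n → ℝ} (hF : Continuous F) (heven : ∀ x, F (-x) = F x)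
    (ι : (Fin k → ℝ) →L[ℝ] (Fin n → ℝ)) {η : ℝ} (hη : 0 < η) :
    ∃ x : Fin k → ℝ, ‖x‖ = 1 ∧ ∃ X : (Fin r → Bool) → Fin n → ℝ, Function.Injective X ∧
      (∀ a, dist (X a) (ι x) < η) ∧ ∀ a b, F (X a) = F (X b) := by
  obtain ⟨⟨x, c⟩, h⟩ := exists_eq_zero_of_equivariant hk hn
    (fun p => leafDiff F (η / 4 ^ r) r (ι p.1.1) p.2)
    ((continuous_leafDiff _ hF r).comp (f := fun p : Sph k × Tr (Sph n) r => (ι p.1.1, p.2))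
      (by fun_prop)) (fun g x c => by
        dsimp only
        rw [negAct_sph_val, map_smul]
        exact leafDiff_act _ heven r g _ c)
  have hε : 0 < η / 4 ^ r := by positivity
  refine ⟨x.1, by simp, leaf (η / 4 ^ r) r (ι x.1) c, leaf_injective hε r _ _,
    fun a => (dist_leaf_le hε.le r _ _ a).trans_lt ?_, fun a b => ?_⟩
  · have h1 : η / 4 ^ r * 4 ^ r = η := div_mul_cancel₀ _ (by positivity)
    linarith
  · refine smul_right_injective _ (show (2 ^ r : ℝ) ≠ 0 by positivity) ?_
    exact (smul_leaf_eq _ r _ c h a).trans (smul_leaf_eq _ r _ c h b).symm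

section Chords

variable {E : Type} [NormedAddCommGroup E] [NormedSpace ℝ E] {K : Set E}

/-- The segment from `x` to `x + s • w` is a longest chord of `K` in the direction `w`. -/
def IsMaxChord (K : Set E) (w x : E) (s : ℝ) : Prop :=
  x ∈ K ∧ x + s • w ∈ K ∧ ∀ x' ∈ K, ∀ s', x' + s' • w ∈ K → s' ≤ s

theorem IsMaxChord.nonneg {w x : E} {s : ℝ} (h : IsMaxChord K w x s) : 0 ≤ s :=
  h.2.2 x h.1 0 (by simpa using h.1)

theorem IsMaxChord.neg {w x : E} {s : ℝ} (h : IsMaxChord K w x s) :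
    IsMaxChord K (-w) (x + s • w) s := by
  refine ⟨h.2.1, by simpa using h.1, fun x' hx' s' hs' => h.2.2 _ hs' s' ?_⟩
  simpa using hx'

theorem IsMaxChord.unique (hK : StrictConvex ℝ K) {w x x' : E} {s s' : ℝ}
    (h : IsMaxChord K w x s) (h' : IsMaxChord K w x' s') : x = x' ∧ s = s' := by
  have hs : s = s' := le_antisymm (h'.2.2 x h.1 s h.2.1) (h.2.2 x' h'.1 s' h'.2.1)
  subst hs
  refine ⟨by_contra fun hne => ?_, rfl⟩
  have h1 := hK h.1 h'.1 hne (a := 1 / 2) (b := 1 / 2) (by norm_num) (by norm_num) (by norm_num)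
  have h2 := hK h.2.1 h'.2.1 (fun e => hne (add_right_cancel e)) (a := 1 / 2) (b := 1 / 2)
    (by norm_num) (by norm_num) (by norm_num)
  have h3 : Tendsto (fun δ : ℝ => ((1 / 2 : ℝ) • x + (1 / 2 : ℝ) • x') + (s + δ) • w) (𝓝[>] 0)
      (𝓝 (((1 / 2 : ℝ) • x + (1 / 2 : ℝ) • x') + (s + 0) • w)) :=
    Continuous.tendsto (by fun_prop) _ |>.mono_left nhdsWithin_le_nhds
  have h4 : ((1 / 2 : ℝ) • x + (1 / 2 : ℝ) • x') + (s + 0) • w =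
      (1 / 2 : ℝ) • (x + s • w) + (1 / 2 : ℝ) • (x' + s • w) := by module
  rw [h4] at h3
  obtain ⟨δ, hδ, hδ0⟩ := ((h3.eventually (isOpen_interior.mem_nhds h2)).and
    self_mem_nhdsWithin).exists
  have := h.2.2 _ (interior_subset h1) (s + δ) (interior_subset hδ)
  have hδ0 : 0 < δ := hδ0
  linarith

theorem exists_isMaxChord (hK : IsCompact K) (hne : K.Nonempty) {w : E} (hw : w ≠ 0) :
    ∃ x s, IsMaxChord K w x s := by
  have hw' : 0 < ‖w‖ := norm_pos_iff.2 hw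
  let S : Set (E × ℝ) := {p | p.1 ∈ K ∧ p.1 + p.2 • w ∈ K}
  have hS : IsCompact S := by
    refine (hK.prod (isCompact_Icc (a := -(Metric.diam K / ‖w‖)) (b := Metric.diam K / ‖w‖))
      ).of_isClosed_subset ?_ ?_
    · exact (hK.isClosed.preimage continuous_fst).inter (hK.isClosed.preimage (by fun_prop))
    · rintro ⟨x, s⟩ ⟨h1, h2⟩
      refine ⟨h1, abs_le.1 ?_⟩
      have := Metric.dist_le_diam_of_mem hK.isBounded h2 h1
      rw [dist_self_add_left, norm_smul, Real.norm_eq_abs] at this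
      rwa [le_div_iff₀ hw']
  obtain ⟨x₀, hx₀⟩ := hne
  obtain ⟨⟨x, s⟩, h, hmax⟩ := hS.exists_isMaxOn ⟨(x₀, 0), hx₀, by simpa using hx₀⟩
    continuous_snd.continuousOn
  exact ⟨x, s, h.1, h.2, fun x' hx' s' hs' => hmax (a := (x', s')) ⟨hx', hs'⟩⟩

theorem IsMaxChord.norm_le_diam (hK : IsCompact K) {w x : E} {s : ℝ} (h : IsMaxChord K w x s) :
    s * ‖w‖ ≤ Metric.diam K := by
  have := Metric.dist_le_diam_of_mem hK.isBounded h.2.1 h.1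
  rwa [dist_self_add_left, norm_smul, Real.norm_of_nonneg h.nonneg] at this

theorem IsMaxChord.two_mul_le {w x z : E} {s ρ : ℝ} (hw : w ≠ 0) (hρ : 0 ≤ ρ)
    (hz : Metric.closedBall z ρ ⊆ K) (h : IsMaxChord K w x s) : 2 * ρ ≤ s * ‖w‖ := by
  have hw' : 0 < ‖w‖ := norm_pos_iff.2 hw
  have h1 : ‖(ρ / ‖w‖) • w‖ = ρ := by
    rw [norm_smul, Real.norm_of_nonneg (by positivity), div_mul_cancel₀ _ hw'.ne']
  rw [← div_le_iff₀ hw']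
  refine h.2.2 (z - (ρ / ‖w‖) • w) (hz ?_) _ (hz ?_)
  · rw [Metric.mem_closedBall, dist_self_sub_left, h1]
  · have : z - (ρ / ‖w‖) • w + (2 * ρ / ‖w‖) • w = z + (ρ / ‖w‖) • w := by module
    rw [this, Metric.mem_closedBall, dist_self_add_left, h1]

theorem isMaxChord_of_tendsto (hK : IsCompact K) (hconv : Convex ℝ K)
    (hinner : (interior K).Nonempty)
    {w x : E} {s : ℝ} {X : E → E} {S : E → ℝ} {l : Filter E} [l.NeBot] (hl : l ≤ 𝓝 w)
    (hX : ∀ᶠ u in l, IsMaxChord K u (X u) (S u)) (hx : Tendsto X l (𝓝 x))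
    (hs : Tendsto S l (𝓝 s)) : IsMaxChord K w x s := by
  obtain ⟨z, hz⟩ := hinner
  have hid : Tendsto (fun u : E => u) l (𝓝 w) := hl
  refine ⟨hK.isClosed.mem_of_tendsto hx (hX.mono fun u h => h.1),
    hK.isClosed.mem_of_tendsto (hx.add (hs.smul hid)) (hX.mono fun u h => h.2.1),
    fun x' hx' s' hs' => ?_⟩
  have key : ∀ᶠ t in 𝓝[>] (0 : ℝ), (1 - t) * s' ≤ s := by
    filter_upwards [Ioo_mem_nhdsGT (zero_lt_one' ℝ)] with t ht
    refine ge_of_tendsto hs ?_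
    have h1 := hconv.combo_interior_closure_mem_interior hz (subset_closure hx') ht.1
      (sub_nonneg.2 ht.2.le) (by ring)
    have h2 := hconv.combo_interior_closure_mem_interior hz (subset_closure hs') ht.1
      (sub_nonneg.2 ht.2.le) (by ring)
    have h3 : t • z + (1 - t) • (x' + s' • w) = t • z + (1 - t) • x' + ((1 - t) * s') • w := by
      module
    rw [h3] at h2
    have h4 : Tendsto (fun u => t • z + (1 - t) • x' + ((1 - t) * s') • u) l
        (𝓝 (t • z + (1 - t) • x' + ((1 - t) * s') • w)) := tendsto_const_nhds.add (hid.const_smul _)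
    filter_upwards [hX, h4.eventually (isOpen_interior.mem_nhds h2)] with u hu hu'
    exact hu.2.2 _ (interior_subset h1) _ (interior_subset hu')
  have h5 : Tendsto (fun t : ℝ => (1 - t) * s') (𝓝[>] 0) (𝓝 ((1 - 0) * s')) :=
    Continuous.tendsto (by fun_prop) _ |>.mono_left nhdsWithin_le_nhds
  simpa using le_of_tendsto h5 key

/-- The midpoint of a longest chord depends continuously on the direction. -/
theorem exists_continuous_midpoint (hK : IsCompact K) (hstrict : StrictConvex ℝ K)
    (hinner : (interior K).Nonempty) :
    ∃ c : E → E, (∀ w ≠ 0, ContinuousAt c w) ∧ (∀ w, c w ∈ K) ∧ (∀ w, c (-w) = c w) ∧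
      ∀ w ≠ 0, ∃ s, IsMaxChord K w (c w - (s / 2) • w) s := by
  obtain ⟨z, hz⟩ := hinner
  have hzK := interior_subset hz
  choose X S hXK hXS using fun w : E => show ∃ x s, x + (s / 2) • w ∈ K ∧
    (w ≠ 0 → IsMaxChord K w x s) by
    by_cases hw : w = 0
    · exact ⟨z, 0, by simpa using hzK, fun h => absurd hw h⟩
    · obtain ⟨x, s, h⟩ := exists_isMaxChord hK ⟨z, hzK⟩ hw
      refine ⟨x, s, ?_, fun _ => h⟩
      have h1 := hstrict.convex h.1 h.2.1 (a := 1 / 2) (b := 1 / 2) (by norm_num) (by norm_num)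
        (by norm_num)
      convert h1 using 1
      module
  have hcont : ∀ w ≠ 0, ContinuousAt (fun u => (X u, S u)) w := by
    intro w hw
    have hw' : 0 < ‖w‖ := norm_pos_iff.2 hw
    have hev : ∀ᶠ u in 𝓝 w, u ≠ 0 := isOpen_ne.mem_nhds hw
    have hev' : ∀ᶠ u in 𝓝 w, ‖w‖ / 2 < ‖u‖ :=
      continuous_norm.continuousAt.eventually (lt_mem_nhds (half_lt_self hw'))
    refine (hK.prod (isCompact_Icc (a := 0) (b := Metric.diam K / (‖w‖ / 2)))
      ).tendsto_nhds_of_unique_mapClusterPt ?_ ?_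
    · filter_upwards [hev, hev'] with u hu hu'
      have h := hXS u hu
      refine ⟨h.1, h.nonneg, ?_⟩
      rw [le_div_iff₀ (half_pos hw')]
      exact (mul_le_mul_of_nonneg_left hu'.le h.nonneg).trans (h.norm_le_diam hK)
    · rintro ⟨x, s⟩ - h
      obtain ⟨U, hU, hU'⟩ := mapClusterPt_iff_ultrafilter.1 h
      have := isMaxChord_of_tendsto hK hstrict.convex ⟨z, hz⟩ hU
        (Filter.Eventually.filter_mono hU (hev.mono fun u hu => hXS u hu))
        ((continuous_fst.tendsto _).comp hU') ((continuous_snd.tendsto _).comp hU')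
      obtain ⟨h1, h2⟩ := this.unique hstrict (hXS w hw)
      exact Prod.ext h1 h2
  refine ⟨fun w => X w + (S w / 2) • w, fun w hw => ?_, hXK, fun w => ?_, fun w hw => ⟨S w, ?_⟩⟩
  · exact (continuous_fst.continuousAt.comp (hcont w hw)).add
      (((continuous_snd.continuousAt.comp (hcont w hw)).div_const 2).smul continuousAt_id)
  · by_cases hw : w = 0
    · simp [hw]
    · obtain ⟨h1, h2⟩ := (hXS w hw).neg.unique hstrict (hXS _ (neg_ne_zero.2 hw))
      dsimp only
      rw [← h1, ← h2]
      module
  · rw [add_sub_cancel_right]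
    exact hXS w hw

end Chords

theorem isAffineDiameter_of_isMaxChord {m : ℕ} {K : Set (EuclideanSpace ℝ (Fin m))}
    (hK : IsCompact K) {w x v : EuclideanSpace ℝ (Fin m)} {s t : ℝ} (h : IsMaxChord K w x s)
    (hx : x = v + t • w) : IsAffineDiameter K w {p | ∃ t : ℝ, p = v + t • w} := by
  refine ⟨⟨v, rfl⟩, ?_⟩
  rintro _ ⟨u, rfl⟩
  have h1 : s * ‖w‖ ≤ Metric.diam (K ∩ {p | ∃ t : ℝ, p = v + t • w}) := by
    have := Metric.dist_le_diam_of_mem (s := K ∩ {p | ∃ t : ℝ, p = v + t • w})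
      (hK.isBounded.subset Set.inter_subset_left) ⟨h.2.1, t + s, by rw [hx]; module⟩ ⟨h.1, t, hx⟩
    rwa [dist_self_add_left, norm_smul, Real.norm_of_nonneg h.nonneg] at this
  refine (Metric.diam_le_of_forall_dist_le (mul_nonneg h.nonneg (norm_nonneg w)) ?_).trans h1
  rintro _ ⟨hp, a, rfl⟩ _ ⟨hq, b, rfl⟩
  rw [dist_add_left, dist_eq_norm, ← sub_smul, norm_smul, Real.norm_eq_abs]
  refine mul_le_mul_of_nonneg_right (abs_le.2 ⟨?_, ?_⟩) (norm_nonneg w)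
  · have e : u + a • w + (b - a) • w = u + b • w := by module
    have := h.2.2 _ hp (b - a) (e ▸ hq)
    linarith
  · have e : u + b • w + (a - b) • w = u + a • w := by module
    exact h.2.2 _ hq (a - b) (e ▸ hp)

/-- The affine diameters of a strictly convex body near a suitable direction. -/
theorem exists_affineDiameters {r m k n : ℕ} (hk : k = 2 ^ r) (hn : n = 2 ^ (r + 1) - 1)
    (hmn : n = m + 1) (hkm : k ≤ m) {K : Set (EuclideanSpace ℝ (Fin m))} (hK : IsCompact K)
    (hinner : (interior K).Nonempty) (hstrict : StrictConvex ℝ K) :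
    ∃ L : (Fin r → Bool) → Set (EuclideanSpace ℝ (Fin m)), Function.Injective L ∧
      (∀ i, ∃ w, w ≠ 0 ∧ IsAffineDiameter K w (L i)) ∧ ∃ z, z ∈ interior K ∧ ∀ i, z ∈ L i := by
  obtain ⟨c, hc, hcK, hcneg, hcmax⟩ := exists_continuous_midpoint hK hstrict hinner
  obtain ⟨z, hz⟩ := hinner
  obtain ⟨ρ, hρ, hρK⟩ := Metric.nhds_basis_closedBall.mem_iff.1 (mem_interior_iff_mem_nhds.1 hz)
  obtain ⟨R, hR⟩ := hK.isBounded.exists_norm_le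
  obtain ⟨j, hj⟩ := finrank_le_iff_exists_linearMap.1
    (show Module.finrank ℝ (Fin k → ℝ) ≤ Module.finrank ℝ (EuclideanSpace ℝ (Fin m)) by
        simpa using hkm)
  obtain ⟨A, hA, hjA⟩ := j.exists_antilipschitzWith (LinearMap.ker_eq_bot.2 hj)
  let e : (EuclideanSpace ℝ (Fin m) × ℝ) ≃L[ℝ] (Fin n → ℝ) :=
    ContinuousLinearEquiv.ofFinrankEq (by simp [hmn])
  let G : EuclideanSpace ℝ (Fin m) × ℝ → EuclideanSpace ℝ (Fin m) × ℝ :=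
    fun p => (‖p.1‖ • c p.1 + p.2 • p.1, ‖p.1‖)
  have hcont : Continuous fun w : EuclideanSpace ℝ (Fin m) => ‖w‖ • c w := by
    rw [continuous_iff_continuousAt]
    intro w
    by_cases hw : w = 0
    · subst hw
      rw [ContinuousAt, norm_zero, zero_smul]
      refine squeeze_zero_norm (a := fun w => ‖w‖ * R) (fun w => ?_) ?_
      · rw [norm_smul, norm_norm]
        exact mul_le_mul_of_nonneg_left (hR _ (hcK w)) (norm_nonneg w)
      · have : Continuous fun w : EuclideanSpace ℝ (Fin m) => ‖w‖ * R := by fun_prop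
        simpa using this.tendsto 0
    · exact continuous_norm.continuousAt.smul (hc w hw)
  have hG : Continuous G := by
    refine ((hcont.comp continuous_fst).add ?_).prodMk ?_ <;> fun_prop
  have hGneg : ∀ p, G (-p) = G p := fun p => by simp [G, hcneg]
  obtain ⟨C, hC⟩ : ∃ C : ℝ, ∀ v, ‖e.symm v‖ ≤ C * ‖v‖ :=
    ⟨_, (e.symm : (Fin n → ℝ) →L[ℝ] EuclideanSpace ℝ (Fin m) × ℝ).le_opNorm⟩
  obtain ⟨η, hη, hη1, hη2⟩ : ∃ η : ℝ, 0 < η ∧ η ≤ ρ ∧ η * A < 1 := by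
    have hA' : (0 : ℝ) < A := hA
    refine ⟨min ρ (1 / (2 * A)), by positivity, min_le_left _ _, ?_⟩
    refine (mul_le_mul_of_nonneg_right (min_le_right _ _) hA'.le).trans_lt ?_
    field_simp
    norm_num
  obtain ⟨x, hx, X, hX, hXη, hXF⟩ := exists_injective_forall_eq hk hn
    (F := fun v => e (G (e.symm v))) (by fun_prop) (fun v => by simp [hGneg])
    ((e : (EuclideanSpace ℝ (Fin m) × ℝ) →L[ℝ] (Fin n → ℝ)).comp
      ((ContinuousLinearMap.inl ℝ _ ℝ).comp (LinearMap.toContinuousLinearMap j)))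
    (η := η / (|C| + 1)) (by positivity)
  have hjx : η < ‖j x‖ := by
    have h1 := hjA.le_mul_dist x 0
    rw [map_zero, dist_zero_right, dist_zero_right, hx] at h1
    have hA' : (0 : ℝ) < A := hA
    nlinarith
  have hnear : ∀ a, ‖e.symm (X a) - (j x, 0)‖ < η := by
    intro a
    have h1 := hC (X a - e (j x, 0))
    rw [map_sub, e.symm_apply_apply] at h1
    refine h1.trans_lt ?_
    have h2 : ‖X a - e (j x, 0)‖ < η / (|C| + 1) := by
      rw [← dist_eq_norm]
      exact hXη a
    rw [lt_div_iff₀ (by positivity)] at h2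
    nlinarith [le_abs_self C, norm_nonneg (X a - e (j x, 0))]
  have hw : ∀ a, ‖(e.symm (X a)).1 - j x‖ < η := fun a =>
    (norm_fst_le (e.symm (X a) - (j x, 0))).trans_lt (hnear a)
  have ht : ∀ a, |(e.symm (X a)).2| < η := fun a => by
    have := (norm_snd_le (e.symm (X a) - (j x, 0))).trans_lt (hnear a)
    simpa using this
  have hinj : Function.Injective fun a => e.symm (X a) := e.symm.injective.comp hX
  have hGeq : ∀ a b, G (e.symm (X a)) = G (e.symm (X b)) := fun a b => e.injective (hXF a b)
  generalize hY : (fun a => e.symm (X a)) = Y at hinj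
  have hYa : ∀ a, e.symm (X a) = Y a := fun a => congrFun hY a
  simp only [hYa] at hw ht hGeq
  have hw0 : ∀ a, (Y a).1 ≠ 0 := fun a h0 => by
    have := hw a
    rw [h0, zero_sub, norm_neg] at this
    exact lt_asymm this hjx
  have hnorm : ∀ a b, ‖(Y a).1‖ = ‖(Y b).1‖ := fun a b => congrArg Prod.snd (hGeq a b)
  have hpt : ∀ a b, ‖(Y a).1‖ • c (Y a).1 + (Y a).2 • (Y a).1 =
    ‖(Y b).1‖ • c (Y b).1 + (Y b).2 • (Y b).1 := fun a b => congrArg Prod.fst (hGeq a b)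
  let z (a : Fin r → Bool) := c (Y a).1 + ((Y a).2 / ‖(Y a).1‖) • (Y a).1
  have hzz : ∀ a, ‖(Y a).1‖ • z a = ‖(Y a).1‖ • c (Y a).1 + (Y a).2 • (Y a).1 := fun a => by
    rw [smul_add, smul_smul, mul_div_cancel₀ _ (norm_ne_zero_iff.2 (hw0 a))]
  have hz_eq : ∀ a b, z a = z b := fun a b => by
    refine smul_right_injective _ (norm_ne_zero_iff.2 (hw0 a)) ?_
    change ‖(Y a).1‖ • z a = ‖(Y a).1‖ • z b
    rw [hzz, hpt a b, hnorm a b, hzz]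
  refine ⟨fun a => {p | ∃ t : ℝ, p = c (Y a).1 + t • (Y a).1}, fun a b hab => ?_,
    fun a => ⟨(Y a).1, hw0 a, ?_⟩, z (fun _ => true), ?_, fun a => ?_⟩
  · have hmem : ∀ τ : ℝ, ∃ t : ℝ, c (Y a).1 + τ • (Y a).1 = c (Y b).1 + t • (Y b).1 := fun τ =>
      (congrArg (c (Y a).1 + τ • (Y a).1 ∈ ·) hab).mp ⟨τ, rfl⟩
    obtain ⟨t₀, h₀⟩ := hmem 0
    obtain ⟨t₁, h₁⟩ := hmem 1
    have h2 : (Y a).1 = (t₁ - t₀) • (Y b).1 := by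
      rw [sub_smul, ← add_sub_add_left_eq_sub _ _ (c (Y b).1), ← h₁, ← h₀]
      module
    have h3 := hnorm a b
    rw [h2, norm_smul, Real.norm_eq_abs, mul_eq_right₀ (norm_ne_zero_iff.2 (hw0 b))] at h3
    have h4 : (Y a).1 = (Y b).1 := by
      rcases (abs_eq zero_le_one).1 h3 with h | h
      · rw [h2, h, one_smul]
      · exfalso
        rw [h, neg_one_smul] at h2
        have h5 : ‖(2 : ℝ) • j x‖ ≤ ‖(Y a).1 - j x‖ + ‖(Y b).1 - j x‖ := by
          rw [← norm_neg ((2 : ℝ) • j x)]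
          refine le_of_eq_of_le (congrArg _ ?_) (norm_add_le _ _)
          rw [h2]
          module
        rw [norm_smul, Real.norm_of_nonneg zero_le_two] at h5
        linarith [hw a, hw b]
    have h5 := hpt a b
    rw [h4] at h5
    exact hinj (Prod.ext h4 (smul_left_injective ℝ (hw0 b) (add_left_cancel h5)))
  · obtain ⟨s, hs⟩ := hcmax _ (hw0 a)
    exact isAffineDiameter_of_isMaxChord hK hs (t := -(s / 2)) (by module)
  · generalize (fun _ => true : Fin r → Bool) = a
    obtain ⟨s, hs⟩ := hcmax _ (hw0 a)
    have hw' : 0 < ‖(Y a).1‖ := norm_pos_iff.2 (hw0 a)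
    have h1 := hs.two_mul_le (hw0 a) hρ.le hρK
    have h2 : |(Y a).2 / ‖(Y a).1‖| < s / 2 := by
      rw [abs_div, abs_norm, div_lt_iff₀ hw']
      linarith [ht a]
    have hs0 : 0 < s := by linarith [abs_nonneg ((Y a).2 / ‖(Y a).1‖)]
    obtain ⟨h3, h4⟩ := abs_lt.1 h2
    refine hstrict.openSegment_subset hs.1 hs.2.1 ?_ ?_
    · intro h
      exact (smul_ne_zero hs0.ne' (hw0 a)) (left_eq_add.1 h)
    · refine ⟨1 / 2 - (Y a).2 / ‖(Y a).1‖ / s, 1 / 2 + (Y a).2 / ‖(Y a).1‖ / s, ?_, ?_, by ring, ?_⟩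
      · rw [sub_pos, div_lt_iff₀ hs0]
        linarith
      · rw [← neg_lt_iff_pos_add', lt_div_iff₀ hs0]
        linarith
      · have h5 : (Y a).2 / ‖(Y a).1‖ / s * s = (Y a).2 / ‖(Y a).1‖ := div_mul_cancel₀ _ hs0.ne'
        generalize (Y a).2 / ‖(Y a).1‖ / s = τ at h5
        change _ = c (Y a).1 + ((Y a).2 / ‖(Y a).1‖) • (Y a).1
        rw [← h5]
        module
  · rw [hz_eq _ a]
    exact ⟨_, rfl⟩

end AffineDiameter

/-- For `m = 2^ℓ - 2` and `k = 2^(ℓ-1)`, every strictly convex body in `ℝ^m` has `k`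
pairwise distinct affine diameters meeting at a common interior point. -/
theorem exists_concurrent_affineDiameters
    (ℓ : ℕ) (hℓ : 2 ≤ ℓ) (K : Set (EuclideanSpace ℝ (Fin (2 ^ ℓ - 2))))
    (hKcomp : IsCompact K) (hKconv : Convex ℝ K) (hKint : (interior K).Nonempty)
    (hKstrict : StrictConvex ℝ K) :
    ∃ L : Fin (2 ^ (ℓ - 1)) → Set (EuclideanSpace ℝ (Fin (2 ^ ℓ - 2))),
      Function.Injective L ∧
        (∀ i, ∃ w : EuclideanSpace ℝ (Fin (2 ^ ℓ - 2)), w ≠ 0 ∧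
          IsAffineDiameter K w (L i)) ∧
        ∃ z, z ∈ interior K ∧ ∀ i, z ∈ L i := by
  obtain ⟨r, rfl⟩ : ∃ r, ℓ = r + 1 := ⟨ℓ - 1, by omega⟩
  have h2 : 2 ≤ 2 ^ r := Nat.le_self_pow (by omega) 2
  have h3 : 2 ^ (r + 1) = 2 * 2 ^ r := pow_succ' 2 r
  obtain ⟨L, hL, hd, z, hz, hzL⟩ := AffineDiameter.exists_affineDiameters (r := r)
    (m := 2 ^ (r + 1) - 2) rfl rfl (by omega) (by omega) hKcomp hKint hKstrict
  let e : Fin (2 ^ (r + 1 - 1)) ≃ (Fin r → Bool) := (Fintype.equivFinOfCardEq (by simp)).symm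
  exact ⟨L ∘ e, hL.comp e.injective, fun i => hd _, z, hz, fun i => hzL _⟩
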